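/- Let p be an odd prime, G = C₄ × C_p × C_p, K ∈ Sup₂^min(G_r), and 𝒜 = V(K,G). Then one of the following holds: (1) rk(𝒜) = 2; (2) 𝒜 is the tensor product of two S-rings over proper nontrivial subgroups of G; (3) 𝒜 is a nontrivial S = U/L-wreath product for some 𝒜-section S = U/L, satisfying one of the conditions (CA), (CA'), (CA''). -/

import Mathlib

open scoped Pointwise

noncomputable section

namespace Paper

/-- The element `∑_{x ∈ X} x` of the integer group ring `ℤG`. -/
def sumElems {G : Type*} [Group G] [Finite G] (X : Set G) : MonoidAlgebra ℤ G :=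
  ∑ x ∈ X.toFinite.toFinset, MonoidAlgebra.single x (1 : ℤ)

/-- A Schur ring (S-ring) over a finite group `G`, described by the partition of `G`
into its basic sets: the partition contains `{1}`, is closed under taking inverses,
and its `ℤ`-span inside the group ring `ℤG` is closed under multiplication
(hence is a subring of `ℤG`). -/
structure SRing (G : Type*) [Group G] [Finite G] where
  basic : Set (Set G)
  nonempty : ∀ X ∈ basic, X.Nonempty
  cover : ∀ g : G, ∃! X, X ∈ basic ∧ g ∈ X
  one_mem : ({1} : Set G) ∈ basic
  inv_mem : ∀ X ∈ basic, X⁻¹ ∈ basic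
  mul_mem : ∀ a b : MonoidAlgebra ℤ G,
    a ∈ Submodule.span ℤ (sumElems '' basic) →
    b ∈ Submodule.span ℤ (sumElems '' basic) →
    a * b ∈ Submodule.span ℤ (sumElems '' basic)

namespace SRing

/-- The `ℤ`-module underlying an S-ring. -/
def span {G : Type*} [Group G] [Finite G] (A : SRing G) :
    Submodule ℤ (MonoidAlgebra ℤ G) :=
  Submodule.span ℤ (sumElems '' A.basic)

/-- A set `X ⊆ G` is an `𝒜`-set if `∑_{x ∈ X} x ∈ 𝒜`. -/
def IsASet {G : Type*} [Group G] [Finite G] (A : SRing G) (X : Set G) : Prop :=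
  sumElems X ∈ A.span

/-- A subgroup which is an `𝒜`-set is an `𝒜`-subgroup. -/
def IsASubgroup {G : Type*} [Group G] [Finite G] (A : SRing G) (H : Subgroup G) : Prop :=
  A.IsASet (H : Set G)

end SRing

/-- The arc set `R(X) = {(g, xg) : x ∈ X, g ∈ G}` of the Cayley digraph `Cay(G, X)`. -/
def Rel {G : Type*} [Group G] (X : Set G) : Set (G × G) := {p | p.2 * p.1⁻¹ ∈ X}

/-- `f : G ≃ G'` is an isomorphism from the S-ring `A` over `G` to the S-ring `B`
over `G'` if `{R(X)^f : X ∈ 𝒮(A)} = {R(Y) : Y ∈ 𝒮(B)}`. -/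
def IsSRingIso {G G' : Type*} [Group G] [Finite G] [Group G'] [Finite G']
    (A : SRing G) (B : SRing G') (f : G ≃ G') : Prop :=
  (fun X => Prod.map f f '' Rel X) '' A.basic = Rel '' B.basic

/-- The automorphism group `Aut(𝒜)` of an S-ring, as a set of permutations of `G`. -/
def SRing.autSet {G : Type*} [Group G] [Finite G] (A : SRing G) : Set (Equiv.Perm G) :=
  {f | ∀ X ∈ A.basic, Prod.map f f '' Rel X = Rel X}

/-- The set `Iso(𝒜)` of isomorphisms from `𝒜` onto S-rings over the same group `G`. -/
def SRing.isoSet {G : Type*} [Group G] [Finite G] (A : SRing G) : Set (Equiv.Perm G) :=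
  {f | ∃ B : SRing G, IsSRingIso A B f}

/-- `Aut(G)` as a set of permutations of `G`. -/
def autPerm (G : Type*) [Group G] : Set (Equiv.Perm G) :=
  Set.range fun φ : G ≃* G => (φ.toEquiv : Equiv.Perm G)

/-- A CI-S-ring: `Aut(𝒜)·Aut(G) = Iso(𝒜)`. -/
def SRing.IsCI {G : Type*} [Group G] [Finite G] (A : SRing G) : Prop :=
  A.autSet * autPerm G = A.isoSet

/-- The orbits on `G` of a set of automorphisms of `G`. -/
def setOrbits {G : Type*} [Group G] (Δ : Set (MulAut G)) : Set (Set G) :=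
  Set.range fun g : G => (fun φ : MulAut G => φ g) '' Δ

/-- An S-ring is cyclotomic if its basic sets are exactly the orbits of some
subgroup `K ≤ Aut(G)`. -/
def SRing.IsCyclotomic {G : Type*} [Group G] [Finite G] (A : SRing G) : Prop :=
  ∃ K : Subgroup (MulAut G), A.basic = setOrbits (K : Set (MulAut G))

/-- `Aut_G(𝒜) = Aut(𝒜) ∩ Aut(G)`, as a set of automorphisms of `G`. -/
def SRing.autGSet {G : Type*} [Group G] [Finite G] (A : SRing G) : Set (MulAut G) :=
  {φ | (φ.toEquiv : Equiv.Perm G) ∈ A.autSet}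

/-- A (cyclotomic) S-ring is Cayley minimal if `Aut_G(𝒜)` is the only subgroup of
`Aut(G)` whose orbits on `G` coincide with those of `Aut_G(𝒜)`. -/
def SRing.IsCayleyMinimal {G : Type*} [Group G] [Finite G] (A : SRing G) : Prop :=
  ∀ K : Subgroup (MulAut G),
    setOrbits (K : Set (MulAut G)) = setOrbits A.autGSet →
    (K : Set (MulAut G)) = A.autGSet

/-- `rad(X) = {g ∈ G : gX = Xg = X}`. -/
def rad {G : Type*} [Group G] (X : Set G) : Set G := {g | {g} * X = X ∧ X * {g} = X}

/-- The class `𝓔_c` of finite abelian groups all of whose Sylow subgroups are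
elementary abelian or isomorphic to `C₄`. -/
def InEc (G : Type*) [CommGroup G] [Finite G] : Prop :=
  ∀ p : ℕ, p.Prime → ∀ P : Sylow p G,
    (∀ x : ↥(P : Subgroup G), x ^ p = 1) ∨
    Nonempty (↥(P : Subgroup G) ≃* Multiplicative (ZMod 4))

/-- A finite group `G` is a `DCI`-group if any two Cayley digraphs over `G` that are
isomorphic as digraphs are Cayley isomorphic. -/
def IsDCIGroup (G : Type*) [Group G] : Prop :=
  ∀ S T : Set G,
    (∃ f : G ≃ G, ∀ g h : G, h * g⁻¹ ∈ S ↔ f h * (f g)⁻¹ ∈ T) →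
    ∃ φ : G ≃* G, ⇑φ '' S = T

/-- The subgroup `G_r ≤ Sym(G)` of right translations of `G`. -/
def rightTranslations (G : Type*) [Group G] : Subgroup (Equiv.Perm G) where
  carrier := Set.range fun g : G => Equiv.mulRight g
  one_mem' := ⟨1, by ext x; simp⟩
  mul_mem' := by
    rintro _ _ ⟨a, rfl⟩ ⟨b, rfl⟩
    exact ⟨b * a, by ext x; simp [mul_assoc]⟩
  inv_mem' := by
    rintro _ ⟨a, rfl⟩
    exact ⟨a⁻¹, by ext x; simp⟩

/-- The basic sets of the S-ring `V(K, G)`: the orbits of the stabilizer `K_e`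
of the identity on `G`. -/
def VBasic {G : Type*} [Group G] (K : Subgroup (Equiv.Perm G)) : Set (Set G) :=
  Set.range fun g : G => MulAction.orbit (MulAction.stabilizer K (1 : G)) g

/-- A subgroup `R ≤ Sym(G)` is regular if for all `g, h ∈ G` there is a
unique `r ∈ R` with `r(g) = h`. -/
def IsRegularSubgroup {G : Type*} [Group G] (R : Subgroup (Equiv.Perm G)) : Prop :=
  ∀ g h : G, ∃! r : R, (r : Equiv.Perm G) g = h

/-- `K ∈ Sup(G_r)`. -/
def InSup {G : Type*} [Group G] (K : Subgroup (Equiv.Perm G)) : Prop :=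
  rightTranslations G ≤ K

/-- `K ∈ Sup₂(G_r)`, i.e. `K ≥ G_r` and `K = K^{(2)} = Aut(V(K,G))`. -/
def InSup2 {G : Type*} [Group G] [Finite G] (K : Subgroup (Equiv.Perm G)) : Prop :=
  InSup K ∧
    (K : Set (Equiv.Perm G)) =
      {f : Equiv.Perm G | ∀ X ∈ VBasic K, Prod.map (⇑f) (⇑f) '' Rel X = Rel X}

/-- `K₁ ⪯_G K₂`: `K₁ ≤ K₂` and every regular subgroup of `K₂` isomorphic to `G`
is conjugate in `K₂` to a subgroup of `K₁`. -/
def GComplete {G : Type*} [Group G] (K₁ K₂ : Subgroup (Equiv.Perm G)) : Prop :=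
  K₁ ≤ K₂ ∧ ∀ R : Subgroup (Equiv.Perm G), R ≤ K₂ → IsRegularSubgroup R →
    Nonempty (↥R ≃* G) → ∃ k ∈ K₂, ∀ r ∈ R, k * r * k⁻¹ ∈ K₁

/-- `K ∈ Sup₂^min(G_r)`: a minimal element of `Sup₂(G_r)` with respect to `⪯_G`. -/
def InSup2Min {G : Type*} [Group G] [Finite G] (K : Subgroup (Equiv.Perm G)) : Prop :=
  InSup2 K ∧ ∀ K' : Subgroup (Equiv.Perm G), InSup2 K' → GComplete K' K → K' = K

/-- The basic sets of the restriction `𝒜_U` of `𝒜` to an `𝒜`-subgroup `U`: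
the basic sets of `𝒜` contained in `U`, viewed inside `U`. -/
def restrictBasic {G : Type*} [Group G] [Finite G] (A : SRing G) (U : Subgroup G) :
    Set (Set ↥U) :=
  {Y : Set ↥U | Subtype.val '' Y ∈ A.basic}

/-- The basic sets of the quotient S-ring `𝒜_{G/L}`: the images of the basic
sets of `𝒜` under the canonical epimorphism `G → G/L`. -/
def quotBasic {G : Type*} [CommGroup G] [Finite G] (A : SRing G) (L : Subgroup G) :
    Set (Set (G ⧸ L)) :=
  (fun X => QuotientGroup.mk '' X) '' A.basic

/-- The basic sets of the S-ring `𝒜_S` on the section `S = U/L`: the images under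
the canonical epimorphism `U → U/L` of the basic sets of `𝒜` contained in `U`. -/
def secBasic {G : Type*} [CommGroup G] [Finite G] (A : SRing G) (U L : Subgroup G) :
    Set (Set (↥U ⧸ L.subgroupOf U)) :=
  {Z | ∃ X ∈ A.basic, X ⊆ (U : Set G) ∧
    Z = QuotientGroup.mk '' (Subtype.val ⁻¹' X : Set ↥U)}

/-- The set of bijections of `H ⧸ N` induced by members of `Δ ⊆ Sym(H)`
permuting the `N`-cosets. -/
def inducedOnQuot {H : Type*} [CommGroup H] (N : Subgroup H) (Δ : Set (Equiv.Perm H)) :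
    Set (Equiv.Perm (H ⧸ N)) :=
  {σ | ∃ f ∈ Δ, ∀ x : H, σ (QuotientGroup.mk x) = QuotientGroup.mk (f x)}

/-- The canonical (injective) homomorphism `U/L → G/L` for `L ≤ U ≤ G`. -/
def secIncl {G : Type*} [CommGroup G] (U L : Subgroup G) :
    (↥U ⧸ L.subgroupOf U) →* G ⧸ L :=
  QuotientGroup.map (L.subgroupOf U) L U.subtype (fun _ hx => hx)

/-- The set of bijections of the section `S = U/L` induced by members of
`Δ ⊆ Sym(G/L)` preserving `S` (i.e. permuting the `L`-cosets contained in `U`). -/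
def inducedOnSec {G : Type*} [CommGroup G] (U L : Subgroup G)
    (Δ : Set (Equiv.Perm (G ⧸ L))) : Set (Equiv.Perm (↥U ⧸ L.subgroupOf U)) :=
  {σ | ∃ φ ∈ Δ, ∀ x : ↥U,
    φ (QuotientGroup.mk (x : G) : G ⧸ L) = secIncl U L (σ (QuotientGroup.mk x))}

/-- The basic sets of the S-ring `(ℤL ⊗ 𝒜_V) ≀_{(V×L)/V} ℤ(U/V)` over `U`,
where `Lu, V ≤ U` and `𝒜_V` is the restriction of `𝒜_U` to `V`. -/
def tensorWreathBasic {U : Type*} [CommGroup U] [Finite U] (AU : SRing U)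
    (Lu V : Subgroup U) : Set (Set U) :=
  {Z | (∃ l ∈ Lu, ∃ X ∈ AU.basic, X ⊆ (V : Set U) ∧ Z = l • X) ∨
       (∃ u : U, u ∉ Lu ⊔ V ∧ Z = u • (V : Set U))}

/-- Condition (CA): `𝒜_S = ℤS`. -/
def CondCA {G : Type*} [CommGroup G] [Finite G] (A : SRing G) (U L : Subgroup G) : Prop :=
  ∀ AS : SRing (↥U ⧸ L.subgroupOf U), AS.basic = secBasic A U L →
    AS.basic = Set.range fun s => ({s} : Set (↥U ⧸ L.subgroupOf U))

/-- Condition (CA'): `𝒜_U` or `𝒜_{G/L}` is cyclotomic and `𝒜_S` is Cayley minimal. -/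
def CondCA' {G : Type*} [CommGroup G] [Finite G] (A : SRing G) (U L : Subgroup G) : Prop :=
  ((∀ AU : SRing ↥U, AU.basic = restrictBasic A U → AU.IsCyclotomic) ∨
   (∀ AQ : SRing (G ⧸ L), AQ.basic = quotBasic A L → AQ.IsCyclotomic)) ∧
  (∀ AS : SRing (↥U ⧸ L.subgroupOf U), AS.basic = secBasic A U L → AS.IsCayleyMinimal)

/-- Condition (CA''): `U ≅ C_{4p}`, `L ≅ C₂` and
`𝒜_U = (ℤL ⊗ 𝒜_V) ≀_{(V×L)/V} ℤ(U/V)` for an `𝒜_U`-subgroup `V` of order `p`. -/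
def CondCA'' {G : Type*} [CommGroup G] [Finite G] (p : ℕ) (A : SRing G)
    (U L : Subgroup G) : Prop :=
  Nat.card ↥U = 4 * p ∧ IsCyclic ↥U ∧ Nat.card ↥L = 2 ∧
  ∀ AU : SRing ↥U, AU.basic = restrictBasic A U →
    ∃ V : Subgroup ↥U, AU.IsASubgroup V ∧ Nat.card ↥V = p ∧
      AU.basic = tensorWreathBasic AU (L.subgroupOf U) V

/-- `𝒜 = 𝒜_{G₁} ⊗ 𝒜_{G₂}` for `G = G₁ × G₂` (internally). -/
def IsTensorDecomp {G : Type*} [CommGroup G] [Finite G] (A : SRing G)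
    (G₁ G₂ : Subgroup G) : Prop :=
  A.IsASubgroup G₁ ∧ A.IsASubgroup G₂ ∧ G₁ ⊓ G₂ = ⊥ ∧ G₁ ⊔ G₂ = ⊤ ∧
  A.basic = {Z | ∃ X ∈ A.basic, ∃ Y ∈ A.basic,
    X ⊆ (G₁ : Set G) ∧ Y ⊆ (G₂ : Set G) ∧ Z = X * Y}

/-- `𝒜` is the tensor product of two S-rings over proper nontrivial subgroups of `G`. -/
def TensorConclusion {G : Type*} [CommGroup G] [Finite G] (A : SRing G) : Prop :=
  ∃ G₁ G₂ : Subgroup G, G₁ ≠ ⊥ ∧ G₁ ≠ ⊤ ∧ G₂ ≠ ⊥ ∧ G₂ ≠ ⊤ ∧ IsTensorDecomp A G₁ G₂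

/-- `𝒜` is a nontrivial `S = U/L`-wreath product satisfying one of the
conditions (CA), (CA'), (CA''). -/
def WreathConclusion {G : Type*} [CommGroup G] [Finite G] (p : ℕ) (A : SRing G) : Prop :=
  ∃ U L : Subgroup G, L ≤ U ∧ A.IsASubgroup U ∧ A.IsASubgroup L ∧ L ≠ ⊥ ∧ U ≠ ⊤ ∧
    (∀ X ∈ A.basic, ¬ X ⊆ (U : Set G) → (L : Set G) ⊆ rad X) ∧
    (CondCA A U L ∨ CondCA' A U L ∨ CondCA'' p A U L)

set_option linter.unusedSectionVars false

/-- An equivalence relation on a finite abelian group whose classes form a Schur partition. -/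
structure Sch (Γ : Type*) [AddCommGroup Γ] [Fintype Γ] where
  r : Γ → Γ → Prop
  eqv : Equivalence r
  zero : ∀ x, r 0 x → x = 0
  neg : ∀ x y, r x y → r (-x) (-y)
  conv : ∀ f g : Γ → ℤ, (∀ x y, r x y → f x = f y) → (∀ x y, r x y → g x = g y) →
    ∀ x y, r x y → ∑ t, f t * g (x - t) = ∑ t, f t * g (y - t)

namespace Sch

variable {Γ : Type*} [AddCommGroup Γ] [Fintype Γ] (s : Sch Γ)

/-- A set which is a union of classes. -/
def Inv (S : Set Γ) : Prop := ∀ x y, s.r x y → x ∈ S → y ∈ S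

/-- The class of an element. -/
def cl (x : Γ) : Set Γ := {y | s.r x y}

variable {s}

theorem rfl' (x : Γ) : s.r x x := s.eqv.refl x
theorem symm' {x y : Γ} (h : s.r x y) : s.r y x := s.eqv.symm h
theorem trans' {x y z : Γ} (h : s.r x y) (h' : s.r y z) : s.r x z := s.eqv.trans h h'

theorem self_mem_cl (x : Γ) : x ∈ s.cl x := rfl' x

theorem cl_inv (x : Γ) : s.Inv (s.cl x) := fun _ _ h hx => trans' hx h

theorem Inv.mem_iff {S : Set Γ} (hS : s.Inv S) {x y : Γ} (h : s.r x y) : x ∈ S ↔ y ∈ S :=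
  ⟨hS x y h, hS y x (symm' h)⟩

theorem zero' {x : Γ} (h : s.r x 0) : x = 0 := s.zero x (symm' h)

theorem neg_iff {x y : Γ} : s.r (-x) (-y) ↔ s.r x y :=
  ⟨fun h => by simpa using s.neg _ _ h, s.neg _ _⟩

theorem inv_zero : s.Inv {0} := by
  intro x y h hx
  rw [Set.mem_singleton_iff] at *
  subst hx
  exact s.zero y h

theorem Inv.compl {S : Set Γ} (hS : s.Inv S) : s.Inv Sᶜ :=
  fun x y h hx hy => hx (hS y x (symm' h) hy)

theorem Inv.inter {S T : Set Γ} (hS : s.Inv S) (hT : s.Inv T) : s.Inv (S ∩ T) :=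
  fun x y h hx => ⟨hS x y h hx.1, hT x y h hx.2⟩

theorem Inv.union {S T : Set Γ} (hS : s.Inv S) (hT : s.Inv T) : s.Inv (S ∪ T) :=
  fun x y h hx => hx.imp (hS x y h) (hT x y h)

theorem Inv.diff {S T : Set Γ} (hS : s.Inv S) (hT : s.Inv T) : s.Inv (S \ T) :=
  hS.inter hT.compl

theorem Inv.neg {S : Set Γ} (hS : s.Inv S) : s.Inv (-S) :=
  fun x y h hx => hS (-x) (-y) (s.neg _ _ h) hx

theorem Inv.cnt {S T : Set Γ} (hS : s.Inv S) (hT : s.Inv T) {x y : Γ} (h : s.r x y) :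
    {t | t ∈ S ∧ x - t ∈ T}.ncard = {t | t ∈ S ∧ y - t ∈ T}.ncard := by
  classical
  have h1 := s.conv (fun t => if t ∈ S then 1 else 0) (fun t => if t ∈ T then 1 else 0)
    (fun a b hab => by simp [hS.mem_iff hab]) (fun a b hab => by simp [hT.mem_iff hab]) x y h
  have key : ∀ x : Γ, (∑ t, (if t ∈ S then (1 : ℤ) else 0) * (if x - t ∈ T then 1 else 0)) =
      ({t | t ∈ S ∧ x - t ∈ T}.ncard : ℤ) := by
    intro x
    rw [Set.ncard_eq_toFinset_card', Finset.card_eq_sum_ones, Set.toFinset_ofPred,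
      Finset.sum_filter]
    push_cast
    refine Finset.sum_congr rfl fun t _ => ?_
    by_cases h1 : t ∈ S <;> by_cases h2 : x - t ∈ T <;> simp [h1, h2]
  simp only [key] at h1
  exact_mod_cast h1

theorem Inv.add {S T : Set Γ} (hS : s.Inv S) (hT : s.Inv T) : s.Inv (S + T) := by
  have key : ∀ x : Γ, x ∈ S + T ↔ 0 < {t | t ∈ S ∧ x - t ∈ T}.ncard := by
    intro x
    rw [Set.ncard_pos (Set.toFinite _), Set.mem_add]
    constructor
    · rintro ⟨a, ha, b, hb, rfl⟩
      exact ⟨a, ha, by simpa using hb⟩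
    · rintro ⟨a, ha, hb⟩
      exact ⟨a, ha, _, hb, by simp⟩
  intro x y h hx
  rw [key] at *
  rwa [← hS.cnt hT h]

theorem Inv.sub {S T : Set Γ} (hS : s.Inv S) (hT : s.Inv T) : s.Inv (S - T) := by
  rw [sub_eq_add_neg]
  exact hS.add hT.neg

theorem Inv.closure {S : Set Γ} (hS : s.Inv S) :
    s.Inv (AddSubgroup.closure S : Set Γ) := by
  intro x y h hx
  revert y
  induction hx using AddSubgroup.closure_induction with
  | mem x hx => exact fun y h => AddSubgroup.subset_closure (hS x y h hx)
  | zero => exact fun y h => by rw [s.zero y h]; exact zero_mem _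
  | add a b _ _ ha hb =>
    intro y h
    obtain ⟨u, hu, v, hv, rfl⟩ := ((cl_inv (s := s) a).add (cl_inv b)) _ _ h
      ⟨a, self_mem_cl a, b, self_mem_cl b, rfl⟩
    exact add_mem (ha u hu) (hb v hv)
  | neg a _ ha =>
    intro y h
    have := ha (-y) (by simpa using s.neg _ _ h)
    simpa using neg_mem this

theorem inv_sup {A B : AddSubgroup Γ} (hA : s.Inv (A : Set Γ)) (hB : s.Inv (B : Set Γ)) :
    s.Inv ((A ⊔ B : AddSubgroup Γ) : Set Γ) := by
  rw [AddSubgroup.add_normal]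
  exact hA.add hB

theorem inv_inf {A B : AddSubgroup Γ} (hA : s.Inv (A : Set Γ)) (hB : s.Inv (B : Set Γ)) :
    s.Inv ((A ⊓ B : AddSubgroup Γ) : Set Γ) := hA.inter hB

/-- The set of `g` with `g + S ⊆ T` is a union of classes. -/
theorem Inv.add_subset {S T : Set Γ} (hS : s.Inv S) (hT : s.Inv T) :
    s.Inv {g | ∀ t ∈ S, g + t ∈ T} := by
  have : {g | ∀ t ∈ S, g + t ∈ T} = (Tᶜ - S)ᶜ := by
    ext g
    simp only [Set.mem_ofPred_eq, Set.mem_compl_iff, Set.mem_sub, not_exists, not_and]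
    constructor
    · rintro h a ha b hb rfl
      exact ha (by simpa using h b hb)
    · intro h t ht
      by_contra hc
      exact h (g + t) hc t ht (by simp)
  rw [this]
  exact (hT.compl.sub hS).compl

/-- The stabilizer of a set under translations. -/
def stab (S : Set Γ) : AddSubgroup Γ where
  carrier := {g | ∀ t ∈ S, g + t ∈ S}
  zero_mem' := by simp
  add_mem' := by
    intro a b ha hb t ht
    rw [add_assoc]
    exact ha _ (hb t ht)
  neg_mem' := by
    intro a ha t ht
    have hs : (fun t => a + t) '' S = S := by
      refine Set.eq_of_subset_of_ncard_le (Set.image_subset_iff.2 ha) ?_ (Set.toFinite _)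
      rw [Set.ncard_image_of_injective _ (add_right_injective a)]
    rw [← hs] at ht
    obtain ⟨u, hu, rfl⟩ := ht
    simpa using hu

theorem Inv.stab {S : Set Γ} (hS : s.Inv S) : s.Inv (stab S : Set Γ) := hS.add_subset hS

/-- The classes meet cosets of an invariant subgroup uniformly. -/
theorem Inv.mult {S : Set Γ} (hS : s.Inv S) {L : AddSubgroup Γ} (hL : s.Inv (L : Set Γ))
    {x y : Γ} (h : s.r x y) :
    {t | t ∈ S ∧ t - x ∈ L}.ncard = {t | t ∈ S ∧ t - y ∈ L}.ncard := by
  have := hS.cnt hL h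
  simpa only [SetLike.mem_coe, ← neg_sub _ x, ← neg_sub _ y, neg_mem_iff] using this

theorem Inv.cnt_sub {S T : Set Γ} (hS : s.Inv S) (hT : s.Inv T) {x y : Γ} (h : s.r x y) :
    {t | t ∈ S ∧ t + x ∈ T}.ncard = {t | t ∈ S ∧ t + y ∈ T}.ncard := by
  have := hS.cnt hT.neg (s.neg _ _ h)
  simpa [add_comm] using this

theorem single_add {a : Γ} (ha : s.Inv {a}) {x y : Γ} (h : s.r x y) : s.r (a + x) (a + y) := by
  have h1 : s.Inv ({-a} + s.cl (a + x)) := by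
    have := ha.neg
    rw [Set.neg_singleton] at this
    exact this.add (cl_inv _)
  rw [Set.singleton_add] at h1
  obtain ⟨u, hu, hy⟩ := h1 x y h ⟨a + x, self_mem_cl _, by simp⟩
  have : u = a + y := by rw [← hy]; simp
  rwa [← this]

theorem conv_zmod {m : ℕ} [NeZero m] (f g : Γ → ZMod m) (hf : ∀ x y, s.r x y → f x = f y)
    (hg : ∀ x y, s.r x y → g x = g y) {x y : Γ} (h : s.r x y) :
    ∑ t, f t * g (x - t) = ∑ t, f t * g (y - t) := by
  have := s.conv (fun t => ((f t).val : ℤ)) (fun t => ((g t).val : ℤ))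
    (fun a b hab => by simp [hf a b hab]) (fun a b hab => by simp [hg a b hab]) x y h
  have h2 := congrArg (Int.cast : ℤ → ZMod m) this
  simpa using h2

theorem coeff_mul_sum {R : Type*} [CommRing R] (a b : AddMonoidAlgebra R Γ) (x : Γ) :
    (a * b).coeff x = ∑ t, a.coeff t * b.coeff (x - t) := by
  classical
  rw [AddMonoidAlgebra.coeff_mul_apply_left, Finsupp.sum_fintype _ _ (by simp)]
  refine Finset.sum_congr rfl fun t _ => ?_
  rw [sub_eq_add_neg, add_comm x]

theorem frob_pow {m : ℕ} [NeZero m] (a : AddMonoidAlgebra (ZMod m) Γ)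
    (ha : ∀ x y, s.r x y → a.coeff x = a.coeff y) (k : ℕ) :
    ∀ x y, s.r x y → (a ^ (k + 1)).coeff x = (a ^ (k + 1)).coeff y := by
  induction k with
  | zero => simpa using ha
  | succ k ih =>
    intro x y h
    rw [pow_succ, coeff_mul_sum, coeff_mul_sum]
    exact conv_zmod _ _ ih ha h

/-- Schur's congruence for `m`-th powers, `m` prime. -/
theorem Inv.frob {S : Set Γ} (hS : s.Inv S) {m : ℕ} (hm : m.Prime) {x y : Γ} (h : s.r x y) :
    {t | t ∈ S ∧ m • t = x}.ncard ≡ {t | t ∈ S ∧ m • t = y}.ncard [MOD m] := by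
  classical
  have : Fact m.Prime := ⟨hm⟩
  have : CharP (AddMonoidAlgebra (ZMod m) Γ) m :=
    charP_of_injective_algebraMap (algebraMap (ZMod m) _).injective m
  let a : AddMonoidAlgebra (ZMod m) Γ := ∑ t ∈ S.toFinset, AddMonoidAlgebra.single t 1
  have ha : ∀ x, a.coeff x = if x ∈ S then 1 else 0 := by
    intro x
    simp only [a, AddMonoidAlgebra.coeff_sum, Finsupp.finsetSum_apply,
      AddMonoidAlgebra.coeff_single, Finsupp.single_apply]
    simp
  have hp : a ^ m = ∑ t ∈ S.toFinset, AddMonoidAlgebra.single (m • t) 1 := by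
    simp [a, sum_pow_char, AddMonoidAlgebra.single_pow]
  have hpc : ∀ x, (a ^ m).coeff x = (({t | t ∈ S ∧ m • t = x}.ncard : ℕ) : ZMod m) := by
    intro x
    rw [hp, AddMonoidAlgebra.coeff_sum, Finsupp.finsetSum_apply,
      Set.ncard_eq_toFinset_card', Set.toFinset_ofPred]
    simp only [AddMonoidAlgebra.coeff_single, Finsupp.single_apply, Finset.sum_boole]
    congr 2
    ext t; simp
  have := frob_pow (s := s) a (fun x y hxy => by rw [ha, ha, hS.mem_iff hxy]) (m - 1) x y h
  rw [Nat.sub_add_cancel hm.one_le, hpc, hpc] at this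
  exact (ZMod.natCast_eq_natCast_iff _ _ _).1 this

theorem smul_inj {m : ℕ} (hm : m.Coprime (Fintype.card Γ)) :
    Function.Injective (fun x : Γ => m • x) := by
  have : (Nat.card Γ).Coprime m := by rw [Nat.card_eq_fintype_card]; exact hm.symm
  exact (nsmulCoprime this).injective

theorem Inv.smul {m : ℕ} : m.Coprime (Fintype.card Γ) → ∀ {S : Set Γ}, s.Inv S →
    s.Inv ((fun x => m • x) '' S) := by
  induction m using Nat.recOnMul with
  | zero =>
    intro h S hS
    rw [Nat.coprime_zero_left, Fintype.card_eq_one_iff] at h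
    obtain ⟨a, ha⟩ := h
    intro x y _ hx
    rwa [ha y, ← ha x]
  | one => intro _ S hS; simpa using hS
  | prime m hm =>
    intro h S hS x y hxy hx
    have h1 := hS.frob hm hxy
    have key : ∀ x, {t | t ∈ S ∧ m • t = x}.ncard ≤ 1 := by
      intro x
      refine (Set.ncard_le_one (Set.toFinite _)).2 ?_
      rintro a ⟨_, ha⟩ b ⟨_, hb⟩
      exact smul_inj h (ha.trans hb.symm)
    have h2 : 0 < {t | t ∈ S ∧ m • t = x}.ncard :=
      (Set.ncard_pos (Set.toFinite _)).2 hx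
    have h3 : {t | t ∈ S ∧ m • t = x}.ncard = 1 := le_antisymm (key x) h2
    have h4 : {t | t ∈ S ∧ m • t = y}.ncard ≠ 0 := by
      intro h4
      rw [h3, h4] at h1
      have := (Nat.modEq_zero_iff_dvd).1 h1
      exact hm.one_lt.ne' (Nat.dvd_one.1 this)
    exact (Set.ncard_pos (Set.toFinite _)).1 (Nat.pos_of_ne_zero h4)
  | mul a b ha hb =>
    intro h S hS
    have := ha (Nat.Coprime.coprime_mul_right h) (hb (Nat.Coprime.coprime_mul_left h) hS)
    rw [Set.image_image] at this
    simpa only [mul_smul] using this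

/-- Schur's theorem on multipliers. -/
theorem smul_r {m : ℕ} (hm : m.Coprime (Fintype.card Γ)) {x y : Γ} (h : s.r x y) :
    s.r (m • x) (m • y) := by
  obtain ⟨k, hk⟩ : ∃ k, (m ^ k) % (Fintype.card Γ) = 1 % Fintype.card Γ ∧ 0 < k := by
    refine ⟨(Fintype.card Γ).totient, Nat.ModEq.pow_totient hm, ?_⟩
    exact Nat.totient_pos.2 Fintype.card_pos
  obtain ⟨⟨hk, k0⟩⟩ := Nonempty.intro hk
  have key : ∀ x : Γ, m ^ k • x = x := by
    intro x
    conv_rhs => rw [← one_nsmul x]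
    rw [← mod_addOrderOf_nsmul, ← mod_addOrderOf_nsmul x 1]
    have hd : addOrderOf x ∣ Fintype.card Γ := addOrderOf_dvd_card
    rw [(Nat.ModEq.of_dvd hd hk : m ^ k % _ = 1 % _)]
  obtain ⟨j, rfl⟩ : ∃ j, k = j + 1 := ⟨k - 1, by omega⟩
  have h1 := (cl_inv (s := s) (m • x)).smul (hm.pow_left j)
  obtain ⟨u, hu, huy⟩ := h1 x y h ⟨m • x, self_mem_cl _, by
    show m ^ j • m • x = x
    rw [← mul_smul, ← pow_succ]; exact key x⟩
  have : u = m • y := by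
    rw [← huy]
    show u = m • m ^ j • u
    rw [← mul_smul, ← pow_succ']; exact (key u).symm
  rwa [← this]

end Sch

/-- Elementary abelian groups of order `p ^ 2`, `p` an odd prime. -/
class Plane (p : ℕ) (V : Type*) [AddCommGroup V] [Fintype V] : Prop where
  prime : p.Prime
  odd : Odd p
  psmul : ∀ v : V, p • v = 0
  card : Fintype.card V = p ^ 2

namespace Plane

variable {p : ℕ} {V : Type*} [AddCommGroup V] [Fintype V] [hP : Plane p V]

theorem smul_mod (k : ℕ) (v : V) : (k % p) • v = k • v := by
  conv_rhs => rw [← Nat.mod_add_div k p, add_nsmul, mul_smul, hP.psmul, add_zero]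

theorem smul_congr {k l : ℕ} (h : k ≡ l [MOD p]) (v : V) : k • v = l • v := by
  rw [← smul_mod (p := p) k v, ← smul_mod (p := p) l v, h]

variable (p V) in
include hP in
theorem exists_inv {k : ℕ} (hk : ¬ p ∣ k) : ∃ l : ℕ, ¬ p ∣ l ∧ l * k ≡ 1 [MOD p] := by
  have hc : Nat.Coprime k p := ((Nat.Prime.coprime_iff_not_dvd hP.prime).2 hk).symm
  obtain ⟨l, hl⟩ := Nat.exists_mul_mod_eq_one_of_coprime hc hP.prime.one_lt
  refine ⟨l, fun h => ?_, ?_⟩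
  · have := (Nat.dvd_iff_mod_eq_zero ..).1 (h.mul_left k)
    omega
  · rw [mul_comm, Nat.ModEq, hl.2, Nat.mod_eq_of_lt hP.prime.one_lt]

variable (p) in
theorem exists_smul_inv {k : ℕ} (hk : ¬ p ∣ k) :
    ∃ l : ℕ, ¬ p ∣ l ∧ ∀ v : V, l • k • v = v ∧ k • l • v = v := by
  obtain ⟨l, hl, h⟩ := exists_inv p V hk
  refine ⟨l, hl, fun v => ?_⟩
  rw [← mul_smul, ← mul_smul, mul_comm k, smul_congr h, one_smul]
  exact ⟨rfl, rfl⟩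

variable (p) in
theorem smul_eq_zero' {k : ℕ} (hk : ¬ p ∣ k) {v : V} : k • v = 0 ↔ v = 0 := by
  obtain ⟨l, -, h⟩ := exists_smul_inv (V := V) p hk
  refine ⟨fun h0 => ?_, fun h0 => by simp [h0]⟩
  have := (h v).1
  rw [h0, smul_zero] at this
  exact this.symm

variable (p) in
theorem smul_mem_iff {k : ℕ} (hk : ¬ p ∣ k) {v : V} {Q : AddSubgroup V} : k • v ∈ Q ↔ v ∈ Q := by
  obtain ⟨l, -, h⟩ := exists_smul_inv (V := V) p hk
  refine ⟨fun h0 => ?_, fun h0 => nsmul_mem h0 k⟩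
  rw [← (h v).1]
  exact nsmul_mem h0 l

variable (p V) in
include hP in
theorem not_dvd_two : ¬ p ∣ 2 := by
  intro h
  have h1 := (Nat.prime_dvd_prime_iff_eq hP.prime Nat.prime_two).1 h
  have := hP.odd
  rw [h1] at this
  exact absurd this (by decide)

variable (p V) in
include hP in
theorem three_le : 3 ≤ p := by
  have h1 := not_dvd_two p V
  have := hP.prime.two_le
  rcases Nat.lt_or_ge p 3 with h | h
  · have : p = 2 := by omega
    subst this
    simp at h1
  · exact h

variable (p) in
include hP in
theorem two_smul_eq_zero {v : V} : v + v = 0 ↔ v = 0 := by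
  rw [← two_smul ℕ]
  exact smul_eq_zero' p (not_dvd_two p V)

variable (p) in
include hP in
theorem double_inj {v w : V} (h : v + v = w + w) : v = w := by
  have : (v - w) + (v - w) = 0 := by rw [sub_add_sub_comm, h, sub_self]
  exact sub_eq_zero.1 ((two_smul_eq_zero p).1 this)

variable (p) in
include hP in
theorem double_mem {v : V} {Q : AddSubgroup V} : v + v ∈ Q ↔ v ∈ Q := by
  rw [← two_smul ℕ]
  exact smul_mem_iff p (not_dvd_two p V)

theorem card_eq (p : ℕ) {V : Type*} [AddCommGroup V] [Fintype V] [hP : Plane p V] :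
    Nat.card V = p ^ 2 := by rw [Nat.card_eq_fintype_card, hP.card]

variable (p) in
theorem cases_subgroup (Q : AddSubgroup V) : Q = ⊥ ∨ Nat.card Q = p ∨ Q = ⊤ := by
  have h := Q.card_addSubgroup_dvd_card
  rw [card_eq (V := V) p, Nat.dvd_prime_pow hP.prime] at h
  obtain ⟨k, hk, h⟩ := h
  interval_cases k
  · left; exact (AddSubgroup.eq_bot_iff_card _).2 (by simpa using h)
  · right; left; simpa using h
  · right; right
    exact AddSubgroup.eq_top_of_card_eq _ (by rw [h, card_eq p])

variable (p) in
theorem card_zmultiples {v : V} (hv : v ≠ 0) : Nat.card (AddSubgroup.zmultiples v) = p := by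
  have : Fact p.Prime := ⟨hP.prime⟩
  rw [Nat.card_zmultiples]
  exact addOrderOf_eq_prime (hP.psmul v) hv

theorem line_ne_bot {Q : AddSubgroup V} (hQ : Nat.card Q = p) : Q ≠ ⊥ := by
  rintro rfl
  rw [AddSubgroup.card_bot] at hQ
  exact hP.prime.one_lt.ne hQ

theorem line_ne_top {Q : AddSubgroup V} (hQ : Nat.card Q = p) : Q ≠ ⊤ := by
  rintro rfl
  rw [AddSubgroup.card_top, card_eq p] at hQ
  have := hP.prime.one_lt
  nlinarith

theorem line_le {Q R : AddSubgroup V} (hQ : Nat.card Q = p) (hR : R ≠ ⊤) (h : Q ≤ R) : Q = R := by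
  rcases cases_subgroup p R with h1 | h1 | h1
  · subst h1
    exact absurd (le_bot_iff.1 h) (line_ne_bot hQ)
  · exact AddSubgroup.eq_of_le_of_card_ge h (by rw [hQ, h1])
  · exact absurd h1 hR

theorem zmultiples_eq_line {Q : AddSubgroup V} (hQ : Nat.card Q = p) {v : V} (hv : v ∈ Q)
    (h0 : v ≠ 0) : AddSubgroup.zmultiples v = Q :=
  line_le (card_zmultiples p h0) (line_ne_top hQ) (by simpa using hv)

variable (p) in
theorem mem_zmultiples_iff {v w : V} : w ∈ AddSubgroup.zmultiples v ↔ ∃ k < p, k • v = w := by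
  constructor
  · intro h
    obtain ⟨k, hk⟩ := mem_zmultiples_iff_mem_range_addOrderOf' h
    exact ⟨k % p, Nat.mod_lt _ hP.prime.pos, by rw [smul_mod]; exact hk⟩
  · rintro ⟨k, -, rfl⟩
    exact nsmul_mem (AddSubgroup.mem_zmultiples v) k
where
  mem_zmultiples_iff_mem_range_addOrderOf' {v w : V} (h : w ∈ AddSubgroup.zmultiples v) :
      ∃ k : ℕ, k • v = w := by
    rw [← mem_multiples_iff_mem_zmultiples] at h
    exact h

theorem sup_eq_top {Q : AddSubgroup V} (hQ : Nat.card Q = p) {w : V} (hw : w ∉ Q) :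
    Q ⊔ AddSubgroup.zmultiples w = ⊤ := by
  by_contra h
  have := line_le hQ h le_sup_left
  apply hw
  rw [this]
  exact (le_sup_right : _ ≤ Q ⊔ AddSubgroup.zmultiples w) (AddSubgroup.mem_zmultiples w)

theorem exists_coset {Q : AddSubgroup V} (hQ : Nat.card Q = p) {w : V} (hw : w ∉ Q) (v : V) :
    ∃ k < p, v - k • w ∈ Q := by
  have h : v ∈ Q ⊔ AddSubgroup.zmultiples w := by rw [sup_eq_top hQ hw]; trivial
  rw [AddSubgroup.mem_sup] at h
  obtain ⟨q, hq, y, hy, rfl⟩ := h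
  obtain ⟨k, hk, rfl⟩ := (mem_zmultiples_iff p).1 hy
  exact ⟨k, hk, by simpa using hq⟩

theorem coset_inj {Q : AddSubgroup V} {w : V} (hw : w ∉ Q) {k l : ℕ} (hk : k < p)
    (hl : l < p) (h : k • w - l • w ∈ Q) : k = l := by
  wlog hkl : l ≤ k generalizing k l
  · exact (this hl hk (by rw [← neg_sub]; exact neg_mem h) (by omega)).symm
  obtain ⟨d, rfl⟩ := Nat.exists_eq_add_of_le hkl
  rw [add_nsmul, add_sub_cancel_left] at h
  by_contra hne
  refine hw ((smul_mem_iff p ?_).1 h)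
  intro hd
  have := Nat.le_of_dvd (by omega) hd
  omega

theorem card_coset {Q : AddSubgroup V} (hQ : Nat.card Q = p) (w : V) :
    {v | v - w ∈ Q}.ncard = p := by
  have : {v | v - w ∈ Q} = (fun q => q + w) '' (Q : Set V) := by
    ext v
    simp [sub_eq_add_neg]
  rw [this, Set.ncard_image_of_injective _ (add_left_injective w)]
  exact hQ

/-- A scalar closed set is determined by its intersections with two cosets of a line. -/
theorem card_scalar {T : Set V} (hT : ∀ k : ℕ, ¬ p ∣ k → ∀ v ∈ T, k • v ∈ T)
    {Q : AddSubgroup V} (hQ : Nat.card Q = p) {w : V} (hw : w ∉ Q) :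
    T.ncard = {v | v ∈ T ∧ v ∈ Q}.ncard + (p - 1) * {v | v ∈ T ∧ v - w ∈ Q}.ncard := by
  have h1 : T = {v | v ∈ T ∧ v ∈ Q} ∪ {v | v ∈ T ∧ v ∉ Q} := by
    ext v
    simp only [Set.mem_union, Set.mem_ofPred_eq]
    tauto
  have h2 : {v | v ∈ T ∧ v ∉ Q} = (fun x : ℕ × V => x.1 • x.2) ''
      (Set.Ico 1 p ×ˢ {v | v ∈ T ∧ v - w ∈ Q}) := by
    ext v
    constructor
    · rintro ⟨hv, hvQ⟩
      obtain ⟨k, hk, hkv⟩ := exists_coset hQ hw v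
      have hk0 : k ≠ 0 := by
        rintro rfl
        simp at hkv
        exact hvQ hkv
      have hpk : ¬ p ∣ k := fun hd => by
        have := Nat.le_of_dvd (by omega) hd
        omega
      obtain ⟨l, hl, h⟩ := exists_smul_inv (V := V) p hpk
      refine ⟨(k, l • v), ⟨⟨by omega, hk⟩, hT l hl v hv, ?_⟩, (h v).2⟩
      have := nsmul_mem hkv l
      rwa [smul_sub, (h w).1] at this
    · rintro ⟨⟨k, v⟩, ⟨⟨hk1, hk⟩, hv, hvw⟩, rfl⟩
      have hpk : ¬ p ∣ k := fun hd => by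
        have := Nat.le_of_dvd (by simp at hk1; omega) hd
        simp at hk
        omega
      refine ⟨hT k hpk v hv, fun h => hw ?_⟩
      have := (smul_mem_iff p hpk).1 h
      have h3 := sub_mem this hvw
      simpa using h3
  conv_lhs => rw [h1]
  rw [Set.ncard_union_eq _ (Set.toFinite _) (Set.toFinite _), h2, Set.InjOn.ncard_image,
    Set.ncard_prod]
  · congr 2
    rw [← Nat.card_coe_set_eq, Nat.card_eq_fintype_card]
    simp
  · rintro ⟨k, v⟩ ⟨⟨hk1, hk⟩, hv, hvw⟩ ⟨l, u⟩ ⟨⟨hl1, hl⟩, hu, huw⟩ h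
    simp only at *
    have : k = l := by
      refine coset_inj hw hk hl ?_
      have h3 := sub_mem (nsmul_mem huw l) (nsmul_mem hvw k)
      simp only [smul_sub] at h3
      rw [h] at h3
      convert h3 using 1
      abel
    subst this
    have hpk : ¬ p ∣ k := fun hd => by
      have := Nat.le_of_dvd (by omega) hd
      omega
    obtain ⟨l, -, h'⟩ := exists_smul_inv (V := V) p hpk
    rw [← (h' v).1, h, (h' u).1]
  · rw [Set.disjoint_left]
    rintro v ⟨_, hv⟩ ⟨_, hv'⟩
    exact hv' hv

theorem line_of_scalar {T : Set V} (hT : ∀ k : ℕ, ¬ p ∣ k → ∀ v ∈ T, k • v ∈ T) (h0 : 0 ∈ T)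
    (hd : p ∣ T.ncard) : (∃ Q : AddSubgroup V, Nat.card Q = p ∧ T = Q) ∨ T = Set.univ := by
  have h1 : ∃ v ∈ T, v ≠ 0 := by
    by_contra! h
    have : T = {0} := by
      ext v; exact ⟨fun hv => h v hv, fun hv => by rw [hv]; exact h0⟩
    rw [this, Set.ncard_singleton, Nat.dvd_one] at hd
    exact hP.prime.one_lt.ne' hd
  obtain ⟨v, hv, hv0⟩ := h1
  set Q := AddSubgroup.zmultiples v with hQd
  have hQ : Nat.card Q = p := card_zmultiples p hv0
  have hQT : ∀ u ∈ Q, u ∈ T := by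
    intro u hu
    obtain ⟨k, hk, rfl⟩ := (mem_zmultiples_iff p).1 hu
    rcases Nat.eq_zero_or_pos k with rfl | hk0
    · simpa using h0
    · refine hT k (fun hd => ?_) v hv
      have := Nat.le_of_dvd hk0 hd
      omega
  by_cases hTQ : T = Q
  · exact Or.inl ⟨Q, hQ, hTQ⟩
  right
  obtain ⟨w, hwT, hw⟩ : ∃ w ∈ T, w ∉ Q := by
    by_contra! h
    exact hTQ (Set.Subset.antisymm h hQT)
  have hc := card_scalar hT hQ hw
  have hQ' : {v | v ∈ T ∧ v ∈ Q} = {v | v - 0 ∈ Q} := by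
    ext u; simp only [sub_zero, Set.mem_ofPred_eq]; exact ⟨fun h => h.2, fun h => ⟨hQT u h, h⟩⟩
  rw [hQ', card_coset hQ] at hc
  have hle : {v | v ∈ T ∧ v - w ∈ Q}.ncard ≤ p := by
    rw [← card_coset hQ w]
    exact Set.ncard_le_ncard (fun x hx => hx.2) (Set.toFinite _)
  have hpos : 0 < {v | v ∈ T ∧ v - w ∈ Q}.ncard :=
    (Set.ncard_pos (Set.toFinite _)).2 ⟨w, hwT, by simp⟩
  rw [hc, Nat.dvd_add_right (dvd_refl p), Nat.Prime.dvd_mul hP.prime] at hd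
  have h3 := three_le p V
  rcases hd with hd | hd
  · have := Nat.le_of_dvd (by omega) hd
    omega
  have : {v | v ∈ T ∧ v - w ∈ Q}.ncard = p := le_antisymm hle (Nat.le_of_dvd hpos hd)
  rw [this] at hc
  refine Set.eq_of_subset_of_ncard_le (Set.subset_univ _) ?_ (Set.toFinite _)
  rw [hc, Set.ncard_univ, card_eq p]
  obtain ⟨m, rfl⟩ : ∃ m, p = m + 1 := ⟨p - 1, by omega⟩
  simp
  nlinarith

theorem exists_notMem {Q : AddSubgroup V} (hQ : Nat.card Q = p) : ∃ w, w ∉ Q := by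
  by_contra! h
  exact line_ne_top hQ (eq_top_iff.2 fun v _ => h v)

theorem coset_sum {Q : AddSubgroup V} (hQ : Nat.card Q = p) {w : V} (hw : w ∉ Q) (S : Set V) :
    S.ncard = ∑ k ∈ Finset.range p, {v | v ∈ S ∧ v - k • w ∈ Q}.ncard := by
  classical
  choose f hf using exists_coset hQ hw
  rw [Set.ncard_eq_toFinset_card', Finset.card_eq_sum_card_fiberwise (f := f)
    (t := Finset.range p) (fun v _ => by simpa using (hf v).1)]
  refine Finset.sum_congr rfl fun k hk => ?_
  rw [Set.ncard_eq_toFinset_card']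
  congr 1
  ext v
  simp only [Finset.mem_filter, Set.mem_toFinset, Set.mem_ofPred_eq]
  refine and_congr_right fun _ => ⟨fun h => h ▸ (hf v).2, fun h => ?_⟩
  refine coset_inj hw (hf v).1 (Finset.mem_range.1 hk) ?_
  have := sub_mem h (hf v).2
  convert this using 1
  abel

theorem transversal_card {Q : AddSubgroup V} (hQ : Nat.card Q = p) {S : Set V}
    (h : ∀ v, {u | u ∈ S ∧ u - v ∈ Q}.ncard = 1) : S.ncard = p := by
  obtain ⟨w, hw⟩ := exists_notMem hQ
  rw [coset_sum hQ hw]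
  simp [h]

theorem coset_full {Q : AddSubgroup V} (hQ : Nat.card Q = p) {S : Set V} {v : V}
    (h : {u | u ∈ S ∧ u - v ∈ Q}.ncard = p) {q : V} (hq : q ∈ Q) : v + q ∈ S := by
  have h1 : {u | u ∈ S ∧ u - v ∈ Q} = {u | u - v ∈ Q} := by
    refine Set.eq_of_subset_of_ncard_le (fun x hx => hx.2) ?_ (Set.toFinite _)
    rw [h, card_coset hQ]
  have : v + q ∈ {u | u ∈ S ∧ u - v ∈ Q} := by
    rw [h1]
    simpa using hq
  exact this.1

/-- A set off a line `Q` meeting the cosets of `Q` uniformly and of size divisible by `p` is a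
union of cosets. -/
theorem full_of_cosets {Q : AddSubgroup V} (hQ : Nat.card Q = p) {S : Set V}
    (hSQ : ∀ v ∈ S, v ∉ Q) (hd : p ∣ S.ncard)
    (hu : ∀ v ∈ S, ∀ v' ∈ S, {u | u ∈ S ∧ u - v ∈ Q}.ncard = {u | u ∈ S ∧ u - v' ∈ Q}.ncard)
    {v : V} (hv : v ∈ S) {q : V} (hq : q ∈ Q) : v + q ∈ S := by
  classical
  have hw := hSQ v hv
  have hc := coset_sum hQ hw S
  set b := {u | u ∈ S ∧ u - v ∈ Q}.ncard with hb
  have key : ∀ k ∈ Finset.range p, {u | u ∈ S ∧ u - k • v ∈ Q}.ncard =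
      b * (if {u | u ∈ S ∧ u - k • v ∈ Q}.Nonempty then 1 else 0) := by
    intro k _
    split_ifs with h
    · obtain ⟨u, huS, hu'⟩ := h
      rw [mul_one, hb, hu v hv u huS]
      congr 1
      ext t
      refine and_congr_right fun _ => ⟨fun h => ?_, fun h => ?_⟩
      · have := sub_mem h hu'
        simpa using this
      · have := add_mem h hu'
        simpa using this
    · rw [Set.not_nonempty_iff_eq_empty.1 h]
      simp
  rw [Finset.sum_congr rfl key, ← Finset.mul_sum, Finset.sum_boole, Nat.cast_id] at hc
  have hlt : (Finset.filter (fun k => {u | u ∈ S ∧ u - k • v ∈ Q}.Nonempty)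
      (Finset.range p)).card < p := by
    conv_rhs => rw [← Finset.card_range p]
    refine Finset.card_lt_card (Finset.filter_ssubset.2 ⟨0, ?_, ?_⟩)
    · simpa using hP.prime.pos
    · rintro ⟨u, hu, hu'⟩
      simp at hu'
      exact hSQ u hu hu'
  have hpos : 0 < (Finset.filter (fun k => {u | u ∈ S ∧ u - k • v ∈ Q}.Nonempty)
      (Finset.range p)).card := by
    refine Finset.card_pos.2 ⟨1, ?_⟩
    simp only [Finset.mem_filter, Finset.mem_range, one_smul]
    exact ⟨hP.prime.one_lt, v, hv, by simp⟩
  rw [hc, Nat.Prime.dvd_mul hP.prime] at hd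
  have hb0 : 0 < b := (Set.ncard_pos (Set.toFinite _)).2 ⟨v, hv, by simp⟩
  have hbp : b ≤ p := by
    rw [← card_coset hQ v]
    exact Set.ncard_le_ncard (fun x hx => hx.2) (Set.toFinite _)
  refine coset_full hQ ?_ hq
  rcases hd with hd | hd
  · exact le_antisymm hbp (Nat.le_of_dvd hb0 hd)
  · have := Nat.le_of_dvd hpos hd
    omega

end Plane

/-- The subgroup of order two of the cyclic group of order four. -/
def Z2 : AddSubgroup (ZMod 4) where
  carrier := {0, 2}
  zero_mem' := by simp
  add_mem' := by
    rintro a b (rfl | rfl) (rfl | rfl) <;> decide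
  neg_mem' := by
    rintro a (rfl | rfl) <;> decide

theorem mem_Z2 {h : ZMod 4} : h ∈ Z2 ↔ h = 0 ∨ h = 2 := Iff.rfl

theorem zmod4_cases (h : ZMod 4) : h = 0 ∨ h = 2 ∨ h = 1 ∨ h = 3 := by
  revert h; decide

namespace Sch

variable {p : ℕ} {V : Type*} [AddCommGroup V] [Fintype V] [hP : Plane p V]

include hP in
variable (p V) in
theorem natCast_sq : ((p * p : ℕ) : ZMod 4) = 1 := by
  have : p % 4 = 1 ∨ p % 4 = 3 := by
    have := Nat.odd_iff.1 hP.odd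
    omega
  have h : (p * p) % 4 = 1 := by
    rcases this with h | h <;> simp [Nat.mul_mod, h]
  rw [← ZMod.natCast_mod, h]
  rfl

include hP in
variable (p) in
theorem sq_smul (x : ZMod 4 × V) : (p * p) • x = (x.1, 0) := by
  ext
  · rw [Prod.smul_fst, nsmul_eq_mul, natCast_sq p V, one_mul]
  · rw [Prod.smul_snd, mul_smul, hP.psmul]

include hP in
variable (p) in
theorem sub_fst {W : AddSubgroup (ZMod 4 × V)} {h : ZMod 4} {v : V} (hv : (h, v) ∈ W) :
    (h, 0) ∈ W := by
  have := nsmul_mem hv (p * p)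
  rwa [sq_smul p] at this

include hP in
variable (p) in
theorem sub_snd {W : AddSubgroup (ZMod 4 × V)} {h : ZMod 4} {v : V} (hv : (h, v) ∈ W) :
    (0, v) ∈ W := by
  have := sub_mem hv (sub_fst p hv)
  simpa using this

/-- The intersection of a subgroup with the second factor. -/
def vp (W : AddSubgroup (ZMod 4 × V)) : AddSubgroup V := W.comap (AddMonoidHom.inr _ _)

theorem mem_vp {W : AddSubgroup (ZMod 4 × V)} {v : V} : v ∈ vp W ↔ (0, v) ∈ W := Iff.rfl

include hP in
variable (p) in
theorem mem_sub {W : AddSubgroup (ZMod 4 × V)} {h : ZMod 4} {v : V} :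
    (h, v) ∈ W ↔ (h, 0) ∈ W ∧ v ∈ vp W := by
  refine ⟨fun hv => ⟨sub_fst p hv, sub_snd p hv⟩, fun ⟨h1, h2⟩ => ?_⟩
  have := add_mem h1 (mem_vp.1 h2)
  simpa using this

theorem H_mem {W : AddSubgroup (ZMod 4 × V)} (h1 : ((1, 0) : ZMod 4 × V) ∈ W) (h : ZMod 4) :
    (h, 0) ∈ W := by
  have := nsmul_mem h1 h.val
  simpa using this

include hP in
variable (p) in
theorem odd_mem {W : AddSubgroup (ZMod 4 × V)} {h : ZMod 4} {v : V} (hv : (h, v) ∈ W)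
    (hh : h = 1 ∨ h = 3) : ((1, 0) : ZMod 4 × V) ∈ W := by
  have h1 := sub_fst p hv
  rcases hh with rfl | rfl
  · exact h1
  · have := neg_mem h1
    rwa [Prod.neg_mk, neg_zero, show (-3 : ZMod 4) = 1 by decide] at this

theorem eq_top_of {W : AddSubgroup (ZMod 4 × V)} (h1 : ((1, 0) : ZMod 4 × V) ∈ W)
    (h2 : ∀ v : V, (0, v) ∈ W) : W = ⊤ := by
  rw [eq_top_iff]
  rintro ⟨h, v⟩ -
  have := add_mem (H_mem h1 h) (h2 v)
  simpa using this

theorem snd_add_self {x y : ZMod 4 × V} : x + x = y + y ↔ (x.1 + x.1 = y.1 + y.1) ∧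
    x.2 + x.2 = y.2 + y.2 := Prod.ext_iff

theorem zmod4_double {a b : ZMod 4} : a + a = b + b ↔ a = b ∨ a = b + 2 := by
  revert a b; decide

theorem zz : ((2, 0) : ZMod 4 × V) + (2, 0) = 0 := by
  ext
  · show (2 + 2 : ZMod 4) = 0
    decide
  · simp

theorem neg_z : -((2, 0) : ZMod 4 × V) = (2, 0) := neg_eq_of_add_eq_zero_left zz

include hP in
variable (p) in
theorem double_iff {x y : ZMod 4 × V} : x + x = y + y ↔ x = y ∨ x = y + (2, 0) := by
  rw [snd_add_self, zmod4_double]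
  constructor
  · rintro ⟨h1 | h1, h2⟩
    · exact Or.inl (Prod.ext h1 (Plane.double_inj p h2))
    · exact Or.inr (Prod.ext h1 (by simpa using Plane.double_inj p h2))
  · rintro (rfl | rfl)
    · simp
    · simp

theorem add_z_ne (x : ZMod 4 × V) : x + (2, 0) ≠ x := by
  intro h
  have h1 : ((2, 0) : ZMod 4 × V) = 0 := by simpa using h
  have h2 : (2 : ZMod 4) = 0 := congrArg Prod.fst h1
  revert h2; decide

theorem z_ne_zero : ((2, 0) : ZMod 4 × V) ≠ 0 := by
  intro h
  have h2 : (2 : ZMod 4) = 0 := congrArg Prod.fst h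
  revert h2; decide

variable {s : Sch (ZMod 4 × V)}

include hP in
variable (p) in
/-- Doubles of elements of `S` whose translate by the involution is outside `S`. -/
theorem Inv.sq {S : Set (ZMod 4 × V)} (hS : s.Inv S) :
    s.Inv {g | ∃ x ∈ S, x + (2, 0) ∉ S ∧ x + x = g} := by
  have key : ∀ g, g ∈ {g | ∃ x ∈ S, x + (2, 0) ∉ S ∧ x + x = g} ↔
      {t | t ∈ S ∧ 2 • t = g}.ncard % 2 = 1 := by
    intro g
    simp only [two_nsmul]
    constructor
    · rintro ⟨x, hx, hxz, rfl⟩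
      have : {t | t ∈ S ∧ t + t = x + x} = {x} := by
        ext t
        simp only [Set.mem_ofPred_eq, Set.mem_singleton_iff, double_iff p]
        constructor
        · rintro ⟨ht, h | h⟩
          · exact h
          · exact absurd (h ▸ ht) hxz
        · rintro rfl
          exact ⟨hx, Or.inl rfl⟩
      rw [this, Set.ncard_singleton]
    · intro h
      have hpos : 0 < {t | t ∈ S ∧ t + t = g}.ncard := by omega
      obtain ⟨x, hx, rfl⟩ := (Set.ncard_pos (Set.toFinite _)).1 hpos
      refine ⟨x, hx, fun hxz => ?_, rfl⟩
      have : {t | t ∈ S ∧ t + t = x + x} = {x, x + (2, 0)} := by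
        ext t
        simp only [Set.mem_ofPred_eq, double_iff p, Set.mem_insert_iff, Set.mem_singleton_iff]
        constructor
        · exact fun h => h.2
        · rintro (rfl | rfl)
          · exact ⟨hx, Or.inl rfl⟩
          · exact ⟨hxz, Or.inr rfl⟩
      rw [this, Set.ncard_pair (add_z_ne x).symm] at h
      omega
  intro x y h hx
  rw [key] at *
  rw [← hx]
  exact (hS.frob Nat.prime_two h).symm

include hP in
variable (p) in
theorem Inv.pp {S : Set (ZMod 4 × V)} (hS : s.Inv S) {h : ZMod 4}
    (hd : ¬ p ∣ {v | (h, v) ∈ S}.ncard) :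
    ∃ W : AddSubgroup (ZMod 4 × V), s.Inv (W : Set (ZMod 4 × V)) ∧ (∀ x ∈ W, x.2 = 0) ∧
      (h, 0) ∈ W := by
  set W' : Set (ZMod 4 × V) := {g | ¬ p ∣ {t | t ∈ S ∧ p • t = g}.ncard} with hW'
  have h1 : s.Inv W' := by
    intro x y hxy hx
    have := hS.frob hP.prime hxy
    simp only [hW', Set.mem_ofPred_eq] at *
    rwa [← (Nat.ModEq.dvd_iff this (dvd_refl p))]
  have h2 : ∀ x ∈ W', x.2 = 0 := by
    intro x hx
    have : {t | t ∈ S ∧ p • t = x}.Nonempty := by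
      by_contra hc
      rw [Set.not_nonempty_iff_eq_empty] at hc
      simp [hW', hc] at hx
    obtain ⟨t, -, rfl⟩ := this
    exact hP.psmul t.2
  have h3 : p • ((h, 0) : ZMod 4 × V) ∈ W' := by
    have : {t | t ∈ S ∧ p • t = p • ((h, 0) : ZMod 4 × V)} = (fun v => (h, v)) '' {v | (h, v) ∈ S} := by
      ext ⟨a, v⟩
      simp only [Set.mem_ofPred_eq, Set.mem_image, Prod.mk.injEq, Prod.smul_mk, hP.psmul]
      constructor
      · rintro ⟨ht, h1, -⟩
        have h4 : p • p • a = p • p • h := congrArg (fun a => p • a) h1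
        rw [← mul_smul, ← mul_smul, nsmul_eq_mul, nsmul_eq_mul, natCast_sq p V, one_mul,
          one_mul] at h4
        subst h4
        exact ⟨v, ht, rfl, rfl⟩
      · rintro ⟨v, hv, rfl, rfl⟩
        exact ⟨hv, rfl, trivial⟩
    simp only [hW', Set.mem_ofPred_eq]
    rwa [this, Set.ncard_image_of_injective]
    intro a b hab
    simpa using hab
  refine ⟨AddSubgroup.closure W', h1.closure, ?_, ?_⟩
  · intro x hx
    induction hx using AddSubgroup.closure_induction with
    | mem x hx => exact h2 x hx
    | zero => rfl
    | add a b _ _ ha hb => rw [Prod.snd_add, ha, hb, add_zero]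
    | neg a _ ha => rw [Prod.snd_neg, ha, neg_zero]
  · have := nsmul_mem (AddSubgroup.subset_closure h3) p
    rwa [← mul_smul, sq_smul p] at this

include hP in
variable (p) in
theorem scal_r {k : ℕ} (hk : ¬ p ∣ k) {h h' : ZMod 4} {u u' : V} (hr : s.r (h, u) (h', u')) :
    s.r (h, k • u) (h', k • u') := by
  have hc : Nat.Coprime 4 p := by
    have : Nat.Coprime 2 p := (Nat.coprime_two_left).2 hP.odd
    exact Nat.Coprime.pow_left 2 this
  obtain ⟨n, hn1, hn2⟩ := Nat.chineseRemainder hc 1 k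
  have hcop : n.Coprime (Fintype.card (ZMod 4 × V)) := by
    rw [Fintype.card_prod, ZMod.card, hP.card]
    refine Nat.Coprime.mul_right ?_ (Nat.Coprime.pow_right 2 ?_)
    · rw [Nat.coprime_iff_gcd_eq_one, Nat.ModEq.gcd_eq hn1]
      rfl
    · rw [Nat.coprime_iff_gcd_eq_one, Nat.ModEq.gcd_eq hn2]
      exact ((Nat.Prime.coprime_iff_not_dvd hP.prime).2 hk).symm
  have := smul_r hcop hr
  have h4 : ∀ a : ZMod 4, n • a = a := by
    intro a
    rw [nsmul_eq_mul, (ZMod.natCast_eq_natCast_iff _ _ _).2 hn1]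
    simp
  simpa only [Prod.smul_mk, h4, Plane.smul_congr hn2] using this

end Sch

namespace Sch

variable {p : ℕ} {V : Type*} [AddCommGroup V] [Fintype V]

/-- Subgroups which are unions of classes. -/
def Isub {Γ : Type*} [AddCommGroup Γ] [Fintype Γ] (s : Sch Γ) (W : AddSubgroup Γ) : Prop :=
  s.Inv (W : Set Γ)

/-- Tensor decompositions. -/
def Tens (s : Sch (ZMod 4 × V)) : Prop :=
  ∃ A B : AddSubgroup (ZMod 4 × V), A ≠ ⊥ ∧ B ≠ ⊥ ∧ s.Isub A ∧ s.Isub B ∧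
    A ⊓ B = ⊥ ∧ A ⊔ B = ⊤ ∧
    ∀ a ∈ A, ∀ c ∈ A, ∀ b ∈ B, ∀ d ∈ B, s.r a c → s.r b d → s.r (a + b) (c + d)

/-- Wreath decompositions with trivial section. -/
def WrTriv (s : Sch (ZMod 4 × V)) : Prop :=
  ∃ U L : AddSubgroup (ZMod 4 × V), L ≤ U ∧ s.Isub U ∧ s.Isub L ∧ L ≠ ⊥ ∧ U ≠ ⊤ ∧
    (∀ x ∉ U, ∀ l ∈ L, s.r x (x + l)) ∧ (∀ x ∈ U, ∀ y, s.r x y → y - x ∈ L)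

/-- Wreath decompositions over `C₂ × C_p` and `C₂`. -/
def WrCyc (p : ℕ) (s : Sch (ZMod 4 × V)) : Prop :=
  s.Inv {(2, 0)} ∧ ∃ Q : AddSubgroup V, Nat.card Q = p ∧ s.Isub ((⊥ : AddSubgroup (ZMod 4)).prod Q) ∧
    ∀ x ∉ Z2.prod Q, s.r x (x + (2, 0))

/-- Wreath decompositions over `C₄ × C_p` and `C₂`. -/
def WrExc (p : ℕ) (s : Sch (ZMod 4 × V)) : Prop :=
  s.Inv {(2, 0)} ∧ ∃ Q : AddSubgroup V, Nat.card Q = p ∧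
    s.Isub ((⊤ : AddSubgroup (ZMod 4)).prod Q) ∧ s.Isub ((⊥ : AddSubgroup (ZMod 4)).prod Q) ∧
    (∀ x ∉ (⊤ : AddSubgroup (ZMod 4)).prod Q, s.r x (x + (2, 0))) ∧
    ∀ y, s.r (1, 0) y ↔ y.1 = 1 ∧ y.2 ∈ Q

/-- The alternatives of the main theorem. -/
def Concl (p : ℕ) (s : Sch (ZMod 4 × V)) : Prop :=
  (∀ x y, x ≠ 0 → y ≠ 0 → s.r x y) ∨ Tens s ∨ WrTriv s ∨ WrCyc p s ∨ WrExc p s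

variable {s : Sch (ZMod 4 × V)}

theorem Concl.of_triv (h : WrTriv s) : Concl p s := Or.inr (Or.inr (Or.inl h))

theorem WrTriv.of_sub {U : AddSubgroup (ZMod 4 × V)} (hU : s.Isub U) (h0 : U ≠ ⊥) (h1 : U ≠ ⊤)
    (h : ∀ x ∉ U, ∀ l ∈ U, s.r x (x + l)) : WrTriv s :=
  ⟨U, U, le_rfl, hU, hU, h0, h1, h, fun _ hx _ hxy => sub_mem (hU _ _ hxy hx) hx⟩

theorem ne_bot_of_mem {W : AddSubgroup (ZMod 4 × V)} {x : ZMod 4 × V} (hx : x ∈ W) (h : x ≠ 0) :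
    W ≠ ⊥ := by
  rintro rfl
  exact h hx

theorem ne_top_of_notMem {W : AddSubgroup (ZMod 4 × V)} {x : ZMod 4 × V} (hx : x ∉ W) :
    W ≠ ⊤ := by
  rintro rfl
  exact hx trivial

theorem one_notMem_Z2 : (1 : ZMod 4) ∉ Z2 := by
  rw [mem_Z2]; decide

theorem C2_mem {x : ZMod 4 × V} : x ∈ Z2.prod (⊥ : AddSubgroup V) ↔ x = 0 ∨ x = (2, 0) := by
  rw [AddSubgroup.mem_prod, mem_Z2, AddSubgroup.mem_bot, Prod.ext_iff, Prod.ext_iff]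
  simp only [Prod.fst_zero, Prod.snd_zero]
  tauto

theorem C2_sub (hz : s.Inv {((2, 0) : ZMod 4 × V)}) : s.Isub (Z2.prod (⊥ : AddSubgroup V)) := by
  have : ((Z2.prod (⊥ : AddSubgroup V) : AddSubgroup (ZMod 4 × V)) : Set (ZMod 4 × V)) =
      {0} ∪ {(2, 0)} := by
    ext x
    rw [SetLike.mem_coe, C2_mem]
    rfl
  rw [Isub, this]
  exact inv_zero.union hz

theorem z_of_C2 (h : s.Isub (Z2.prod (⊥ : AddSubgroup V))) : s.Inv {((2, 0) : ZMod 4 × V)} := by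
  have : ({(2, 0)} : Set (ZMod 4 × V)) =
      ((Z2.prod (⊥ : AddSubgroup V) : AddSubgroup (ZMod 4 × V)) : Set (ZMod 4 × V)) \ {0} := by
    ext x
    rw [Set.mem_sdiff, SetLike.mem_coe, C2_mem, Set.mem_singleton_iff, Set.mem_singleton_iff]
    refine ⟨fun h => ⟨Or.inr h, h ▸ z_ne_zero⟩, fun h => h.1.resolve_left h.2⟩
  rw [this]
  exact h.diff inv_zero

theorem C2_ne_bot : Z2.prod (⊥ : AddSubgroup V) ≠ ⊥ :=
  ne_bot_of_mem (x := (2, 0)) (C2_mem.2 (Or.inr rfl)) z_ne_zero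

theorem C2_ne_top : Z2.prod (⊥ : AddSubgroup V) ≠ ⊤ :=
  ne_top_of_notMem (x := (1, 0)) (fun h => one_notMem_Z2 h.1)

theorem WrTriv.of_C2 (hz : s.Inv {((2, 0) : ZMod 4 × V)})
    (h : ∀ x ∉ Z2.prod (⊥ : AddSubgroup V), s.r x (x + (2, 0))) : WrTriv s := by
  refine WrTriv.of_sub (C2_sub hz) C2_ne_bot C2_ne_top fun x hx l hl => ?_
  rcases C2_mem.1 hl with rfl | rfl
  · rw [add_zero]; exact rfl' x
  · exact h x hx

theorem zr (hz : s.Inv {((2, 0) : ZMod 4 × V)}) {x y : ZMod 4 × V} (h : s.r x y) :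
    s.r (x + (2, 0)) (y + (2, 0)) := by
  rw [add_comm x, add_comm y]
  exact single_add hz h

theorem noninv (hz : s.Inv {((2, 0) : ZMod 4 × V)}) {x y : ZMod 4 × V}
    (hx : ¬ s.r x (x + (2, 0))) (hy : s.r x y) : ¬ s.r x (y + (2, 0)) :=
  fun h => hx (trans' h (symm' (zr hz hy)))

theorem Z2_double (h : ZMod 4) : h + h ∈ Z2 := by
  rw [mem_Z2]; revert h; decide

theorem Z2_double_eq {h : ZMod 4} (hh : h ∈ Z2) : h + h = 0 := by
  rcases hh with rfl | rfl <;> decide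

theorem not_Z2 {h : ZMod 4} (hh : h ∉ Z2) : h = 1 ∨ h = 3 := by
  rw [mem_Z2] at hh; revert h; decide

theorem odd_not_Z2 {h : ZMod 4} (hh : h = 1 ∨ h = 3) : h ∉ Z2 := by
  rw [mem_Z2]; revert h; decide

variable [hP : Plane p V]

include hP in
variable (p) in
theorem Inv.dbl (hz : s.Inv {((2, 0) : ZMod 4 × V)}) {x : ZMod 4 × V}
    (hx : ¬ s.r x (x + (2, 0))) : s.Inv {g | ∃ y, s.r x y ∧ y + y = g} := by
  have h := (cl_inv (s := s) x).sq p
  convert h using 5 with g y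
  refine ⟨fun h => ⟨h.1, noninv hz hx h.1, h.2⟩, fun h => ⟨h.1, h.2.2⟩⟩

theorem closure_le' {S : Set (ZMod 4 × V)} {W : AddSubgroup (ZMod 4 × V)} (h : ∀ x ∈ S, x ∈ W) :
    AddSubgroup.closure S ≤ W := (AddSubgroup.closure_le W).2 h

include hP in
variable (p) in
/-- A subgroup inside the first factor missing the generator. -/
theorem z_of_sub {W : AddSubgroup (ZMod 4 × V)} (hW : s.Isub W) (h2 : ∀ x ∈ W, x.2 = 0)
    (h1 : ((1, 0) : ZMod 4 × V) ∉ W) {x : ZMod 4 × V} (hx : x ∈ W) (h0 : x ≠ 0) :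
    s.Inv {((2, 0) : ZMod 4 × V)} := by
  have h4 : ∀ y ∈ W, y.1 ∈ Z2 := by
    intro y hy
    by_contra hc
    exact h1 (odd_mem (p := p) (v := y.2) hy (not_Z2 hc))
  have h5 : ((2, 0) : ZMod 4 × V) ∈ W := by
    have := C2_mem.1 (show x ∈ Z2.prod (⊥ : AddSubgroup V) from ⟨h4 x hx, h2 x hx⟩)
    rw [← this.resolve_left h0]
    exact hx
  have : W = Z2.prod ⊥ := by
    ext y
    refine ⟨fun hy => ⟨h4 y hy, h2 y hy⟩, fun hy => ?_⟩
    rcases C2_mem.1 hy with rfl | rfl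
    · exact zero_mem _
    · exact h5
  rw [this] at hW
  exact z_of_C2 hW

theorem vp_ne_top {W : AddSubgroup (ZMod 4 × V)} (h : ¬ ∀ v : V, (0, v) ∈ W) : vp W ≠ ⊤ := by
  intro h'
  refine h fun v => ?_
  rw [← mem_vp, h']
  trivial

theorem vp_mono {W W' : AddSubgroup (ZMod 4 × V)} (h : W ≤ W') : vp W ≤ vp W' :=
  fun _ hv => h hv

end Sch

namespace Sch

variable {p : ℕ} {V : Type*} [AddCommGroup V] [Fintype V] [hP : Plane p V]
variable {s : Sch (ZMod 4 × V)}

theorem vp_ne_top_of_even (hV : ∀ W, s.Isub W → (∀ v : V, (0, v) ∈ W) → W = ⊤)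
    {W : AddSubgroup (ZMod 4 × V)} (hW : s.Isub W) (h : ∀ x ∈ W, x.1 ∈ Z2) : vp W ≠ ⊤ := by
  refine vp_ne_top fun hc => ?_
  have := hV W hW hc
  refine one_notMem_Z2 (h (1, 0) ?_)
  rw [this]
  trivial

theorem closure_even {S : Set (ZMod 4 × V)} (h : ∀ x ∈ S, x.1 ∈ Z2) :
    ∀ x ∈ AddSubgroup.closure S, x.1 ∈ Z2 := by
  have := closure_le' (W := Z2.prod ⊤) (fun x hx => ⟨h x hx, trivial⟩)
  exact fun x hx => (this hx).1

theorem closure_snd {S : Set (ZMod 4 × V)} {Q : AddSubgroup V} (h : ∀ x ∈ S, x.2 ∈ Q) :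
    ∀ x ∈ AddSubgroup.closure S, x.2 ∈ Q := by
  have := closure_le' (W := (⊤ : AddSubgroup (ZMod 4)).prod Q) (fun x hx => ⟨trivial, h x hx⟩)
  exact fun x hx => (this hx).2

theorem ne_top_of_snd {W : AddSubgroup (ZMod 4 × V)} {Q : AddSubgroup V} (hQ : Q ≠ ⊤)
    (h : ∀ x ∈ W, x.2 ∈ Q) : W ≠ ⊤ := by
  rintro rfl
  exact hQ (eq_top_iff.2 fun v _ => h (0, v) trivial)

include hP in
theorem primitive_single (hz : s.Inv {((2, 0) : ZMod 4 × V)})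
    (hH : ∀ W, s.Isub W → ((1, 0) : ZMod 4 × V) ∈ W → W = ⊤)
    (hV : ∀ W, s.Isub W → (∀ v : V, (0, v) ∈ W) → W = ⊤) : Concl p s := by
  have hD : ∀ x, ¬ s.r x (x + (2, 0)) → x.1 ∈ Z2 := by
    intro x hx
    have hS := Inv.dbl p hz hx
    set T := AddSubgroup.closure {g | ∃ y, s.r x y ∧ y + y = g} with hT
    have hTs : s.Isub T := hS.closure
    have hTe : ∀ x ∈ T, x.1 ∈ Z2 := by
      refine closure_even ?_
      rintro _ ⟨y, -, rfl⟩
      exact Z2_double _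
    have hTv := vp_ne_top_of_even hV hTs hTe
    have h1 : ∀ y ∈ AddSubgroup.closure (s.cl x), y.2 ∈ vp T := by
      refine closure_snd fun y hy => ?_
      have : y + y ∈ T := AddSubgroup.subset_closure ⟨y, hy, rfl⟩
      exact (Plane.double_mem p).1 ((mem_sub p).1 this).2
    by_contra hc
    refine ne_top_of_snd hTv h1 (hH _ (cl_inv (s := s) x).closure ?_)
    exact odd_mem p (v := x.2) (AddSubgroup.subset_closure (self_mem_cl x)) (not_Z2 hc)
  by_cases hD0 : ∀ x, ¬ s.r x (x + (2, 0)) → x.2 = 0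
  · refine Concl.of_triv (WrTriv.of_C2 hz fun x hx => ?_)
    by_contra hc
    exact hx ⟨hD x hc, hD0 x hc⟩
  push Not at hD0
  obtain ⟨x, hx, hx2⟩ := hD0
  have hDi : s.Inv {x | ¬ s.r x (x + (2, 0))} := by
    intro a b hab ha hb
    exact ha (trans' (trans' hab hb) (symm' (zr hz hab)))
  set W := AddSubgroup.closure {x | ¬ s.r x (x + (2, 0))} with hWd
  have hW : s.Isub W := hDi.closure
  have hWe : ∀ x ∈ W, x.1 ∈ Z2 := closure_even hD
  have hWv := vp_ne_top_of_even hV hW hWe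
  have hxv : x.2 ∈ vp W := ((mem_sub p).1 (AddSubgroup.subset_closure hx : x ∈ W)).2
  have hQ : Nat.card (vp W) = p := by
    rcases Plane.cases_subgroup p (vp W) with h | h | h
    · rw [h] at hxv
      exact absurd hxv hx2
    · exact h
    · exact absurd h hWv
  refine Or.inr (Or.inr (Or.inr (Or.inl ⟨hz, vp W, hQ, ?_, fun y hy => ?_⟩)))
  · have hS := Inv.dbl p hz hx
    set T := AddSubgroup.closure {g | ∃ y, s.r x y ∧ y + y = g} with hT
    have hTW : ∀ y ∈ T, y ∈ (⊥ : AddSubgroup (ZMod 4)).prod (vp W) := by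
      intro y hy
      refine closure_le' ?_ hy
      rintro _ ⟨y, hy, rfl⟩
      have : y ∈ W := AddSubgroup.subset_closure (hDi _ _ hy hx)
      have h2 := ((mem_sub p).1 this).2
      exact ⟨Z2_double_eq (hWe y this), add_mem h2 h2⟩
    have hxT : x + x ∈ T := AddSubgroup.subset_closure ⟨x, rfl' x, rfl⟩
    have hline : AddSubgroup.zmultiples (x.2 + x.2) = vp W :=
      Plane.zmultiples_eq_line hQ (add_mem hxv hxv) (fun h => hx2 ((Plane.two_smul_eq_zero p).1 h))
    have : T = (⊥ : AddSubgroup (ZMod 4)).prod (vp W) := by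
      refine le_antisymm hTW ?_
      rintro ⟨h, v⟩ ⟨rfl, hv⟩
      have hv' : v ∈ vp W := hv
      rw [← hline, Plane.mem_zmultiples_iff p] at hv'
      obtain ⟨k, -, rfl⟩ := hv'
      have := nsmul_mem ((mem_sub p).1 hxT).2 k
      exact this
    rw [← this]
    exact hS.closure
  · by_contra hc
    have : y ∈ W := AddSubgroup.subset_closure hc
    exact hy ⟨hWe y this, ((mem_sub p).1 this).2⟩

include hP in
theorem primitive_z (hz : ¬ s.Inv {((2, 0) : ZMod 4 × V)})
    (hH : ∀ W, s.Isub W → ((1, 0) : ZMod 4 × V) ∈ W → W = ⊤)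
    (hV : ∀ W, s.Isub W → (∀ v : V, (0, v) ∈ W) → W = ⊤)
    {W0 : AddSubgroup (ZMod 4 × V)} (hW0 : s.Isub W0) (hW0t : W0 ≠ ⊤)
    (hzW : ((2, 0) : ZMod 4 × V) ∈ W0) : Concl p s := by
  have hodd : ∀ W, s.Isub W → W ≠ ⊤ → ∀ x ∈ W, x.1 ∈ Z2 := by
    intro W hW hWt x hx
    by_contra hc
    exact hWt (hH W hW (odd_mem p (v := x.2) hx (not_Z2 hc)))
  have he0 := hodd W0 hW0 hW0t
  have hQ : Nat.card (vp W0) = p := by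
    rcases Plane.cases_subgroup p (vp W0) with h | h | h
    · exfalso
      refine hz (z_of_sub p hW0 (fun x hx => ?_) (fun h => one_notMem_Z2 (he0 _ h)) hzW z_ne_zero)
      have := ((mem_sub p).1 (show (x.1, x.2) ∈ W0 from hx)).2
      rwa [h] at this
    · exact h
    · exact absurd h (vp_ne_top_of_even hV hW0 he0)
  set Q := vp W0 with hQd
  have hmem0 : ∀ x : ZMod 4 × V, x ∈ W0 ↔ x.1 ∈ Z2 ∧ x.2 ∈ Q := by
    rintro ⟨h, v⟩
    refine ⟨fun hx => ⟨he0 _ hx, ((mem_sub p).1 hx).2⟩, fun ⟨h1, h2⟩ => (mem_sub p).2 ⟨?_, h2⟩⟩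
    rcases h1 with h1 | h1
    · have h1' : h = 0 := h1
      subst h1'
      exact zero_mem _
    · have h1' : h = 2 := h1
      subst h1'
      exact hzW
  have hmax : ∀ W, s.Isub W → (∀ x ∈ W, x.1 ∈ Z2) → W ≤ W0 := by
    intro W hW hWe
    have h1 : s.Isub (W ⊔ W0) := inv_sup hW hW0
    have h2 : ∀ x ∈ W ⊔ W0, x.1 ∈ Z2 := by
      have : W ⊔ W0 ≤ Z2.prod ⊤ :=
        sup_le (fun x hx => ⟨hWe x hx, trivial⟩) (fun x hx => ⟨he0 x hx, trivial⟩)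
      exact fun x hx => (this hx).1
    have h3 := Plane.line_le hQ (vp_ne_top_of_even hV h1 h2) (vp_mono le_sup_right)
    intro x hx
    rw [hmem0]
    refine ⟨hWe x hx, ?_⟩
    rw [h3]
    exact ((mem_sub p).1 ((le_sup_left : W ≤ W ⊔ W0) hx)).2
  have hcomp : ∀ {S : Set (ZMod 4 × V)}, s.Inv S → ∀ h : ZMod 4, h ≠ 0 →
      p ∣ {v | (h, v) ∈ S}.ncard := by
    intro S hS h h0
    by_contra hc
    obtain ⟨W, hW, hW2, hh⟩ := hS.pp p hc
    refine hz (z_of_sub p hW hW2 (fun h1 => ?_) hh (fun h => h0 (congrArg Prod.fst h)))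
    exact ne_top_of_snd (Q := ⊥) (Plane.line_ne_bot hQ |> fun h => by
      intro h'
      exact h (le_bot_iff.1 (h' ▸ le_top))) hW2 (hH W hW h1)
  refine Concl.of_triv (WrTriv.of_sub hW0 (ne_bot_of_mem hzW z_ne_zero) hW0t fun x hx => ?_)
  have hzin : ∀ y, s.r x y → ¬ s.r x (y + (2, 0)) → y.2 ∈ Q := by
    intro y hy hyz
    have h1 := ((cl_inv (s := s) x).sq p).closure
    have h2 := hmax _ h1 (closure_even (by
      rintro _ ⟨y, -, -, rfl⟩
      exact Z2_double _))
    have h3 : y + y ∈ W0 := h2 (AddSubgroup.subset_closure ⟨y, hy, hyz, rfl⟩)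
    exact (Plane.double_mem p).1 ((hmem0 _).1 h3).2
  have hnot : ∀ y, s.r x y → y ∉ W0 := fun y hy h => hx (hW0 _ _ (symm' hy) h)
  obtain ⟨y, hy, hye⟩ : ∃ y, s.r x y ∧ y.1 ∈ Z2 := by
    by_contra! hc
    have h0 : ∀ a b : ZMod 4, a ∉ Z2 → b ∉ Z2 → a - b ∈ Z2 ∧ a + b ∈ Z2 := by
      simp only [mem_Z2]; decide
    have h1 : s.cl x - s.cl x ⊆ (W0 : Set (ZMod 4 × V)) := by
      refine Set.Subset.trans AddSubgroup.subset_closure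
        (hmax _ ((cl_inv (s := s) x).sub (cl_inv x)).closure (closure_even ?_))
      rintro _ ⟨a, ha, b, hb, rfl⟩
      exact (h0 _ _ (hc a ha) (hc b hb)).1
    have h2 : s.cl x + s.cl x ⊆ (W0 : Set (ZMod 4 × V)) := by
      refine Set.Subset.trans AddSubgroup.subset_closure
        (hmax _ ((cl_inv (s := s) x).add (cl_inv x)).closure (closure_even ?_))
      rintro _ ⟨a, ha, b, hb, rfl⟩
      exact (h0 _ _ (hc a ha) (hc b hb)).2
    have h3 : ∀ y ∈ AddSubgroup.closure (s.cl x), y.2 ∈ Q := by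
      refine closure_snd fun y hy => ?_
      have : y + y ∈ W0 := h2 ⟨y, hy, y, hy, rfl⟩
      exact (Plane.double_mem p).1 ((hmem0 _).1 this).2
    refine ne_top_of_snd (Plane.line_ne_top hQ) h3 (hH _ (cl_inv (s := s) x).closure ?_)
    exact odd_mem p (v := x.2) (AddSubgroup.subset_closure (self_mem_cl x))
      (not_Z2 (hc x (rfl' x)))
  have hyQ : ∀ y, s.r x y → y.1 ∈ Z2 → y.2 ∉ Q := fun y hy h1 h2 => hnot y hy ((hmem0 y).2 ⟨h1, h2⟩)
  have hzz : ∀ y, s.r x y → y.1 ∈ Z2 → s.r x (y + (2, 0)) := by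
    intro y hy h1
    by_contra hc
    exact hyQ y hy h1 (hzin y hy hc)
  obtain ⟨v, hv⟩ : ∃ v, s.r x (2, v) := by
    obtain ⟨h, v⟩ := y
    rcases hye with h1 | h1
    · have h1' : h = 0 := h1
      subst h1'
      have := hzz _ hy (Or.inl rfl)
      refine ⟨v, ?_⟩
      simpa using this
    · have h1' : h = 2 := h1
      subst h1'
      exact ⟨v, hy⟩
  have hswap : ∀ v, s.r x (2, v) ↔ s.r x (0, v) := by
    intro v
    constructor
    · intro h
      have := hzz _ h (Or.inr rfl)
      rw [Prod.mk_add_mk, add_zero] at this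
      exact this
    · intro h
      have := hzz _ h (Or.inl rfl)
      rwa [Prod.mk_add_mk, add_zero, zero_add] at this
  have hcount : ∀ v, s.r x (2, v) → {t | t ∈ s.cl x ∧ t - (2, v) ∈ W0}.ncard =
      2 * {u | s.r x (2, u) ∧ u - v ∈ Q}.ncard := by
    intro v hv
    have : {t | t ∈ s.cl x ∧ t - (2, v) ∈ W0} =
        ((Z2 : Set (ZMod 4)) ×ˢ {u | s.r x (2, u) ∧ u - v ∈ Q}) := by
      ext ⟨h, u⟩
      simp only [Set.mem_ofPred_eq, Set.mem_prod, SetLike.mem_coe, hmem0, Prod.mk_sub_mk]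
      have h2 : h - 2 ∈ Z2 ↔ h ∈ Z2 := by simp only [mem_Z2]; revert h; decide
      rw [h2]
      constructor
      · rintro ⟨h3, h4, h5⟩
        refine ⟨h4, ?_, h5⟩
        rcases h4 with rfl | rfl
        · exact (hswap u).2 h3
        · exact h3
      · rintro ⟨h3, h4, h5⟩
        refine ⟨?_, h3, h5⟩
        rcases h3 with rfl | rfl
        · exact (hswap u).1 h4
        · exact h4
    rw [this, Set.ncard_prod]
    congr 1
    rw [show (Z2 : Set (ZMod 4)) = {0, 2} from rfl, Set.ncard_pair (by decide)]
  have hfull : ∀ q ∈ Q, s.r x (2, v + q) := by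
    intro q hq
    refine Plane.full_of_cosets (p := p) hQ (S := {u | s.r x (2, u)}) ?_ ?_ ?_ hv hq
    · exact fun u hu => hyQ _ hu (Or.inr rfl)
    · exact hcomp (cl_inv (s := s) x) 2 (by decide)
    · intro u hu u' hu'
      have h1 := (cl_inv (s := s) x).mult hW0 (trans' (symm' hu) hu')
      rw [hcount u hu, hcount u' hu'] at h1
      exact Nat.eq_of_mul_eq_mul_left (by norm_num) h1
  have hfin : ∀ l ∈ W0, s.r x ((2, v) + l) := by
    rintro ⟨h, q⟩ hl
    obtain ⟨h1, h2⟩ := (hmem0 _).1 hl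
    rcases h1 with h1 | h1
    · have h1' : h = 0 := h1
      subst h1'
      simpa using hfull q h2
    · have h1' : h = 2 := h1
      subst h1'
      have := (hswap _).1 (hfull q h2)
      rwa [Prod.mk_add_mk, show (2 + 2 : ZMod 4) = 0 by decide]
  have hA := Inv.add_subset (s := s) hW0 (cl_inv x)
  intro l hl
  exact hA _ _ (symm' hv) hfin l hl

end Sch

namespace Sch

variable {p : ℕ} {V : Type*} [AddCommGroup V] [Fintype V] [hP : Plane p V]
variable {s : Sch (ZMod 4 × V)}

theorem zero_prod_mem {Q : AddSubgroup V} {x : ZMod 4 × V} :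
    x ∈ (⊥ : AddSubgroup (ZMod 4)).prod Q ↔ x.1 = 0 ∧ x.2 ∈ Q := Iff.rfl

include hP in
variable (p) in
theorem fst_zero_of_z {W : AddSubgroup (ZMod 4 × V)} (hz : ((2, 0) : ZMod 4 × V) ∉ W) :
    ∀ x ∈ W, x.1 = 0 := by
  rintro ⟨h, v⟩ hx
  have h1 := sub_fst p hx
  rcases zmod4_cases h with rfl | rfl | hh
  · rfl
  · exact absurd h1 hz
  · exact absurd (H_mem (odd_mem p hx hh) 2) hz

include hP in
variable (p) in
theorem max_proper (hzn : ∀ W, s.Isub W → ((2, 0) : ZMod 4 × V) ∈ W → W = ⊤)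
    (hV : ∀ W, s.Isub W → (∀ v : V, (0, v) ∈ W) → W = ⊤) :
    ∃ Q : AddSubgroup V, (Q = ⊥ ∨ Nat.card Q = p) ∧
      s.Isub ((⊥ : AddSubgroup (ZMod 4)).prod Q) ∧
      ∀ W, s.Isub W → W ≠ ⊤ → W ≤ (⊥ : AddSubgroup (ZMod 4)).prod Q := by
  have hz : ∀ W, s.Isub W → W ≠ ⊤ → ((2, 0) : ZMod 4 × V) ∉ W :=
    fun W hW hWt h => hWt (hzn W hW h)
  have hvp : ∀ W, s.Isub W → W ≠ ⊤ → vp W ≠ ⊤ :=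
    fun W hW hWt => vp_ne_top fun h => hWt (hV W hW h)
  by_cases hc : ∃ W, s.Isub W ∧ W ≠ ⊤ ∧ W ≠ ⊥
  · obtain ⟨W, hW, hWt, hWb⟩ := hc
    have hW1 := fst_zero_of_z p (hz W hW hWt)
    have heq : ∀ W : AddSubgroup (ZMod 4 × V), (∀ x ∈ W, x.1 = 0) →
        W = (⊥ : AddSubgroup (ZMod 4)).prod (vp W) := by
      intro W hW1
      ext ⟨h, v⟩
      rw [zero_prod_mem]
      constructor
      · exact fun hx => ⟨hW1 _ hx, sub_snd p hx⟩
      · rintro ⟨h1, h2⟩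
        have h1' : h = 0 := h1
        subst h1'
        exact h2
    have hQ : Nat.card (vp W) = p := by
      rcases Plane.cases_subgroup p (vp W) with h | h | h
      · refine absurd ?_ hWb
        rw [heq W hW1, h, AddSubgroup.bot_prod_bot]
      · exact h
      · exact absurd h (hvp W hW hWt)
    refine ⟨vp W, Or.inr hQ, ?_, fun W' hW' hWt' => ?_⟩
    · rw [← heq W hW1]
      exact hW
    · have hW1' := fst_zero_of_z p (hz W' hW' hWt')
      have h1 : s.Isub (W ⊔ W') := inv_sup hW hW'
      have h2 : W ⊔ W' ≤ (⊥ : AddSubgroup (ZMod 4)).prod ⊤ :=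
        sup_le (fun x hx => ⟨hW1 x hx, trivial⟩) (fun x hx => ⟨hW1' x hx, trivial⟩)
      have h3 : W ⊔ W' ≠ ⊤ := ne_top_of_notMem (x := (1, 0)) fun h => by
        have h4 : (1 : ZMod 4) = 0 := (h2 h).1
        revert h4; decide
      rw [Plane.line_le hQ (hvp _ h1 h3) (vp_mono le_sup_left), ← heq _ fun x hx => (h2 hx).1]
      exact le_sup_right
  · push Not at hc
    refine ⟨⊥, Or.inl rfl, ?_, fun W hW hWt => (hc W hW hWt).le.trans bot_le⟩
    rw [AddSubgroup.bot_prod_bot, Isub, AddSubgroup.coe_bot]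
    exact inv_zero

include hP in
theorem primitive_not_z (hzn : ∀ W, s.Isub W → ((2, 0) : ZMod 4 × V) ∈ W → W = ⊤)
    (hV : ∀ W, s.Isub W → (∀ v : V, (0, v) ∈ W) → W = ⊤) : Concl p s := by
  obtain ⟨Q, hQ, hP0, hmax⟩ := max_proper p hzn hV
  set P := (⊥ : AddSubgroup (ZMod 4)).prod Q with hPd
  have hmem : ∀ x : ZMod 4 × V, x ∈ P ↔ x.1 = 0 ∧ x.2 ∈ Q := fun x => zero_prod_mem
  have h20 : (2 : ZMod 4) ≠ 0 := by decide
  have hzP : ((2, 0) : ZMod 4 × V) ∉ P := fun h => h20 h.1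
  have hPt : P ≠ ⊤ := ne_top_of_notMem hzP
  have hdisj : ∀ x y, x ∉ P → s.r x y → y ∉ P := fun x y hx h hy => hx (hP0 _ _ (symm' h) hy)
  have hni : ∀ x y, x ∉ P → s.r x y → ¬ s.r x (y + (2, 0)) → y.1 = 2 ∧ y.2 ∈ Q := by
    intro x y hx hy hyz
    have h1 := ((cl_inv (s := s) x).sq p).closure
    have h2 : ∀ g ∈ AddSubgroup.closure {g | ∃ y ∈ s.cl x, y + (2, 0) ∉ s.cl x ∧ y + y = g},
        g.1 ∈ Z2 := by
      refine closure_even ?_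
      rintro _ ⟨y, -, -, rfl⟩
      exact Z2_double _
    have h3 := hmax _ h1 (ne_top_of_notMem (x := (1, 0)) fun h => one_notMem_Z2 (h2 _ h))
    have h4 := h3 (AddSubgroup.subset_closure ⟨y, hy, hyz, rfl⟩)
    have h5 : y.2 ∈ Q := (Plane.double_mem p).1 h4.2
    have h6 : y.1 + y.1 = 0 := h4.1
    refine ⟨?_, h5⟩
    by_contra hc
    have : y.1 = 0 := by
      generalize y.1 = h at *
      revert h; decide
    exact hdisj x y hx hy ⟨this, h5⟩
  have hmeet : ∀ x ∉ P, ∃ q ∈ Q, s.r x (2, q) := by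
    intro x hx
    by_contra! hc
    have h1 : ((2, 0) : ZMod 4 × V) ∈ stab (s.cl x) := by
      intro y hy
      by_contra hyz
      rw [add_comm] at hyz
      obtain ⟨h2, h3⟩ := hni x y hx hy hyz
      obtain ⟨h, v⟩ := y
      have h2' : h = 2 := h2
      subst h2'
      exact hc v h3 hy
    have h2 := hzn _ (cl_inv x).stab h1
    have h3 : -x ∈ stab (s.cl x) := by rw [h2]; trivial
    have h4 := h3 x (self_mem_cl x)
    rw [neg_add_cancel] at h4
    rw [zero' h4] at hx
    exact hx (zero_mem _)
  by_cases hall : ∀ q ∈ Q, s.r (2, 0) (2, q)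
  · have h1 : ∀ x ∉ P, s.r x (2, 0) := by
      intro x hx
      obtain ⟨q, hq, h⟩ := hmeet x hx
      exact trans' h (symm' (hall q hq))
    rcases hQ with hQ | hQ
    · refine Or.inl fun x y hx hy => ?_
      have h2 : ∀ x : ZMod 4 × V, x ≠ 0 → x ∉ P := by
        intro x hx
        rwa [hPd, hQ, AddSubgroup.bot_prod_bot, AddSubgroup.mem_bot]
      exact trans' (h1 x (h2 x hx)) (symm' (h1 y (h2 y hy)))
    · refine Concl.of_triv (WrTriv.of_sub hP0 ?_ hPt fun x hx l hl => ?_)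
      · intro h
        refine Plane.line_ne_bot hQ (le_bot_iff.1 fun q hq => ?_)
        have h5 : ((0, q) : ZMod 4 × V) ∈ P := ⟨rfl, hq⟩
        rw [h] at h5
        exact congrArg Prod.snd (h5 : ((0, q) : ZMod 4 × V) = 0)
      · refine trans' (h1 x hx) (symm' (h1 _ fun h => hx ?_))
        simpa using sub_mem h hl
  exfalso
  push Not at hall
  obtain ⟨q0, hq0, hnr⟩ := hall
  have hq00 : q0 ≠ 0 := by
    rintro rfl
    exact hnr (rfl' _)
  have hQ' : Nat.card Q = p := by
    refine hQ.resolve_left ?_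
    rintro rfl
    exact hq00 hq0
  have hscal : ∀ k : ℕ, ¬ p ∣ k → ∀ h v, s.r (2, 0) (h, v) → s.r (2, 0) (h, k • v) := by
    intro k hk h v hr
    have := scal_r p hk hr
    rwa [smul_zero] at this
  have huni : ∀ q ∈ Q, s.r (2, 0) (2, q) → q = 0 := by
    intro q hq hr
    by_contra hne
    rw [← Plane.zmultiples_eq_line hQ' hq hne, Plane.mem_zmultiples_iff p] at hq0
    obtain ⟨k, hk, rfl⟩ := hq0
    refine hnr (hscal k (fun hd => ?_) _ _ hr)
    have := Nat.eq_zero_of_dvd_of_lt hd hk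
    subst this
    exact hq00 (zero_smul _ _)
  have hcnt : ∀ y ∉ P, {t | t ∈ s.cl (2, 0) ∧ t - y ∈ P}.ncard = 1 := by
    intro y hy
    obtain ⟨q, hq, h⟩ := hmeet y hy
    rw [(cl_inv (s := s) (2, 0)).mult hP0 h, Set.ncard_eq_one]
    refine ⟨(2, 0), ?_⟩
    ext ⟨h, v⟩
    rw [Set.mem_ofPred_eq, Set.mem_singleton_iff]
    constructor
    · rintro ⟨h1, h2, h3⟩
      have h2' : h = 2 := sub_eq_zero.1 (h2 : h - 2 = 0)
      subst h2'
      have h4 : v ∈ Q := by simpa using add_mem (h3 : v - q ∈ Q) hq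
      rw [huni v h4 h1]
    · intro h
      rw [h]
      refine ⟨rfl' _, ?_, ?_⟩
      · simp
      · simpa using hq
  set R : ZMod 4 → Set V := fun h => {v | s.r (2, 0) (h, v)} with hR
  have hRc : ∀ h : ZMod 4, ∀ v, ((h, v) : ZMod 4 × V) ∉ P →
      {u | u ∈ R h ∧ u - v ∈ Q}.ncard = 1 := by
    intro h v hh
    rw [← hcnt _ hh, ← Set.ncard_image_of_injective (f := fun u : V => ((h, u) : ZMod 4 × V)) _
      (fun a b hab => by simpa using hab)]
    congr 1
    ext ⟨h', u⟩
    simp only [Set.mem_image, Set.mem_ofPred_eq, hmem]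
    constructor
    · rintro ⟨u', ⟨h1, h2⟩, h3⟩
      obtain ⟨rfl, rfl⟩ := Prod.mk.inj h3
      exact ⟨h1, by simp, h2⟩
    · rintro ⟨h1, h2, h3⟩
      have h2' : h' = h := sub_eq_zero.1 (h2 : h' - h = 0)
      subst h2'
      exact ⟨u, ⟨h1, h3⟩, rfl⟩
  have hline : ∀ T : Set V, (∀ k : ℕ, ¬ p ∣ k → ∀ v ∈ T, k • v ∈ T) → 0 ∈ T →
      (∀ v, {u | u ∈ T ∧ u - v ∈ Q}.ncard = 1) → ∃ L : AddSubgroup V, Nat.card L = p ∧ T = L := by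
    intro T hT h0 hT1
    have hTp := Plane.transversal_card hQ' hT1
    rcases Plane.line_of_scalar hT h0 (by rw [hTp]) with h | h
    · exact h
    · rw [h, Set.ncard_univ, Plane.card_eq p] at hTp
      have := hP.prime.one_lt
      nlinarith
  have h10 : (1 : ZMod 4) ≠ 0 := by decide
  have hzi : ∀ h v, s.r (2, 0) (h, v) → (h ≠ 2 ∨ v ≠ 0) → s.r (2, 0) (h + 2, v) := by
    intro h v hr hh
    by_contra hc
    obtain ⟨h1, h2⟩ := hni _ _ hzP hr (by simpa using hc)
    have h1' : h = 2 := h1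
    subst h1'
    exact hh.elim (fun h => h rfl) fun h => h (huni v h2 hr)
  obtain ⟨L1, hL1, hR1⟩ := hline (R 1) (fun k hk v hv => hscal k hk _ _ hv) (by
    have h1 := hRc 1 0 fun h => h10 h.1
    rw [Set.ncard_eq_one] at h1
    obtain ⟨q, hq⟩ := h1
    have hq1 : q ∈ {u | u ∈ R 1 ∧ u - 0 ∈ Q} := by rw [hq]; rfl
    have hq2 : 2 • q ∈ {u | u ∈ R 1 ∧ u - 0 ∈ Q} := by
      refine ⟨hscal 2 (Plane.not_dvd_two p V) _ _ hq1.1, ?_⟩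
      rw [sub_zero]
      exact nsmul_mem (by simpa using hq1.2) 2
    rw [hq, Set.mem_singleton_iff, two_smul, add_eq_left] at hq2
    rw [← hq2]
    exact hq1.1) (fun v => hRc 1 v fun h => h10 h.1)
  obtain ⟨L2, hL2, hR2⟩ := hline (R 2) (fun k hk v hv => hscal k hk _ _ hv) (rfl' _)
    (fun v => hRc 2 v fun h => h20 h.1)
  have hr1 : ∀ v, s.r (2, 0) (1, v) ↔ v ∈ L1 := fun v => by
    rw [← SetLike.mem_coe, ← hR1]; rfl
  have hr2 : ∀ v, s.r (2, 0) (2, v) ↔ v ∈ L2 := fun v => by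
    rw [← SetLike.mem_coe, ← hR2]; rfl
  have hr3 : ∀ v, s.r (2, 0) (3, v) ↔ v ∈ L1 := by
    intro v
    rw [← hr1]
    exact ⟨fun h => hzi 3 v h (Or.inl (by decide)), fun h => hzi 1 v h (Or.inl (by decide))⟩
  have hr0 : ∀ v, s.r (2, 0) (0, v) ↔ v ∈ L2 ∧ v ≠ 0 := by
    intro v
    rw [← hr2]
    constructor
    · intro h
      have hv : v ≠ 0 := by
        rintro rfl
        exact hzP (by rw [zero' h]; exact zero_mem _)
      have := hzi 0 v h (Or.inr hv)
      rw [zero_add] at this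
      exact ⟨this, hv⟩
    · rintro ⟨h, hv⟩
      exact hzi 2 v h (Or.inr hv)
  have hB : ∀ x : ZMod 4 × V, x ∈ s.cl (2, 0) ∪ {0} ↔
      (x.1 ∈ Z2 ∧ x.2 ∈ L2) ∨ (x.1 ∉ Z2 ∧ x.2 ∈ L1) := by
    rintro ⟨h, v⟩
    rw [Set.mem_union, Set.mem_singleton_iff]
    change s.r (2, 0) (h, v) ∨ _ ↔ (h ∈ Z2 ∧ v ∈ L2) ∨ (h ∉ Z2 ∧ v ∈ L1)
    have e : ∀ h : ZMod 4, (h, v) = (0 : ZMod 4 × V) ↔ h = 0 ∧ v = 0 := fun h => Prod.ext_iff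
    rw [e, mem_Z2]
    rcases zmod4_cases h with rfl | rfl | rfl | rfl
    · rw [hr0]
      by_cases hv : v = 0
      · simp [hv]
      · simp [hv]
    · rw [hr2]
      simp [h20]
    · rw [hr1]
      simp [h10, show (1 : ZMod 4) ≠ 2 by decide]
    · rw [hr3]
      simp [show (3 : ZMod 4) ≠ 2 by decide, show (3 : ZMod 4) ≠ 0 by decide]
  have hBi : s.Inv (s.cl (2, 0) ∪ {0}) := (cl_inv _).union inv_zero
  have hC := hBi.neg.add_subset hBi
  have hzC : ((2, 0) : ZMod 4 × V) ∈ {g | ∀ t ∈ -(s.cl (2, 0) ∪ {0}), g + t ∈ s.cl (2, 0) ∪ {0}} := by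
    rintro ⟨h, v⟩ ht
    rw [Set.mem_neg, hB] at ht
    rw [hB]
    have e1 : -h ∈ Z2 ↔ h ∈ Z2 := neg_mem_iff
    have e2 : 2 + h ∈ Z2 ↔ h ∈ Z2 := by clear ht e1; simp only [mem_Z2]; revert h; decide
    change (-h ∈ Z2 ∧ -v ∈ L2) ∨ (-h ∉ Z2 ∧ -v ∈ L1) at ht
    change (2 + h ∈ Z2 ∧ 0 + v ∈ L2) ∨ (2 + h ∉ Z2 ∧ 0 + v ∈ L1)
    rw [e1, neg_mem_iff, neg_mem_iff] at ht
    rw [e2, zero_add]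
    exact ht
  have hcC := hC _ _ ((hr1 0).2 (zero_mem _)) hzC
  have hle : L2 ≤ L1 := by
    intro v hv
    have h1 : ((0, v) : ZMod 4 × V) ∈ -(s.cl (2, 0) ∪ {0}) := by
      rw [Set.mem_neg, hB]
      exact Or.inl ⟨by simp, neg_mem hv⟩
    have h2 := hcC _ h1
    rw [hB] at h2
    change ((1 : ZMod 4) + 0 ∈ Z2 ∧ 0 + v ∈ L2) ∨ ((1 : ZMod 4) + 0 ∉ Z2 ∧ 0 + v ∈ L1) at h2
    rw [add_zero, zero_add] at h2
    exact h2.elim (fun h => absurd h.1 one_notMem_Z2) fun h => h.2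
  have hL := Plane.line_le hL2 (Plane.line_ne_top hL1) hle
  have hBe : s.Isub ((⊤ : AddSubgroup (ZMod 4)).prod L1) := by
    have : (((⊤ : AddSubgroup (ZMod 4)).prod L1 : AddSubgroup (ZMod 4 × V)) : Set (ZMod 4 × V)) =
        s.cl (2, 0) ∪ {0} := by
      ext x
      rw [hB, hL]
      by_cases h : x.1 ∈ Z2 <;> simp [h, AddSubgroup.mem_prod]
    rw [Isub, this]
    exact hBi
  have := hzn _ hBe ⟨trivial, zero_mem _⟩
  refine Plane.line_ne_top hL1 (eq_top_iff.2 fun v _ => ?_)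
  have h3 : ((0, v) : ZMod 4 × V) ∈ (⊤ : AddSubgroup (ZMod 4)).prod L1 := by rw [this]; trivial
  exact h3.2

include hP in
/-- Schemes without proper closed subsets over either direct factor. -/
theorem primitive (hH : ∀ W, s.Isub W → ((1, 0) : ZMod 4 × V) ∈ W → W = ⊤)
    (hV : ∀ W, s.Isub W → (∀ v : V, (0, v) ∈ W) → W = ⊤) : Concl p s := by
  by_cases hz : s.Inv {((2, 0) : ZMod 4 × V)}
  · exact primitive_single hz hH hV
  by_cases hzn : ∀ W, s.Isub W → ((2, 0) : ZMod 4 × V) ∈ W → W = ⊤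
  · exact primitive_not_z hzn hV
  · push Not at hzn
    obtain ⟨W, hW, h1, h2⟩ := hzn
    exact primitive_z hz hH hV hW h2 h1

end Sch

namespace Sch

variable {p : ℕ} {V : Type*} [AddCommGroup V] [Fintype V] [hP : Plane p V]
variable {s : Sch (ZMod 4 × V)}

theorem top_prod_mem {Q : AddSubgroup V} {x : ZMod 4 × V} :
    x ∈ (⊤ : AddSubgroup (ZMod 4)).prod Q ↔ x.2 ∈ Q := ⟨fun h => h.2, fun h => ⟨trivial, h⟩⟩

theorem prod_top_mem {Q : AddSubgroup (ZMod 4)} {x : ZMod 4 × V} :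
    x ∈ Q.prod (⊤ : AddSubgroup V) ↔ x.1 ∈ Q := ⟨fun h => h.1, fun h => ⟨h, trivial⟩⟩

include hP in
variable (p) in
theorem exists_ne_zero : ∃ v : V, v ≠ 0 := by
  by_contra! h
  have h1 : (⊥ : AddSubgroup V) = ⊤ := eq_top_iff.2 fun v _ => h v
  have h2 := Plane.card_eq (V := V) p
  rw [← AddSubgroup.card_top, ← h1, AddSubgroup.card_bot] at h2
  have := hP.prime.one_lt
  nlinarith

include hP in
variable (p) in
theorem ne_top_of_H {W : AddSubgroup (ZMod 4 × V)} (h : ∀ x ∈ W, x.2 = 0) : W ≠ ⊤ := by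
  obtain ⟨v, hv⟩ := exists_ne_zero (V := V) p
  rintro rfl
  exact hv (h (0, v) trivial)

theorem V_ne_bot (hv : ∃ v : V, v ≠ 0) :
    (⊥ : AddSubgroup (ZMod 4)).prod (⊤ : AddSubgroup V) ≠ ⊥ := by
  obtain ⟨v, hv⟩ := hv
  exact ne_bot_of_mem (x := (0, v)) ⟨rfl, trivial⟩ fun h => hv (congrArg Prod.snd h)

theorem N_ne_top : Z2.prod (⊤ : AddSubgroup V) ≠ ⊤ :=
  ne_top_of_notMem (x := (1, 0)) fun h => one_notMem_Z2 h.1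

theorem N_ne_bot : Z2.prod (⊤ : AddSubgroup V) ≠ ⊥ :=
  ne_bot_of_mem (x := (2, 0)) ⟨Or.inr rfl, trivial⟩ z_ne_zero

include hP in
/-- Schemes with a closed subset of index two, and no proper closed subset over the first
factor. -/
theorem index_two (hN : s.Isub (Z2.prod (⊤ : AddSubgroup V)))
    (hH : ∀ W, s.Isub W → ((1, 0) : ZMod 4 × V) ∈ W → W = ⊤) : Concl p s := by
  apply Concl.of_triv
  have hodd : ∀ x y, s.r x y → x.1 ∉ Z2 → y.1 ∉ Z2 := by
    intro x y h hx hy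
    exact hx (prod_top_mem.1 (hN _ _ (symm' h) (prod_top_mem.2 hy)))
  have hYi := cl_inv (s := s) (1, 0)
  have hsc : ∀ k : ℕ, ¬ p ∣ k → ∀ h v, s.r (1, 0) (h, v) → s.r (1, 0) (h, k • v) := by
    intro k hk h v hr
    have := scal_r p hk hr
    rwa [smul_zero] at this
  have hd : ∀ h : ZMod 4, (h = 1 ∨ h = 3) → p ∣ {v | s.r (1, 0) (h, v)}.ncard := by
    intro h hh
    by_contra hc
    obtain ⟨W, hW, h2, h3⟩ := hYi.pp p hc
    exact ne_top_of_H p h2 (hH W hW (odd_mem p h3 hh))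
  have hline : ∀ R : AddSubgroup V, Nat.card R = p → ¬ ∀ y, s.r (1, 0) y → y.2 ∈ R := by
    intro R hR h
    exact ne_top_of_snd (Plane.line_ne_top hR) (closure_snd h)
      (hH _ hYi.closure (AddSubgroup.subset_closure (rfl' _)))
  have h13 : (1 : ZMod 4) = 1 ∨ (1 : ZMod 4) = 3 := Or.inl rfl
  have h33 : (3 : ZMod 4) = 1 ∨ (3 : ZMod 4) = 3 := Or.inr rfl
  have h112 : (1 : ZMod 4) + 1 = 2 := by decide
  have h332 : (3 : ZMod 4) + 3 = 2 := by decide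
  have hn3 : -(3 : ZMod 4) = 1 := by decide
  have hn1 : -(1 : ZMod 4) = 3 := by decide
  have hR1 := Plane.line_of_scalar (p := p) (T := {v | s.r (1, 0) (1, v)})
    (fun k hk v hv => hsc k hk _ _ hv) (rfl' _) (hd 1 h13)
  by_cases hc : s.r (1, 0) (3, 0)
  · have h31 : ∀ v, s.r (1, 0) (3, v) → s.r (1, 0) (1, -v) := by
      intro v hv
      have h1 := s.neg _ _ hv
      rw [Prod.neg_mk, Prod.neg_mk, neg_zero, hn3, hn1] at h1
      exact trans' hc h1
    have h31' : ∀ v, s.r (1, 0) (1, -v) → s.r (1, 0) (3, v) := by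
      intro v hv
      have h1 := s.neg _ _ hv
      rw [Prod.neg_mk, Prod.neg_mk, neg_zero, neg_neg, hn1] at h1
      exact trans' hc h1
    rcases hR1 with ⟨R, hR, hY⟩ | hY
    · have hY' : ∀ v, s.r (1, 0) (1, v) → v ∈ R := fun v hv => by
        rw [← SetLike.mem_coe, ← hY]; exact hv
      refine absurd ?_ (hline R hR)
      rintro ⟨h, v⟩ hv
      rcases not_Z2 (hodd _ _ hv one_notMem_Z2) with h1 | h1
      · have h1' : h = 1 := h1
        subst h1'
        exact hY' v hv
      · have h1' : h = 3 := h1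
        subst h1'
        exact (neg_mem_iff (H := R)).1 (hY' _ (h31 v hv))
    · have hall : ∀ x : ZMod 4 × V, x.1 ∉ Z2 → s.r (1, 0) x := by
        rintro ⟨h, v⟩ hx
        have hY' : ∀ v, s.r (1, 0) (1, v) := fun v => by
          have : v ∈ {v | s.r (1, 0) (1, v)} := by rw [hY]; trivial
          exact this
        rcases not_Z2 hx with h1 | h1
        · have h1' : h = 1 := h1
          subst h1'
          exact hY' v
        · have h1' : h = 3 := h1
          subst h1'
          exact h31' v (hY' _)
      refine WrTriv.of_sub hN N_ne_bot N_ne_top fun x hx l hl => ?_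
      rw [prod_top_mem] at hx hl
      refine trans' (symm' (hall x hx)) (hall _ fun h => hx ?_)
      simpa using sub_mem h hl
  · have hdis : ∀ v, s.r (1, 0) (3, v) → ¬ s.r (1, 0) (1, -v) := by
      intro v h1 h2
      have h3 := s.neg _ _ h1
      rw [Prod.neg_mk, Prod.neg_mk, neg_zero, hn3, hn1] at h3
      exact hc (trans' h2 (symm' h3))
    have hVi : s.Isub ((⊥ : AddSubgroup (ZMod 4)).prod (⊤ : AddSubgroup V)) →
        (∀ v, s.r (1, 0) (1, v)) → WrTriv s := by
      intro hV hY
      refine ⟨Z2.prod ⊤, (⊥ : AddSubgroup (ZMod 4)).prod ⊤, ?_, hN, hV,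
        V_ne_bot (exists_ne_zero p), N_ne_top, ?_, ?_⟩
      · exact AddSubgroup.prod_mono bot_le le_rfl
      · rintro ⟨h, v⟩ hx ⟨h', l⟩ ⟨h0, -⟩
        have h0' : h' = 0 := h0
        subst h0'
        rw [Prod.mk_add_mk, add_zero]
        rw [prod_top_mem] at hx
        rcases not_Z2 hx with h1 | h1
        · have h1' : h = 1 := h1
          subst h1'
          exact trans' (symm' (hY _)) (hY _)
        · have h1' : h = 3 := h1
          subst h1'
          have := s.neg _ _ (trans' (symm' (hY (-v))) (hY (-(v + l))))
          rwa [Prod.neg_mk, Prod.neg_mk, neg_neg, neg_neg, hn1] at this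
      · rintro x hx y hxy
        have hy := hN _ _ hxy hx
        refine ⟨?_, trivial⟩
        have hx0 : x.1 = 0 ↔ y.1 = 0 := by
          have := hV.mem_iff hxy
          exact ⟨fun h => (this.1 ⟨h, trivial⟩).1, fun h => (this.2 ⟨h, trivial⟩).1⟩
        have h1 := prod_top_mem.1 hx
        have h2 := prod_top_mem.1 hy
        change y.1 - x.1 = 0
        rw [mem_Z2] at h1 h2
        rcases h1 with h1 | h1
        · rw [h1, hx0.1 h1, sub_zero]
        · rcases h2 with h2 | h2
          · rw [h2, hx0.2 h2, sub_zero]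
          · rw [h1, h2, sub_self]
    rcases hR1 with ⟨R, hR, hY⟩ | hY
    · have hY' : ∀ v, s.r (1, 0) (1, v) ↔ v ∈ R := fun v => by
        rw [← SetLike.mem_coe, ← hY]; rfl
      exfalso
      have hle : ∀ v ∈ R, ¬ s.r (1, 0) (3, v) := by
        intro v hv h
        exact hdis v h ((hY' _).2 (neg_mem hv))
      have hcompl : {v | ¬ s.r (1, 0) (3, v)} = {v | s.r (1, 0) (3, v)}ᶜ := rfl
      have hsc3 : ∀ k : ℕ, ¬ p ∣ k → ∀ v ∈ {v | ¬ s.r (1, 0) (3, v)},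
          k • v ∈ {v | ¬ s.r (1, 0) (3, v)} := by
        intro k hk v hv h
        obtain ⟨l, hl, h4⟩ := Plane.exists_smul_inv (V := V) p hk
        refine hv ?_
        rw [← (h4 v).1]
        exact hsc l hl _ _ h
      have hd3 : p ∣ {v | ¬ s.r (1, 0) (3, v)}.ncard := by
        rw [hcompl, Set.ncard_compl, Plane.card_eq p]
        exact Nat.dvd_sub (dvd_pow_self p two_ne_zero) (hd 3 h33)
      rcases Plane.line_of_scalar (p := p) (T := {v | ¬ s.r (1, 0) (3, v)}) hsc3 (hle 0 (zero_mem _))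
        hd3 with ⟨R', hR', h3⟩ | h3
      · have h3' : ∀ v, ¬ s.r (1, 0) (3, v) ↔ v ∈ R' := fun v => by
          rw [← SetLike.mem_coe, ← h3]; rfl
        have hRR : R = R' := Plane.line_le hR (Plane.line_ne_top hR') fun v hv => (h3' v).1 (hle v hv)
        subst hRR
        have hy3 : ∀ v, s.r (1, 0) (3, v) ↔ v ∉ R := fun v => by rw [← h3', not_not]
        have hYz : ∀ y, s.r (1, 0) y → ¬ s.r (1, 0) (y + (2, 0)) := by
          rintro ⟨h, v⟩ hv h2
          rw [Prod.mk_add_mk, add_zero] at h2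
          rcases not_Z2 (hodd _ _ hv one_notMem_Z2) with h1 | h1
          · have h1' : h = 1 := h1
            subst h1'
            exact (hy3 _).1 h2 ((hY' v).1 hv)
          · have h1' : h = 3 := h1
            subst h1'
            rw [show (3 : ZMod 4) + 2 = 1 by decide] at h2
            exact (hy3 _).1 hv ((hY' v).1 h2)
        have hSq := hYi.sq p
        have hSqe : {g | ∃ x ∈ s.cl (1, 0), x + (2, 0) ∉ s.cl (1, 0) ∧ x + x = g} =
            {g : ZMod 4 × V | g.1 = 2} := by
          ext ⟨h, v⟩
          rw [Set.mem_ofPred_eq, Set.mem_ofPred_eq]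
          constructor
          · rintro ⟨x, hx, -, hxx⟩
            have h1 := not_Z2 (hodd _ _ hx one_notMem_Z2)
            rw [← hxx]
            change x.1 + x.1 = 2
            rcases h1 with h1 | h1 <;> rw [h1] <;> decide
          · intro h1
            have h1' : h = 2 := h1
            subst h1'
            obtain ⟨l, -, hl⟩ := Plane.exists_smul_inv (V := V) p (Plane.not_dvd_two p V)
            have hv2 : l • v + l • v = v := by rw [← two_smul ℕ]; exact (hl v).2
            by_cases hv : l • v ∈ R
            · have := (hY' _).2 hv
              exact ⟨_, this, hYz _ this, Prod.ext h112 hv2⟩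
            · have := (hy3 _).2 hv
              exact ⟨_, this, hYz _ this, Prod.ext h332 hv2⟩
        rw [hSqe] at hSq
        have hV : s.Isub ((⊥ : AddSubgroup (ZMod 4)).prod (⊤ : AddSubgroup V)) := by
          have : (((⊥ : AddSubgroup (ZMod 4)).prod (⊤ : AddSubgroup V) : AddSubgroup (ZMod 4 × V)) :
              Set (ZMod 4 × V)) = {g : ZMod 4 × V | g.1 = 2} - {g : ZMod 4 × V | g.1 = 2} := by
            ext ⟨h, v⟩
            rw [Set.mem_sub]
            constructor
            · rintro ⟨h1, -⟩
              have h1' : h = 0 := h1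
              subst h1'
              exact ⟨(2, v), rfl, (2, 0), rfl, by simp⟩
            · rintro ⟨a, ha, b, hb, hab⟩
              refine ⟨?_, trivial⟩
              have h1 : a.1 - b.1 = h := congrArg Prod.fst hab
              have ha' : a.1 = 2 := ha
              have hb' : b.1 = 2 := hb
              rw [ha', hb', sub_self] at h1
              exact h1.symm
          rw [Isub, this]
          exact hSq.sub hSq
        obtain ⟨w, hw⟩ := Plane.exists_notMem hR
        have hm := hYi.mult hV ((hy3 w).2 hw)
        have e : ∀ (h : ZMod 4) (v : V), {t | t ∈ s.cl (1, 0) ∧ t - (h, v) ∈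
            (⊥ : AddSubgroup (ZMod 4)).prod (⊤ : AddSubgroup V)}.ncard =
            {u | s.r (1, 0) (h, u)}.ncard := by
          intro h v
          rw [← Set.ncard_image_of_injective (f := fun u : V => ((h, u) : ZMod 4 × V))
            {u | s.r (1, 0) (h, u)} (fun a b hab => by simpa using hab)]
          congr 1
          ext ⟨h', u⟩
          simp only [Set.mem_image, Set.mem_ofPred_eq, zero_prod_mem]
          constructor
          · rintro ⟨h1, h2, -⟩
            have h2' : h' = h := sub_eq_zero.1 (h2 : h' - h = 0)
            subst h2'
            exact ⟨u, h1, rfl⟩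
          · rintro ⟨u', h1, h3⟩
            obtain ⟨rfl, rfl⟩ := Prod.mk.inj h3
            exact ⟨h1, by simp, trivial⟩
        rw [e, e, hY] at hm
        have h4 : {u | s.r (1, 0) (3, u)} = (R : Set V)ᶜ := by
          ext v
          exact hy3 v
        rw [h4, Set.ncard_compl, Plane.card_eq p] at hm
        have h5 : (R : Set V).ncard = p := hR
        rw [h5] at hm
        have := Plane.three_le p V
        have h6 : 3 * p ≤ p ^ 2 := by nlinarith
        omega
      · refine hline R hR ?_
        rintro ⟨h, v⟩ hv
        rcases not_Z2 (hodd _ _ hv one_notMem_Z2) with h1 | h1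
        · have h1' : h = 1 := h1
          subst h1'
          exact (hY' v).1 hv
        · have h1' : h = 3 := h1
          subst h1'
          have : v ∈ {v | ¬ s.r (1, 0) (3, v)} := by rw [h3]; trivial
          exact absurd hv this
    · have hY' : ∀ v, s.r (1, 0) (1, v) := fun v => by
        have : v ∈ {v | s.r (1, 0) (1, v)} := by rw [hY]; trivial
        exact this
      have h1 : ∀ y : ZMod 4 × V, y ∈ s.cl (1, 0) ↔ y.1 = 1 := by
        rintro ⟨h, v⟩
        constructor
        · intro hv
          rcases not_Z2 (hodd _ _ hv one_notMem_Z2) with h1 | h1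
          · exact h1
          · have h1' : h = 3 := h1
            subst h1'
            exact absurd (hY' _) (hdis v hv)
        · intro h1
          have h1' : h = 1 := h1
          subst h1'
          exact hY' v
      refine hVi ?_ hY'
      have : (((⊥ : AddSubgroup (ZMod 4)).prod (⊤ : AddSubgroup V) : AddSubgroup (ZMod 4 × V)) :
          Set (ZMod 4 × V)) = s.cl (1, 0) - s.cl (1, 0) := by
        ext ⟨h, v⟩
        rw [Set.mem_sub]
        constructor
        · rintro ⟨h1, -⟩
          have h1' : h = 0 := h1
          subst h1'
          exact ⟨(1, v), hY' v, (1, 0), rfl' _, by simp⟩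
        · rintro ⟨a, ha, b, hb, hab⟩
          refine ⟨?_, trivial⟩
          have h2 : a.1 - b.1 = h := congrArg Prod.fst hab
          rw [(h1 a).1 ha, (h1 b).1 hb, sub_self] at h2
          exact h2.symm
      rw [Isub, this]
      exact hYi.sub hYi

end Sch

namespace Sch

variable {p : ℕ} {V : Type*} [AddCommGroup V] [Fintype V] [hP : Plane p V]
variable {s : Sch (ZMod 4 × V)} {Q : AddSubgroup V}

theorem comp_full (hQ : Nat.card Q = p) (hUx : ∀ x y, s.r x y → y.2 - x.2 ∈ Q) {x : ZMod 4 × V}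
    {h : ZMod 4} (hd : p ∣ {v | s.r x (h, v)}.ncard) {v : V} (hv : s.r x (h, v)) {q : V}
    (hq : q ∈ Q) : s.r x (h, v + q) := by
  have h1 : {v | s.r x (h, v)} ⊆ {v | v - x.2 ∈ Q} := fun v hv => hUx _ _ hv
  have h2 : {v | s.r x (h, v)}.ncard ≠ 0 := by
    exact Set.ncard_ne_zero_of_mem (a := v) hv
  have h3 := Nat.le_of_dvd (Nat.pos_of_ne_zero h2) hd
  have h4 := Set.eq_of_subset_of_ncard_le h1 (by rw [Plane.card_coset hQ]; exact h3)
  have h5 : v + q ∈ {v | v - x.2 ∈ Q} := by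
    have := add_mem (hUx _ _ hv) hq
    rwa [sub_add_eq_add_sub] at this
  rw [← h4] at h5
  exact h5

theorem inv_of_mem_closure_single {y : ZMod 4 × V} (hy : s.Inv {y}) :
    ∀ a ∈ AddSubgroup.closure {y}, s.Inv {a} := by
  intro a ha
  induction ha using AddSubgroup.closure_induction with
  | mem x hx => rw [Set.mem_singleton_iff] at hx; rwa [hx]
  | zero => exact inv_zero
  | add a b _ _ ha hb =>
    have := ha.add hb
    rwa [Set.singleton_add_singleton] at this
  | neg a _ ha =>
    have := ha.neg
    rwa [Set.neg_singleton] at this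

theorem tens_of_single (hQ : Nat.card Q = p) (hU : s.Isub ((⊤ : AddSubgroup (ZMod 4)).prod Q))
    {w : V} (hw : w ∉ Q) (hy : s.Inv {((0, w) : ZMod 4 × V)}) : Tens s := by
  have hA : ∀ a ∈ AddSubgroup.closure {((0, w) : ZMod 4 × V)},
      a ∈ (⊥ : AddSubgroup (ZMod 4)).prod (AddSubgroup.zmultiples w) := by
    refine closure_le' ?_
    rintro x rfl
    exact ⟨rfl, AddSubgroup.mem_zmultiples w⟩
  have hm : ((0, w) : ZMod 4 × V) ∈ AddSubgroup.closure {((0, w) : ZMod 4 × V)} :=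
    AddSubgroup.subset_closure rfl
  have h0 : ∀ v ∈ AddSubgroup.zmultiples w, v ∈ Q → v = 0 := by
    intro v hv hvQ
    obtain ⟨k, hk, rfl⟩ := (Plane.mem_zmultiples_iff p).1 hv
    have := Plane.coset_inj (p := p) hw hk hP.prime.pos (by simpa using hvQ)
    rw [this, zero_smul]
  refine ⟨AddSubgroup.closure {(0, w)}, (⊤ : AddSubgroup (ZMod 4)).prod Q, ?_, ?_, hy.closure, hU,
    ?_, ?_, ?_⟩
  · refine ne_bot_of_mem hm fun h => hw ?_
    rw [show w = 0 from congrArg Prod.snd h]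
    exact zero_mem _
  · exact ne_bot_of_mem (x := (2, 0)) ⟨trivial, zero_mem _⟩ z_ne_zero
  · refine le_bot_iff.1 ?_
    rintro x ⟨hx, hx'⟩
    exact Prod.ext (hA x hx).1 (h0 _ (hA x hx).2 hx'.2)
  · set W := AddSubgroup.closure {((0, w) : ZMod 4 × V)} ⊔ (⊤ : AddSubgroup (ZMod 4)).prod Q with hW
    have hQW : Q ≤ vp W := fun q hq =>
      (le_sup_right : _ ≤ W) (show (0, q) ∈ (⊤ : AddSubgroup (ZMod 4)).prod Q from ⟨trivial, hq⟩)
    have hwW : w ∈ vp W := (le_sup_left : _ ≤ W) hm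
    have hT : vp W = ⊤ := by
      by_contra hc
      exact hw (Plane.line_le hQ hc hQW ▸ hwW)
    refine eq_top_of ((le_sup_right : _ ≤ W) ⟨trivial, zero_mem _⟩) fun v => ?_
    have : v ∈ vp W := by rw [hT]; trivial
    exact this
  · intro a ha a' ha' b hb b' hb' h1 h2
    have h3 := inv_of_mem_closure_single hy a ha
    have h4 : a' = a := h3 _ _ h1 rfl
    rw [h4]
    exact single_add h3 h2

/-- Closed subsets containing a fixed line. -/
theorem sub_of_line (hU : s.Isub ((⊤ : AddSubgroup (ZMod 4)).prod Q))
    (hnQ : ¬ s.Isub ((⊥ : AddSubgroup (ZMod 4)).prod Q)) {W : AddSubgroup (ZMod 4 × V)}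
    (hW : s.Isub W) (h : ∀ q ∈ Q, ((0, q) : ZMod 4 × V) ∈ W) (p : ℕ) [hP : Plane p V] :
    ((2, 0) : ZMod 4 × V) ∈ W ∧ (s.Isub (Z2.prod Q) ∨ ((1, 0) : ZMod 4 × V) ∈ W) := by
  have hW' : s.Isub (W ⊓ (⊤ : AddSubgroup (ZMod 4)).prod Q) := inv_inf hW hU
  set W' := W ⊓ (⊤ : AddSubgroup (ZMod 4)).prod Q with hWd
  have hQ' : ∀ x ∈ W', x.2 ∈ Q := fun x hx => hx.2.2
  have h' : ∀ q ∈ Q, ((0, q) : ZMod 4 × V) ∈ W' := fun q hq => ⟨h q hq, trivial, hq⟩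
  have hz : ((2, 0) : ZMod 4 × V) ∈ W' := by
    by_contra hc
    have h1 := fst_zero_of_z p hc
    refine hnQ ?_
    have : (⊥ : AddSubgroup (ZMod 4)).prod Q = W' := by
      ext x
      rw [zero_prod_mem]
      refine ⟨fun hx => ?_, fun hx => ⟨h1 x hx, hQ' x hx⟩⟩
      have := h' _ hx.2
      rwa [← hx.1] at this
    rw [this]
    exact hW'
  refine ⟨hz.1, ?_⟩
  by_cases h1 : ((1, 0) : ZMod 4 × V) ∈ W
  · exact Or.inr h1
  · refine Or.inl ?_
    have : Z2.prod Q = W' := by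
      ext ⟨a, v⟩
      constructor
      · rintro ⟨h2, h3⟩
        rcases h2 with h2 | h2
        · have h2' : a = 0 := h2
          subst h2'
          exact h' v h3
        · have h2' : a = 2 := h2
          subst h2'
          exact (mem_sub p).2 ⟨hz, h' v h3⟩
      · intro hx
        refine ⟨?_, hQ' _ hx⟩
        by_contra hc
        exact h1 (odd_mem p hx (not_Z2 hc)).1
    rw [this]
    exact hW'

theorem WrTriv.of_line_inv (hQ : Nat.card Q = p) (hU : s.Isub ((⊤ : AddSubgroup (ZMod 4)).prod Q))
    (hnQ : ¬ s.Isub ((⊥ : AddSubgroup (ZMod 4)).prod Q))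
    (h : ∀ x : ZMod 4 × V, x.2 ∉ Q → ∀ q ∈ Q, s.r x (x + (0, q))) : WrTriv s := by
  obtain ⟨w, hw⟩ := Plane.exists_notMem hQ
  have hUt : (⊤ : AddSubgroup (ZMod 4)).prod Q ≠ ⊤ := ne_top_of_notMem (x := (0, w)) fun h => hw h.2
  have hst : ∀ x : ZMod 4 × V, x.2 ∉ Q → ∀ q ∈ Q, ((0, q) : ZMod 4 × V) ∈ stab (s.cl x) := by
    intro x hx q hq y hy
    have hyQ : y.2 ∉ Q := fun hc => hx (hU _ _ (symm' hy) ⟨trivial, hc⟩).2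
    rw [add_comm]
    exact trans' hy (h y hyQ q hq)
  by_cases hC : s.Isub (Z2.prod Q)
  · refine ⟨_, Z2.prod Q, AddSubgroup.prod_mono le_top le_rfl, hU, hC,
      ne_bot_of_mem (x := (2, 0)) ⟨Or.inr rfl, zero_mem _⟩ z_ne_zero, hUt, ?_, ?_⟩
    · intro x hx l hl
      rw [top_prod_mem] at hx
      have h1 := hst x hx
      have h2 := (sub_of_line hU hnQ (cl_inv x).stab h1 p).1
      have h3 : l ∈ stab (s.cl x) := by
        obtain ⟨a, q⟩ := l
        obtain ⟨h3, h4⟩ := hl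
        rcases h3 with h3 | h3
        · have h3' : a = 0 := h3
          subst h3'
          exact h1 _ h4
        · have h3' : a = 2 := h3
          subst h3'
          exact (mem_sub p).2 ⟨h2, h1 _ h4⟩
      rw [add_comm]
      exact h3 x (rfl' x)
    · intro x hx y hxy
      have hy := hU _ _ hxy hx
      refine ⟨?_, Q.sub_mem hy.2 hx.2⟩
      have h1 := hC.mem_iff hxy
      have h2 : x.1 ∈ Z2 ↔ y.1 ∈ Z2 :=
        ⟨fun h => (h1.1 ⟨h, hx.2⟩).1, fun h => (h1.2 ⟨h, hy.2⟩).1⟩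
      change y.1 - x.1 ∈ Z2
      clear h1 hxy
      rw [mem_Z2, mem_Z2] at h2
      rw [mem_Z2]
      generalize x.1 = a at *
      generalize y.1 = b at *
      clear hx hy
      revert a b; decide
  · refine WrTriv.of_sub hU (ne_bot_of_mem (x := (2, 0)) ⟨trivial, zero_mem _⟩ z_ne_zero) hUt ?_
    intro x hx l hl
    rw [top_prod_mem] at hx hl
    have h1 := hst x hx
    have h2 := (sub_of_line hU hnQ (cl_inv x).stab h1 p).2.resolve_left hC
    rw [add_comm]
    have h3 : l ∈ stab (s.cl x) := (mem_sub p).2 ⟨H_mem h2 _, h1 _ hl⟩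
    exact h3 x (rfl' x)

theorem V_sub_of_coset (hQ : Nat.card Q = p) {w : V} (hw : w ∉ Q)
    (hC : s.Inv {g : ZMod 4 × V | g.1 = 0 ∧ g.2 - w ∈ Q}) :
    s.Isub ((⊥ : AddSubgroup (ZMod 4)).prod (⊤ : AddSubgroup V)) := by
  have h1 := hC.closure
  set W := AddSubgroup.closure {g : ZMod 4 × V | g.1 = 0 ∧ g.2 - w ∈ Q} with hW
  have h2 : ∀ x ∈ W, x ∈ (⊥ : AddSubgroup (ZMod 4)).prod (⊤ : AddSubgroup V) :=
    closure_le' fun x hx => ⟨hx.1, trivial⟩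
  have hwW : w ∈ vp W := AddSubgroup.subset_closure ⟨rfl, by simp⟩
  have hQW : Q ≤ vp W := by
    intro q hq
    have h3 : w + q ∈ vp W := AddSubgroup.subset_closure ⟨rfl, by simpa using hq⟩
    simpa using sub_mem h3 hwW
  have hT : vp W = ⊤ := by
    by_contra hc
    exact hw (Plane.line_le hQ hc hQW ▸ hwW)
  have : (⊥ : AddSubgroup (ZMod 4)).prod (⊤ : AddSubgroup V) = W := by
    ext ⟨h, v⟩
    refine ⟨?_, h2 _⟩
    rintro ⟨h3, -⟩
    have h3' : h = 0 := h3
    subst h3'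
    have : v ∈ vp W := by rw [hT]; trivial
    exact this
  rw [this]
  exact h1

include hP in
theorem case_c (hQ : Nat.card Q = p) (hU : s.Isub ((⊤ : AddSubgroup (ZMod 4)).prod Q))
    (hUx : ∀ x y, s.r x y → y.2 - x.2 ∈ Q)
    (hno : ∀ W, s.Isub W → (∀ x ∈ W, x.2 = 0) → W = ⊥) : Concl p s := by
  have hd : ∀ x, ∀ h : ZMod 4, h ≠ 0 → p ∣ {v | s.r x (h, v)}.ncard := by
    intro x h h0
    by_contra hc
    obtain ⟨W, hW, h2, h3⟩ := (cl_inv (s := s) x).pp p hc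
    rw [hno W hW h2] at h3
    exact h0 (congrArg Prod.fst (h3 : (h, (0 : V)) = 0))
  have hfull : ∀ {x : ZMod 4 × V} {h : ZMod 4} {v q : V}, h ≠ 0 → s.r x (h, v) → q ∈ Q →
      s.r x (h, v + q) := fun h0 hv hq => comp_full hQ hUx (hd _ _ h0) hv hq
  have hfull' : ∀ {x : ZMod 4 × V} {h : ZMod 4} {v u : V}, h ≠ 0 → s.r x (h, v) → u - v ∈ Q →
      s.r x (h, u) := fun h0 hv hq => by
    have := hfull h0 hv hq
    rwa [add_sub_cancel] at this
  have hfst : ∀ x : ZMod 4 × V, (∃ q ∈ Q, ¬ s.r x (x + (0, q))) → x.1 = 0 := by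
    rintro ⟨h, v⟩ ⟨q, hq, hn⟩
    by_contra hc
    refine hn ?_
    rw [Prod.mk_add_mk, add_zero]
    exact hfull hc (rfl' _) hq
  by_cases hQs : s.Isub ((⊥ : AddSubgroup (ZMod 4)).prod Q)
  · have hQb : (⊥ : AddSubgroup (ZMod 4)).prod Q ≠ ⊥ := by
      intro h
      refine Plane.line_ne_bot hQ (le_bot_iff.1 fun q hq => ?_)
      have h5 : ((0, q) : ZMod 4 × V) ∈ (⊥ : AddSubgroup (ZMod 4)).prod Q := ⟨rfl, hq⟩
      rw [h] at h5
      exact congrArg Prod.snd (h5 : ((0, q) : ZMod 4 × V) = 0)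
    have hl : ∀ l ∈ (⊥ : AddSubgroup (ZMod 4)).prod Q, ∃ q ∈ Q, l = (0, q) :=
      fun l hl => ⟨l.2, hl.2, Prod.ext hl.1 rfl⟩
    have ht : ∀ Q : AddSubgroup V, (⊥ : AddSubgroup (ZMod 4)).prod Q ≠ ⊤ := fun Q =>
      ne_top_of_notMem (x := (1, 0)) fun h => by
        have h1 : (1 : ZMod 4) = 0 := h.1
        revert h1; decide
    by_cases hall : ∀ x ∉ (⊥ : AddSubgroup (ZMod 4)).prod Q, ∀ q ∈ Q, s.r x (x + (0, q))
    · refine Concl.of_triv (WrTriv.of_sub hQs hQb (ht _) fun x hx l hl' => ?_)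
      obtain ⟨q, hq, rfl⟩ := hl l hl'
      exact hall x hx q hq
    push Not at hall
    obtain ⟨⟨h, w⟩, hx, q, hq, hn⟩ := hall
    have h0 : h = 0 := hfst _ ⟨q, hq, hn⟩
    subst h0
    have hw : w ∉ Q := fun h => hx ⟨rfl, h⟩
    have hni : ∀ v, v - w ∈ Q → ¬ ∀ q ∈ Q, s.r (0, v) (0, v + q) := by
      intro v hv hc
      have h1 := hc (w - v) (by rw [← neg_sub]; exact neg_mem hv)
      have h2 := hc (w - v + q) (add_mem (by rw [← neg_sub]; exact neg_mem hv) hq)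
      rw [add_sub_cancel] at h1
      rw [← add_assoc, add_sub_cancel] at h2
      refine hn ?_
      rw [Prod.mk_add_mk, add_zero]
      exact trans' (symm' h1) h2
    have hC : s.Inv {g : ZMod 4 × V | g.1 = 0 ∧ g.2 - w ∈ Q} := by
      rintro ⟨h, v⟩ ⟨h', v'⟩ hr ⟨h0, hv⟩
      have h0' : h = 0 := h0
      subst h0'
      refine ⟨?_, by simpa using add_mem (hUx _ _ hr) hv⟩
      by_contra hc
      have hc' : h' ≠ 0 := hc
      have hm := (cl_inv (s := s) (0, v)).mult hQs hr
      refine hni v hv fun q hq => ?_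
      have e : ∀ (h : ZMod 4) (u : V), {t | t ∈ s.cl (0, v) ∧
          t - (h, u) ∈ (⊥ : AddSubgroup (ZMod 4)).prod Q} ⊆ (fun v => (h, v)) '' {v | v - u ∈ Q} := by
        rintro h u ⟨a, b⟩ ⟨-, h2, h3⟩
        have h2' : a = h := sub_eq_zero.1 (h2 : a - h = 0)
        subst h2'
        exact ⟨b, h3, rfl⟩
      have e2 : (fun v => (h', v)) '' {u | u - v' ∈ Q} ⊆ {t | t ∈ s.cl (0, v) ∧
          t - (h', v') ∈ (⊥ : AddSubgroup (ZMod 4)).prod Q} := by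
        rintro _ ⟨u, hu, rfl⟩
        exact ⟨hfull' hc' hr hu, sub_self h', hu⟩
      have hi : ∀ h : ZMod 4, Function.Injective (fun v : V => (h, v)) :=
        fun h a b hab => by simpa using hab
      have h3 := Set.ncard_le_ncard e2
      rw [Set.ncard_image_of_injective _ (hi _), Plane.card_coset hQ, ← hm] at h3
      have h4 := Set.eq_of_subset_of_ncard_le (e 0 v)
        (by rwa [Set.ncard_image_of_injective _ (hi _), Plane.card_coset hQ])
      have h5 : ((0, v + q) : ZMod 4 × V) ∈ (fun u => ((0 : ZMod 4), u)) '' {u | u - v ∈ Q} :=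
        ⟨v + q, by simpa using hq, rfl⟩
      rw [← h4] at h5
      exact h5.1
    have hVs := V_sub_of_coset hQ hw hC
    refine Concl.of_triv ⟨_, (⊥ : AddSubgroup (ZMod 4)).prod Q, AddSubgroup.prod_mono le_rfl le_top,
      hVs, hQs, hQb, ht _, fun x hx l hl' => ?_, fun x hx y hxy => ?_⟩
    · obtain ⟨q, hq, rfl⟩ := hl l hl'
      by_contra hc
      exact hx ⟨hfst x ⟨q, hq, hc⟩, trivial⟩
    · refine ⟨?_, hUx _ _ hxy⟩
      have h1 := (hVs _ _ hxy hx).1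
      have h2 : x.1 = 0 := hx.1
      have h3 : y.1 = 0 := h1
      change y.1 - x.1 = 0
      rw [h2, h3, sub_zero]
  by_cases hall : ∀ x : ZMod 4 × V, x.2 ∉ Q → ∀ q ∈ Q, s.r x (x + (0, q))
  · exact Concl.of_triv (WrTriv.of_line_inv hQ hU hQs hall)
  push Not at hall
  obtain ⟨w, hw, q1, hq1, hn1, hX2⟩ : ∃ w, w ∉ Q ∧ ∃ q ∈ Q, ¬ s.r (0, w) (0, w + q) ∧
      ∀ v, ¬ s.r (0, w) (2, v) := by
    obtain ⟨⟨h, w⟩, hw, q, hq, hn⟩ := hall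
    have h0 : h = 0 := hfst _ ⟨q, hq, hn⟩
    subst h0
    rw [Prod.mk_add_mk, add_zero] at hn
    have hw' : w ∉ Q := hw
    by_cases h2 : ∀ v, ¬ s.r (0, w) (2, v)
    · exact ⟨w, hw, q, hq, hn, h2⟩
    · push Not at h2
      obtain ⟨v, hv⟩ := h2
      refine ⟨w + q, fun h => hw' ((add_mem_cancel_right hq).1 h), -q, neg_mem hq, ?_,
        fun u hu => ?_⟩
      · rw [add_neg_cancel_right]
        exact fun h => hn (symm' h)
      · refine hn (trans' (hfull' (u := u) (by decide) hv ?_) (symm' hu))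
        have e1 : v - w ∈ Q := hUx _ _ hv
        have e2 : u - (w + q) ∈ Q := hUx _ _ hu
        have := add_mem (sub_mem e2 e1) hq
        convert this using 1
        abel
  set X := s.cl (0, w) with hX
  have hXi : s.Inv X := cl_inv _
  have hhit : ∀ q ∈ Q, q ≠ 0 → ∃ h : ZMod 4, h ≠ 0 ∧ ∀ q' ∈ Q, s.r (0, q) (h, q') := by
    intro q hq hq0
    by_contra! hc
    have hc' : ∀ h v, s.r (0, q) (h, v) → h = 0 := by
      intro h v hr
      by_contra h0
      obtain ⟨q', hq', hn⟩ := hc h h0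
      have e1 : v - q ∈ Q := hUx _ _ hr
      refine hn (hfull' h0 hr ?_)
      have := sub_mem hq' (add_mem e1 hq)
      rwa [sub_add_cancel] at this
    refine hQs ?_
    rintro ⟨a, u⟩ ⟨b, v⟩ hr ⟨h0, hu⟩
    have h0' : a = 0 := h0
    subst h0'
    have hu' : u ∈ Q := hu
    refine ⟨?_, (hU _ _ hr ⟨trivial, hu⟩).2⟩
    by_cases hu0 : u = 0
    · subst hu0
      exact congrArg Prod.fst (s.zero _ hr)
    · rw [← Plane.zmultiples_eq_line hQ hq hq0, Plane.mem_zmultiples_iff p] at hu'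
      obtain ⟨k, hk, rfl⟩ := hu'
      have hkd : ¬ p ∣ k := by
        intro hd
        rw [Nat.eq_zero_of_dvd_of_lt hd hk, zero_smul] at hu0
        exact hu0 rfl
      obtain ⟨l, hl, h4⟩ := Plane.exists_smul_inv (V := V) p hkd
      have := scal_r p hl hr
      rw [(h4 q).1] at this
      exact hc' _ _ this
  by_cases hodd : ∀ y, s.r (0, w) y → y.1 = 0
  · refine Or.inr (Or.inl (tens_of_single hQ hU hw ?_))
    have : ({((0, w) : ZMod 4 × V)} : Set _) = X := by
      refine Set.Subset.antisymm (by rintro x rfl; exact rfl' _) ?_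
      intro y hy
      by_contra hc
      have hq : y.2 - w ∈ Q := hUx _ _ hy
      have hq0 : y.2 - w ≠ 0 := fun h => hc (Prod.ext (hodd y hy) (sub_eq_zero.1 h))
      obtain ⟨h, h0, hr⟩ := hhit _ hq hq0
      have h1 : ((0, y.2 - w) : ZMod 4 × V) ∈ X - X :=
        ⟨y, hy, (0, w), rfl' _, Prod.ext (by simpa using hodd y hy) rfl⟩
      obtain ⟨a, ha, b, hb, hab⟩ := (hXi.sub hXi) _ _ (hr 0 (zero_mem _)) h1
      have h2 : a.1 - b.1 = h := congrArg Prod.fst hab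
      rw [hodd a ha, hodd b hb, sub_zero] at h2
      exact h0 h2.symm
    rw [this]
    exact hXi
  exfalso
  push Not at hodd
  obtain ⟨⟨e0, v0⟩, hv0, he0⟩ := hodd
  have he0' : e0 ≠ 0 := he0
  have hXfst : ∀ y ∈ X, y.1 ≠ 2 := by
    rintro ⟨a, v⟩ hy h2
    have h2' : a = 2 := h2
    subst h2'
    exact hX2 v hy
  have hlt : ∀ e : ZMod 4, (e = 1 ∨ e = 3) → ∀ q ∈ Q,
      {t | t ∈ X ∧ t + (e, 0) ∈ X}.ncard < {t | t ∈ X ∧ t + (0, q) ∈ X}.ncard := by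
    intro e he q hq
    classical
    have hef : ∀ t ∈ X, t + (e, 0) ∈ X → t.1 = 0 ∨ t.1 ≠ 0 ∧ t.1 + e = 0 := by
      rintro ⟨a, v⟩ h1 h2
      have h3 := hXfst _ h1
      have h4 := hXfst _ h2
      change a ≠ 2 at h3
      change a + e ≠ 2 at h4
      change a = 0 ∨ a ≠ 0 ∧ a + e = 0
      clear h1 h2
      revert a e
      decide
    have he1 : ∀ a : ZMod 4, a + e = 0 → a ≠ e ∧ a ≠ 0 := by
      clear hef
      revert e; decide
    have hen : e ≠ 0 := by
      rcases he with rfl | rfl <;> decide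
    set f : ZMod 4 × V → ZMod 4 × V := fun t => if t.1 = 0 then t + (e, 0) else t with hf
    have hinj : Set.InjOn f {t | t ∈ X ∧ t + (e, 0) ∈ X} := by
      rintro t ⟨h1, h2⟩ t' ⟨h1', h2'⟩ hff
      simp only [hf] at hff
      split_ifs at hff with h3 h4 h4
      · exact add_right_cancel hff
      · exfalso
        have h5 := (hef t' h1' h2').resolve_left h4
        have h6 : t.1 + e = t'.1 := congrArg Prod.fst hff
        rw [h3, zero_add] at h6
        exact (he1 _ h5.2).1 h6.symm
      · exfalso
        have h5 := (hef t h1 h2).resolve_left h3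
        have h6 : t.1 = t'.1 + e := congrArg Prod.fst hff
        rw [h4, zero_add] at h6
        exact (he1 _ h5.2).1 h6
      · exact hff
    have hfX : ∀ t ∈ {t | t ∈ X ∧ t + (e, 0) ∈ X}, f t ∈ X ∧ (f t).1 ≠ 0 ∧ s.r (0, w) (0, (f t).2) := by
      rintro ⟨a, v⟩ ⟨h1, h2⟩
      simp only [hf]
      split_ifs with h3
      · have h3' : a = 0 := h3
        subst h3'
        refine ⟨h2, ?_, ?_⟩
        · simpa using hen
        · have h1' : s.r (0, w) (0, v) := h1
          simpa using h1'
      · have h4 := ((hef _ h1 h2).resolve_left h3).2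
        have h4' : a + e = 0 := h4
        refine ⟨h1, h3, ?_⟩
        rw [Prod.mk_add_mk, h4', add_zero] at h2
        exact h2
    rw [← hinj.ncard_image]
    refine Set.ncard_lt_ncard ?_
    rw [Set.ssubset_iff_of_subset]
    · have h5 : s.r (0, w) (e0, w + q1) := by
        refine hfull' he0' hv0 ?_
        have := sub_mem hq1 (hUx _ _ hv0)
        convert this using 1
        abel
      refine ⟨(e0, w + q1), ⟨h5, ?_⟩, ?_⟩
      · rw [Prod.mk_add_mk, add_zero]
        exact hfull he0' h5 hq
      · rintro ⟨t, ht, hft⟩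
        have h6 := (hfX t ht).2.2
        rw [hft] at h6
        exact hn1 h6
    · rintro _ ⟨t, ht, rfl⟩
      obtain ⟨h1, h2, -⟩ := hfX t ht
      refine ⟨h1, ?_⟩
      generalize f t = t' at *
      obtain ⟨a, v⟩ := t'
      rw [Prod.mk_add_mk, add_zero]
      exact hfull h2 h1 hq
  have hq2 : ∀ q ∈ Q, ∀ e v, (e = 1 ∨ e = 3) → ¬ s.r (0, q) (e, v) := by
    intro q hq e v he hr
    have hen : e ≠ 0 := by
      rcases he with rfl | rfl <;> decide
    have hv : v ∈ Q := (hU _ _ hr ⟨trivial, hq⟩).2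
    have h1 := hfull' (u := 0) hen hr (by simpa using hv)
    exact (hlt e he q hq).ne (hXi.cnt_sub hXi h1).symm
  have hC : s.Isub (Z2.prod Q) := by
    have key : ∀ q ∈ Q, ∀ y, s.r (0, q) y → y ∈ Z2.prod Q := by
      rintro q hq ⟨e, v⟩ hr
      refine ⟨?_, (hU _ _ hr ⟨trivial, hq⟩).2⟩
      by_contra hc
      exact hq2 q hq e v (not_Z2 hc) hr
    rintro ⟨a, u⟩ y hr ⟨ha, hu⟩
    rcases ha with ha | ha
    · have ha' : a = 0 := ha
      subst ha'
      exact key u hu y hr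
    · have ha' : a = 2 := ha
      subst ha'
      obtain ⟨q2, hq2', hq20⟩ : ∃ q ∈ Q, q ≠ 0 := by
        by_contra! hc
        exact Plane.line_ne_bot hQ (le_bot_iff.1 hc)
      obtain ⟨h, h0, h3⟩ := hhit q2 hq2' hq20
      have h4 : h = 2 := by
        have h5 : ¬ (h = 1 ∨ h = 3) := fun h5 => hq2 q2 hq2' h 0 h5 (h3 0 (zero_mem _))
        rcases zmod4_cases h with h6 | h6 | h6
        · exact absurd h6 h0
        · exact h6
        · exact absurd h6 h5
      subst h4
      exact key q2 hq2' y (trans' (h3 u hu) hr)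
  have hm := hXi.mult hC hv0
  have he2 : e0 ≠ 2 := hXfst _ hv0
  have h1 : {t | t ∈ X ∧ t - (0, w) ∈ Z2.prod Q}.ncard < p := by
    have hi : Function.Injective (fun v : V => ((0 : ZMod 4), v)) := fun a b hab => by simpa using hab
    rw [← Plane.card_coset hQ w, ← Set.ncard_image_of_injective _ hi]
    refine Set.ncard_lt_ncard ?_
    rw [Set.ssubset_iff_of_subset]
    · refine ⟨(0, w + q1), ⟨w + q1, by simpa using hq1, rfl⟩, fun h => hn1 h.1⟩
    · rintro ⟨a, v⟩ ⟨h2, h3, h4⟩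
      have h5 : a - 0 ∈ Z2 := h3
      rw [sub_zero, mem_Z2] at h5
      have h6 := h5.resolve_right (hXfst _ h2)
      subst h6
      exact ⟨v, h4, rfl⟩
  have h2 : p ≤ {t | t ∈ X ∧ t - (e0, v0) ∈ Z2.prod Q}.ncard := by
    have hi : Function.Injective (fun v : V => (e0, v)) := fun a b hab => by simpa using hab
    rw [← Plane.card_coset hQ v0, ← Set.ncard_image_of_injective _ hi]
    refine Set.ncard_le_ncard ?_
    rintro _ ⟨u, hu, rfl⟩
    refine ⟨hfull' he0' hv0 hu, ?_, hu⟩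
    rw [Prod.mk_sub_mk, sub_self]
    exact zero_mem _
  rw [hm] at h1
  omega

end Sch

namespace Sch
open Plane

variable {p : ℕ} {V : Type*} [AddCommGroup V] [Fintype V] [hP : Plane p V]
variable {s : Sch (ZMod 4 × V)} {Q : AddSubgroup V}

theorem zmod4_odd_add {h : ZMod 4} (hh : h = 1 ∨ h = 3) : h + 2 = 1 ∨ h + 2 = 3 := by
  revert h; decide

include hP in
variable (p) in
/-- A closed subset containing the generator and lying over `0` is the first factor. -/
theorem H_sub_of {W : AddSubgroup (ZMod 4 × V)} (hW : s.Isub W) (h2 : ∀ x ∈ W, x.2 = 0)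
    {h : ZMod 4} (hh : h = 1 ∨ h = 3) (hm : (h, 0) ∈ W) :
    s.Isub ((⊤ : AddSubgroup (ZMod 4)).prod (⊥ : AddSubgroup V)) := by
  have h1 := odd_mem (p := p) hm hh
  have : W = (⊤ : AddSubgroup (ZMod 4)).prod (⊥ : AddSubgroup V) := by
    ext x
    refine ⟨fun hx => ⟨trivial, h2 x hx⟩, fun hx => ?_⟩
    obtain ⟨a, v⟩ := x
    have hv : v = 0 := hx.2
    subst hv
    exact H_mem h1 a
  rwa [← this]

theorem line_exists (hQ : Nat.card Q = p) : ∃ q ∈ Q, q ≠ 0 := by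
  by_contra! h
  exact line_ne_bot hQ ((AddSubgroup.eq_bot_iff_forall _).2 h)

theorem odd_full (hQ : Nat.card Q = p) (hUx : ∀ x y, s.r x y → y.2 - x.2 ∈ Q)
    (hH : ¬ s.Isub ((⊤ : AddSubgroup (ZMod 4)).prod (⊥ : AddSubgroup V)))
    {x : ZMod 4 × V} {h : ZMod 4} (hh : h = 1 ∨ h = 3) {v : V} (hv : s.r x (h, v)) {q : V}
    (hq : q ∈ Q) : s.r x (h, v + q) := by
  refine comp_full hQ hUx ?_ hv hq
  by_contra hd
  obtain ⟨W, hW, h2, hm⟩ := (cl_inv (s := s) x).pp p hd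
  exact hH (H_sub_of p hW h2 hh hm)

theorem C2Q_sub_of (hQ : Nat.card Q = p) (hz : s.Inv {((2, 0) : ZMod 4 × V)})
    {W : AddSubgroup (ZMod 4 × V)} (hW : s.Isub W) (h1 : ∀ x ∈ W, x.1 ∈ Z2 ∧ x.2 ∈ Q)
    {x : ZMod 4 × V} (hx : x ∈ W) (h0 : x.2 ≠ 0) : s.Isub (Z2.prod Q) := by
  have h2 : W ⊔ Z2.prod (⊥ : AddSubgroup V) = Z2.prod Q := by
    apply le_antisymm
    · refine sup_le (fun y hy => h1 y hy) fun y hy => ⟨hy.1, ?_⟩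
      have : y.2 = 0 := hy.2
      rw [this]
      exact zero_mem _
    · have h3 : ∀ q ∈ Q, ((0, q) : ZMod 4 × V) ∈ W := by
        have h4 : ((0, x.2) : ZMod 4 × V) ∈ W := sub_snd p (h := x.1) hx
        intro q hq
        rw [← zmultiples_eq_line hQ (h1 x hx).2 h0] at hq
        obtain ⟨k, -, rfl⟩ := (mem_zmultiples_iff p).1 hq
        have := nsmul_mem h4 k
        rwa [Prod.smul_mk, smul_zero] at this
      rintro ⟨a, q⟩ ⟨ha, hq⟩
      have : ((a, q) : ZMod 4 × V) = (0, q) + (a, 0) := by simp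
      rw [this]
      exact add_mem (AddSubgroup.mem_sup_left (h3 q hq))
        (AddSubgroup.mem_sup_right ⟨ha, rfl⟩)
  rw [← h2]
  exact inv_sup hW (C2_sub hz)

theorem line_sub_of (hQ : Nat.card Q = p) {W : AddSubgroup (ZMod 4 × V)} (hW : s.Isub W)
    (h1 : ∀ x ∈ W, x.1 = 0 ∧ x.2 ∈ Q) {x : ZMod 4 × V} (hx : x ∈ W) (h0 : x.2 ≠ 0) :
    s.Isub ((⊥ : AddSubgroup (ZMod 4)).prod Q) := by
  have h2 : W = (⊥ : AddSubgroup (ZMod 4)).prod Q := by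
    apply le_antisymm
    · exact fun y hy => h1 y hy
    · have h4 : ((0, x.2) : ZMod 4 × V) ∈ W := sub_snd p (h := x.1) hx
      rintro ⟨a, q⟩ ⟨ha, hq⟩
      have ha' : a = 0 := ha
      have hq' : q ∈ Q := hq
      subst ha'
      rw [← zmultiples_eq_line hQ (h1 x hx).2 h0] at hq'
      obtain ⟨k, -, rfl⟩ := (mem_zmultiples_iff p).1 hq'
      have := nsmul_mem h4 k
      rwa [Prod.smul_mk, smul_zero] at this
  rwa [← h2]

theorem dbl_mem {x y : ZMod 4 × V} (h : s.r x y) : y + y ∈ {g | ∃ y, s.r x y ∧ y + y = g} :=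
  ⟨y, h, rfl⟩

theorem case_b_even_not (hQ : Nat.card Q = p) (hU : s.Isub ((⊤ : AddSubgroup (ZMod 4)).prod Q))
    (hUx : ∀ x y, s.r x y → y.2 - x.2 ∈ Q) (hz : s.Inv {((2, 0) : ZMod 4 × V)})
    (hH : ¬ s.Isub ((⊤ : AddSubgroup (ZMod 4)).prod (⊥ : AddSubgroup V)))
    (hE : ¬ s.Isub (Z2.prod Q)) : Concl p s := by
  by_cases hall : ∀ x ∉ Z2.prod (⊥ : AddSubgroup V), s.r x (x + (2, 0))
  · exact Concl.of_triv (WrTriv.of_C2 hz hall)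
  push Not at hall
  obtain ⟨x, hxC, hx⟩ := hall
  have hW := Inv.dbl p hz hx
  by_cases hxU : x.2 ∈ Q
  · exfalso
    have hcl : ∀ y, s.r x y → y.2 ∈ Q := fun y hy => by
      have := add_mem (hUx x y hy) hxU
      rwa [sub_add_cancel] at this
    have hz0 : ∀ y, s.r x y → y.2 = 0 := by
      intro y hy
      by_contra hc
      refine hE (C2Q_sub_of hQ hz hW.closure ?_ (AddSubgroup.subset_closure (dbl_mem hy)) ?_)
      · refine fun g hg => closure_le' (W := Z2.prod Q) ?_ hg
        rintro _ ⟨y, hy, rfl⟩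
        exact ⟨Z2_double _, add_mem (hcl y hy) (hcl y hy)⟩
      · exact fun h => hc ((two_smul_eq_zero p).1 h)
    have h1 : x.1 = 1 ∨ x.1 = 3 := not_Z2 fun h => hxC ⟨h, hz0 x (rfl' x)⟩
    refine hH (H_sub_of p (cl_inv (s := s) x).closure ?_ h1
      (AddSubgroup.subset_closure ?_))
    · refine fun g hg => ?_
      exact (AddSubgroup.mem_prod.1 (closure_le'
        (W := (⊤ : AddSubgroup (ZMod 4)).prod (⊥ : AddSubgroup V))
        (fun y hy => ⟨trivial, hz0 y hy⟩) hg)).2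
    · have := hz0 x (rfl' x)
      change s.r x (x.1, 0)
      rw [← this]
      exact rfl' x
  · have hsnd : ∀ y, s.r x y → y.2 = x.2 := by
      intro y hy
      by_contra hc
      refine hE (C2Q_sub_of hQ hz (hW.sub hW).closure ?_
        (AddSubgroup.subset_closure (Set.sub_mem_sub (dbl_mem hy) (dbl_mem (rfl' x)))) ?_)
      · refine fun g hg => closure_le' (W := Z2.prod Q) ?_ hg
        rintro _ ⟨_, ⟨y, hy, rfl⟩, _, ⟨y', hy', rfl⟩, rfl⟩
        refine ⟨Z2.sub_mem (Z2_double _) (Z2_double _), ?_⟩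
        have h1 := hUx x y hy
        have h2 := hUx x y' hy'
        have : (y + y - (y' + y')).2 = ((y.2 - x.2) - (y'.2 - x.2)) + ((y.2 - x.2) - (y'.2 - x.2)) := by
          simp only [Prod.snd_sub, Prod.snd_add]; abel
        change (y + y - (y' + y')).2 ∈ Q
        rw [this]
        exact add_mem (sub_mem h1 h2) (sub_mem h1 h2)
      · intro h
        have : y.2 + y.2 - (x.2 + x.2) = 0 := h
        exact hc (double_inj p (sub_eq_zero.1 this))
    have heven : ∀ y, s.r x y → y.1 ∈ Z2 := by
      intro y hy
      by_contra hc
      obtain ⟨q, hq, hq0⟩ := line_exists hQ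
      have := hsnd _ (odd_full hQ hUx hH (not_Z2 hc) (v := y.2) hy hq)
      have h2 : y.2 + q = x.2 := this
      rw [hsnd y hy] at h2
      exact hq0 (by simpa using h2)
    have hsing : s.Inv {x} := by
      have : ({x} : Set (ZMod 4 × V)) = s.cl x := by
        ext y
        rw [Set.mem_singleton_iff]
        refine ⟨by rintro rfl; exact rfl' _, fun hy => ?_⟩
        by_contra hc
        apply hx
        have : y = x + (2, 0) := by
          refine Prod.ext ?_ (by simpa using hsnd y hy)
          have h1 := heven y hy
          have h2 := heven x (rfl' x)
          have h3 : y.1 ≠ x.1 := fun h => hc (Prod.ext h (hsnd y hy))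
          change y.1 = x.1 + 2
          rw [mem_Z2] at h1 h2
          revert h1 h2 h3
          generalize y.1 = a
          generalize x.1 = b
          revert a b
          decide
        rw [← this]
        exact hy
      rw [this]
      exact cl_inv x
    have : s.Inv {((0, x.2) : ZMod 4 × V)} := by
      rcases heven x (rfl' x) with h | h
      · have h' : x.1 = 0 := h
        rwa [← h']
      · have h' : x.1 = 2 := h
        have h3 := hz.add hsing
        rw [Set.singleton_add_singleton] at h3
        convert h3 using 2
        refine Prod.ext ?_ (by simp)
        change 0 = 2 + x.1
        rw [h']; decide
    exact Or.inr (Or.inl (tens_of_single hQ hU hxU this))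

theorem N_coset (hN : s.Isub (Z2.prod (⊤ : AddSubgroup V))) {x y : ZMod 4 × V} (h : s.r x y) :
    x.1 ∈ Z2 ↔ y.1 ∈ Z2 := by
  have := Inv.mem_iff hN h
  rwa [SetLike.mem_coe, SetLike.mem_coe, prod_top_mem, prod_top_mem] at this

/-- A noninvariant class off a closed `C₂ × Q` produces the index two closed subset. -/
theorem N_of_noninv (hQ : Nat.card Q = p) (hz : s.Inv {((2, 0) : ZMod 4 × V)})
    (hE : s.Isub (Z2.prod Q)) {x : ZMod 4 × V} (hxQ : x.2 ∉ Q) (hx : ¬ s.r x (x + (2, 0))) :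
    s.Isub (Z2.prod (⊤ : AddSubgroup V)) := by
  have hW := Inv.dbl p hz hx
  have h1 := inv_sup hW.closure hE
  have h2 : AddSubgroup.closure {g | ∃ y, s.r x y ∧ y + y = g} ⊔ Z2.prod Q =
      Z2.prod (⊤ : AddSubgroup V) := by
    apply le_antisymm
    · refine sup_le (closure_le' ?_) fun y hy => ⟨hy.1, trivial⟩
      rintro _ ⟨y, -, rfl⟩
      exact ⟨Z2_double _, trivial⟩
    · set W := AddSubgroup.closure {g | ∃ y, s.r x y ∧ y + y = g} ⊔ Z2.prod Q with hWd
      have h3 : Q ≤ vp W := fun q hq => AddSubgroup.mem_sup_right ⟨zero_mem _, hq⟩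
      have h4 : x.2 + x.2 ∈ vp W :=
        sub_snd p (h := x.1 + x.1) (AddSubgroup.mem_sup_left
          (AddSubgroup.subset_closure (dbl_mem (rfl' x))))
      have h5 : vp W = ⊤ := by
        by_contra hc
        have := line_le hQ hc h3
        rw [← this] at h4
        exact hxQ ((double_mem p).1 h4)
      rintro ⟨a, v⟩ ⟨ha, -⟩
      refine (mem_sub p).2 ⟨AddSubgroup.mem_sup_right ⟨ha, zero_mem _⟩, ?_⟩
      rw [h5]
      trivial
  rw [← h2]
  exact h1

/-- With a closed `N` of index two, doubling a noninvariant class gives a closed set over `0`. -/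
theorem dbl_even (p : ℕ) [hP : Plane p V] (hz : s.Inv {((2, 0) : ZMod 4 × V)})
    (hN : s.Isub (Z2.prod (⊤ : AddSubgroup V))) {x : ZMod 4 × V} (hx : ¬ s.r x (x + (2, 0))) :
    s.Inv {g | g.1 = 0 ∧ ∃ y, s.r x y ∧ y.2 + y.2 = g.2} := by
  have hW := Inv.dbl p hz hx
  have key : {g : ZMod 4 × V | g.1 = 0 ∧ ∃ y, s.r x y ∧ y.2 + y.2 = g.2} =
      {(x.1 + x.1, 0)} + {g | ∃ y, s.r x y ∧ y + y = g} := by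
    rw [Set.singleton_add]
    have h0 : ∀ y, s.r x y → x.1 + x.1 + (y.1 + y.1) = 0 := by
      intro y hy
      have := N_coset hN hy
      rw [mem_Z2, mem_Z2] at this
      revert this
      generalize y.1 = a
      generalize x.1 = b
      revert a b
      decide
    ext ⟨a, v⟩
    constructor
    · rintro ⟨h1, y, hy, h2⟩
      have h1' : a = 0 := h1
      have h2' : y.2 + y.2 = v := h2
      subst h1' h2'
      refine ⟨y + y, dbl_mem hy, Prod.ext (h0 y hy) (zero_add _)⟩
    · rintro ⟨_, ⟨y, hy, rfl⟩, h⟩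
      have h' : (x.1 + x.1, (0 : V)) + (y + y) = (a, v) := h
      rw [Prod.ext_iff] at h'
      refine ⟨h'.1.symm.trans (h0 y hy), y, hy, (zero_add _).symm.trans h'.2⟩
  rw [key]
  refine Inv.add ?_ hW
  have := Z2_double x.1
  rcases this with h | h
  · have h' : x.1 + x.1 = 0 := h
    rw [h']
    exact inv_zero
  · have h' : x.1 + x.1 = 2 := h
    rw [h']
    exact hz

theorem case_b_even (hQ : Nat.card Q = p) (hU : s.Isub ((⊤ : AddSubgroup (ZMod 4)).prod Q))
    (hUx : ∀ x y, s.r x y → y.2 - x.2 ∈ Q) (hz : s.Inv {((2, 0) : ZMod 4 × V)})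
    (hH : ¬ s.Isub ((⊤ : AddSubgroup (ZMod 4)).prod (⊥ : AddSubgroup V)))
    (hE : s.Isub (Z2.prod Q)) : Concl p s := by
  have hodd : ∀ x : ZMod 4 × V, x.1 ∉ Z2 → ∀ q ∈ Q, s.r x (x + (0, q)) := by
    rintro ⟨h, v⟩ hx q hq
    have := odd_full hQ hUx hH (not_Z2 hx) (v := v) (rfl' (h, v)) hq
    rwa [Prod.mk_add_mk, add_zero]
  have hoddz : ¬ s.Isub ((⊥ : AddSubgroup (ZMod 4)).prod Q) → ∀ x : ZMod 4 × V,
      (∀ y, s.r x y → y.1 ∉ Z2) → s.r x (x + (2, 0)) := by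
    intro hnQ x hx
    have h1 : ∀ q ∈ Q, ((0, q) : ZMod 4 × V) ∈ Sch.stab (s.cl x) := by
      intro q hq t ht
      rw [add_comm]
      exact trans' ht (hodd t (hx t ht) q hq)
    have h2 := (sub_of_line hU hnQ (cl_inv (s := s) x).stab h1 p).1
    rw [add_comm]
    exact h2 x (rfl' x)
  by_cases hU' : ∀ x : ZMod 4 × V, x.2 ∉ Q → s.r x (x + (2, 0))
  · have hcl : ∀ x : ZMod 4 × V, x.2 ∈ Q → x.1 ∉ Z2 → ∀ y, s.r x y → y.1 ∉ Z2 := by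
      intro x hx hx1 y hy h1
      refine hx1 (hE _ _ (symm' hy) ⟨h1, ?_⟩).1
      exact (hU _ _ hy ⟨trivial, hx⟩).2
    by_cases hQs : s.Isub ((⊥ : AddSubgroup (ZMod 4)).prod Q)
    · by_cases hc : s.r (1, 0) (3, 0)
      · refine Or.inr (Or.inr (Or.inr (Or.inl ⟨hz, Q, hQ, hQs, fun x hx => ?_⟩)))
        by_cases hxQ : x.2 ∈ Q
        · have hx1 : x.1 ∉ Z2 := fun h => hx ⟨h, hxQ⟩
          have h2 : ∀ y : ZMod 4 × V, y.1 ∉ Z2 → y.2 ∈ Q → s.r (1, 0) y := by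
            rintro ⟨a, q⟩ ha hq
            rcases not_Z2 ha with h | h
            · have h' : a = 1 := h
              subst h'
              have := hodd (1, 0) ha q hq
              rwa [Prod.mk_add_mk, add_zero, zero_add] at this
            · have h' : a = 3 := h
              subst h'
              have := hodd (3, 0) ha q hq
              rw [Prod.mk_add_mk, add_zero, zero_add] at this
              exact trans' hc this
          refine trans' (symm' (h2 x hx1 hxQ)) (h2 _ (odd_not_Z2 (zmod4_odd_add (not_Z2 hx1))) ?_)
          simpa using hxQ
        · exact hU' x hxQ
      · refine Or.inr (Or.inr (Or.inr (Or.inr ⟨hz, Q, hQ, hU, hQs, fun x hx => ?_, fun y => ?_⟩)))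
        · exact hU' x fun h => hx (top_prod_mem.2 h)
        · constructor
          · intro hy
            have h2 : y.2 ∈ Q := by simpa using hUx _ _ hy
            have h1 := not_Z2 (hcl (1, 0) (zero_mem Q) one_notMem_Z2 y hy)
            refine ⟨h1.resolve_right fun h3 => hc (trans' hy ?_), h2⟩
            have := hodd y (odd_not_Z2 (Or.inr h3)) (-y.2) (neg_mem h2)
            have h4 : y + (0, -y.2) = (3, 0) := Prod.ext (by simpa using h3) (by simp)
            rwa [h4] at this
          · rintro ⟨h1, h2⟩
            have := hodd (1, 0) one_notMem_Z2 y.2 h2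
            have h3 : ((1, 0) : ZMod 4 × V) + (0, y.2) = y := Prod.ext (by simp [h1]) (by simp)
            rwa [h3] at this
    · refine Concl.of_triv (WrTriv.of_C2 hz fun x hx => ?_)
      by_cases hxQ : x.2 ∈ Q
      · by_cases hx1 : x.1 ∈ Z2
        · by_contra hc
          have hW := (Inv.dbl p hz hc).closure
          refine hQs (line_sub_of hQ hW ?_ (AddSubgroup.subset_closure (dbl_mem (rfl' x))) ?_)
          · refine fun g hg => closure_le' (W := (⊥ : AddSubgroup (ZMod 4)).prod Q) ?_ hg
            rintro _ ⟨y, hy, rfl⟩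
            have := hE _ _ hy ⟨hx1, hxQ⟩
            exact ⟨Z2_double_eq this.1, add_mem this.2 this.2⟩
          · intro h
            exact hx ⟨hx1, (two_smul_eq_zero p).1 h⟩
        · exact hoddz hQs x (hcl x hxQ hx1)
      · exact hU' x hxQ
  · push Not at hU'
    obtain ⟨x, hxQ, hx⟩ := hU'
    have hN := N_of_noninv hQ hz hE hxQ hx
    by_cases hQs : s.Isub ((⊥ : AddSubgroup (ZMod 4)).prod Q)
    · have hV : s.Isub ((⊥ : AddSubgroup (ZMod 4)).prod (⊤ : AddSubgroup V)) := by
        refine V_sub_of_coset hQ (w := x.2 + x.2) (fun h => hxQ ((double_mem p).1 h)) ?_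
        convert (dbl_even p hz hN hx).add hQs using 1
        ext ⟨a, v⟩
        constructor
        · rintro ⟨h1, h2⟩
          have h1' : a = 0 := h1
          subst h1'
          refine ⟨(0, x.2 + x.2), ⟨rfl, x, rfl' x, rfl⟩, (0, v - (x.2 + x.2)), ⟨rfl, h2⟩, ?_⟩
          simp
        · rintro ⟨⟨b, u⟩, ⟨h1, y, hy, h2⟩, ⟨c, q⟩, ⟨h3, h4⟩, h5⟩
          have h1' : b = 0 := h1
          have h3' : c = 0 := h3
          have h2' : y.2 + y.2 = u := h2
          have h4' : q ∈ Q := h4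
          subst h1' h3' h2'
          have h5' : ((0 : ZMod 4), y.2 + y.2) + (0, q) = (a, v) := h5
          rw [Prod.mk_add_mk, Prod.ext_iff] at h5'
          refine ⟨h5'.1.symm.trans (add_zero 0), ?_⟩
          have h6 : y.2 + y.2 + q = v := h5'.2
          change v - (x.2 + x.2) ∈ Q
          rw [← h6]
          have h7 := hUx x y hy
          have : y.2 + y.2 + q - (x.2 + x.2) = (y.2 - x.2) + (y.2 - x.2) + q := by abel
          rw [this]
          exact add_mem (add_mem h7 h7) h4'
      refine Concl.of_triv ⟨Z2.prod ⊤, (⊥ : AddSubgroup (ZMod 4)).prod Q, ?_, hN, hQs, ?_,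
        N_ne_top, ?_, ?_⟩
      · rintro ⟨a, q⟩ ⟨ha, -⟩
        have ha' : a = 0 := ha
        subst ha'
        exact ⟨zero_mem _, trivial⟩
      · obtain ⟨q, hq, hq0⟩ := line_exists hQ
        exact ne_bot_of_mem (x := (0, q)) ⟨rfl, hq⟩ fun h => hq0 (congrArg Prod.snd h)
      · rintro y hy ⟨a, q⟩ ⟨ha, hq⟩
        have ha' : a = 0 := ha
        subst ha'
        exact hodd y (fun h => hy ⟨h, trivial⟩) q hq
      · rintro y ⟨hy, -⟩ y' hyy
        refine ⟨?_, hUx y y' hyy⟩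
        rcases hy with h | h
        · have h' : y.1 = 0 := h
          have := (hV _ _ hyy ⟨h', trivial⟩).1
          have h2 : y'.1 = 0 := this
          change y'.1 - y.1 = 0
          rw [h', h2, sub_zero]
        · have h' : y.1 = 2 := h
          have := (hV _ _ (zr hz hyy) ⟨by change y.1 + 2 = 0; rw [h']; decide, trivial⟩).1
          have h2 : y'.1 + 2 = 0 := this
          change y'.1 - y.1 = 0
          rw [h', ← h2]
          generalize y'.1 = a
          revert a
          decide
    · refine Concl.of_triv ⟨Z2.prod ⊤, Z2.prod Q, fun x hx => ⟨hx.1, trivial⟩, hN, hE, ?_,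
        N_ne_top, ?_, ?_⟩
      · exact ne_bot_of_mem (x := (2, 0)) ⟨Or.inr rfl, zero_mem _⟩ z_ne_zero
      · rintro y hy ⟨a, q⟩ ⟨ha, hq⟩
        have hy1 : y.1 ∉ Z2 := fun h => hy ⟨h, trivial⟩
        have h1 := hodd y hy1 q hq
        rcases ha with h | h
        · have h' : a = 0 := h
          subst h'
          exact h1
        · have h' : a = 2 := h
          subst h'
          have h2 := hoddz hQs y fun y' hyy h => hy1 ((N_coset hN hyy).2 h)
          have h3 := hodd (y + (2, 0)) (odd_not_Z2 (zmod4_odd_add (not_Z2 hy1))) q hq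
          have h4 := trans' h2 h3
          have h5 : ((2, 0) : ZMod 4 × V) + (0, q) = (2, q) := by simp
          rwa [add_assoc, h5] at h4
      · rintro y ⟨hy, -⟩ y' hyy
        exact ⟨Z2.sub_mem ((N_coset hN hyy).1 hy) hy, hUx y y' hyy⟩

theorem case_b (hQ : Nat.card Q = p) (hU : s.Isub ((⊤ : AddSubgroup (ZMod 4)).prod Q))
    (hUx : ∀ x y, s.r x y → y.2 - x.2 ∈ Q) (hz : s.Inv {((2, 0) : ZMod 4 × V)})
    (hH : ¬ s.Isub ((⊤ : AddSubgroup (ZMod 4)).prod (⊥ : AddSubgroup V))) : Concl p s := by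
  by_cases hE : s.Isub (Z2.prod Q)
  · exact case_b_even hQ hU hUx hz hH hE
  · exact case_b_even_not hQ hU hUx hz hH hE

end Sch

namespace Sch
open Plane

variable {p : ℕ} {V : Type*} [AddCommGroup V] [Fintype V] [hP : Plane p V]
variable {s : Sch (ZMod 4 × V)} {Q : AddSubgroup V}

variable (s) in
/-- Elements of the second factor forming a class by themselves. -/
def singles : AddSubgroup V where
  carrier := {v | s.Inv {((0, v) : ZMod 4 × V)}}
  zero_mem' := inv_zero
  add_mem' := by
    intro a b ha hb
    have := Inv.add ha hb
    rwa [Set.singleton_add_singleton, Prod.mk_add_mk, add_zero] at this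
  neg_mem' := by
    intro a ha
    have := Inv.neg ha
    rwa [Set.neg_singleton, Prod.neg_mk, neg_zero] at this

theorem mem_singles {v : V} : v ∈ s.singles ↔ s.Inv {((0, v) : ZMod 4 × V)} := Iff.rfl

variable (p) in
include hP in
theorem snd_mem_singles (hz : s.Inv {((2, 0) : ZMod 4 × V)}) {x : ZMod 4 × V} (hx : s.Inv {x}) :
    x.2 ∈ s.singles := by
  rw [← double_mem p, mem_singles]
  have h1 := hx.add hx
  rw [Set.singleton_add_singleton] at h1
  rcases Z2_double x.1 with h | h
  · have h' : x.1 + x.1 = 0 := h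
    convert h1 using 2
    exact Prod.ext h'.symm rfl
  · have h' : x.1 + x.1 = 2 := h
    have h2 := hz.add h1
    rw [Set.singleton_add_singleton] at h2
    convert h2 using 2
    refine Prod.ext ?_ (by simp)
    change 0 = 2 + (x.1 + x.1)
    rw [h']; decide

variable (p) in
include hP in
/-- A noninvariant class over a single point of `V` sits over a singleton. -/
theorem z_inv_of_not_single (hz : s.Inv {((2, 0) : ZMod 4 × V)}) {x : ZMod 4 × V}
    (h2 : ∀ y, s.r x y → y.2 = x.2) (hx : x.2 ∉ s.singles) : s.r x (x + (2, 0)) := by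
  by_contra hc
  have hW := inv_sup (Inv.dbl p hz hc).closure (C2_sub hz)
  set W := AddSubgroup.closure {g | ∃ y, s.r x y ∧ y + y = g} ⊔ Z2.prod (⊥ : AddSubgroup V) with hWd
  have hWe : ∀ g ∈ W, g.1 ∈ Z2 := by
    intro g hg
    have : W ≤ Z2.prod (⊤ : AddSubgroup V) := by
      refine sup_le (closure_le' ?_) fun y hy => ⟨hy.1, trivial⟩
      rintro _ ⟨y, -, rfl⟩
      exact ⟨Z2_double _, trivial⟩
    exact (this hg).1
  have hv : x.2 ∈ vp W := by
    rw [← double_mem p]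
    exact sub_snd p (h := x.1 + x.1) (AddSubgroup.mem_sup_left
          (AddSubgroup.subset_closure (dbl_mem (rfl' x))))
  have hWx : ∀ y, s.r x y → (y ∈ W ↔ y.1 ∈ Z2) := by
    intro y hy
    refine ⟨hWe y, fun h => ?_⟩
    have : y = (y.1, x.2) := Prod.ext rfl (h2 y hy)
    rw [this, mem_sub p]
    exact ⟨AddSubgroup.mem_sup_right ⟨h, rfl⟩, hv⟩
  have hpar : ∀ y, s.r x y → (x.1 ∈ Z2 ↔ y.1 ∈ Z2) := by
    intro y hy
    rw [← hWx y hy, ← hWx x (rfl' x)]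
    exact Inv.mem_iff hW hy
  have hsing : s.Inv {x} := by
    have : ({x} : Set (ZMod 4 × V)) = s.cl x := by
      ext y
      rw [Set.mem_singleton_iff]
      refine ⟨by rintro rfl; exact rfl' _, fun hy => ?_⟩
      by_contra hn
      apply hc
      have : y = x + (2, 0) := by
        refine Prod.ext ?_ (by simpa using h2 y hy)
        have h1 := hpar y hy
        have h3 : y.1 ≠ x.1 := fun h => hn (Prod.ext h (h2 y hy))
        change y.1 = x.1 + 2
        rw [mem_Z2, mem_Z2] at h1
        revert h1 h3
        generalize y.1 = a
        generalize x.1 = b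
        revert a b
        decide
      rw [← this]
      exact hy
    rw [this]
    exact cl_inv x
  exact hx (snd_mem_singles p hz hsing)

variable (p) in
include hP in
theorem H_of_z (hHs : s.Isub ((⊤ : AddSubgroup (ZMod 4)).prod (⊥ : AddSubgroup V)))
    (hz : ¬ s.Inv {((2, 0) : ZMod 4 × V)}) {W : AddSubgroup (ZMod 4 × V)} (hW : s.Isub W)
    (hm : ((2, 0) : ZMod 4 × V) ∈ W) : ((1, 0) : ZMod 4 × V) ∈ W := by
  by_contra hc
  refine hz (z_of_sub p (inv_inf hW hHs) (fun x hx => hx.2.2) (fun h => hc h.1)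
    (x := (2, 0)) ⟨hm, trivial, rfl⟩ z_ne_zero)

variable (p) in
include hP in
/-- If the involution is not a class, a class is either invariant under the first factor, or its
noninvariant doubles all lie over `0`. -/
theorem H_inv_or (hHs : s.Isub ((⊤ : AddSubgroup (ZMod 4)).prod (⊥ : AddSubgroup V)))
    (hz : ¬ s.Inv {((2, 0) : ZMod 4 × V)}) (x : ZMod 4 × V) :
    (∀ l ∈ (⊤ : AddSubgroup (ZMod 4)).prod (⊥ : AddSubgroup V), s.r x (x + l)) ∨
    ∃ D : Set (ZMod 4 × V), s.Inv D ∧ D.Nonempty ∧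
      ∀ g ∈ D, g.1 = 0 ∧ ∃ y, s.r x y ∧ y.2 + y.2 = g.2 := by
  by_cases h : ∀ t ∈ s.cl x, t + (2, 0) ∈ s.cl x
  · left
    have h1 : ((2, 0) : ZMod 4 × V) ∈ Sch.stab (s.cl x) := by
      intro t ht
      rw [add_comm]
      exact h t ht
    have h2 := H_of_z p hHs hz (cl_inv (s := s) x).stab h1
    rintro ⟨a, v⟩ ⟨-, hv⟩
    have hv' : v = 0 := hv
    subst hv'
    have := H_mem h2 a x (rfl' x)
    rwa [add_comm] at this
  · right
    push Not at h
    obtain ⟨t, ht, ht2⟩ := h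
    have hD := (cl_inv (s := s) x).sq p
    refine ⟨_, hD, ⟨t + t, t, ht, ht2, rfl⟩, ?_⟩
    rintro g ⟨y, hy, hy2, rfl⟩
    refine ⟨?_, y, hy, rfl⟩
    refine fst_zero_of_z p (W := AddSubgroup.closure
      {g | ∃ y ∈ s.cl x, y + (2, 0) ∉ s.cl x ∧ y + y = g}) ?_ _
      (AddSubgroup.subset_closure ⟨y, hy, hy2, rfl⟩)
    intro hm
    have h1 := H_of_z p hHs hz hD.closure hm
    have h2 : AddSubgroup.closure {g | ∃ y ∈ s.cl x, y + (2, 0) ∉ s.cl x ∧ y + y = g} ≤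
        Z2.prod (⊤ : AddSubgroup V) := by
      refine closure_le' ?_
      rintro _ ⟨y, -, -, rfl⟩
      exact ⟨Z2_double _, trivial⟩
    exact one_notMem_Z2 (h2 h1).1

theorem HQ_ne_bot {P : AddSubgroup V} : (⊤ : AddSubgroup (ZMod 4)).prod P ≠ ⊥ :=
  ne_bot_of_mem (x := (2, 0)) ⟨trivial, zero_mem _⟩ z_ne_zero

theorem HQ_ne_top {P : AddSubgroup V} (hP : P ≠ ⊤) : (⊤ : AddSubgroup (ZMod 4)).prod P ≠ ⊤ :=
  ne_top_of_snd hP fun _ hx => hx.2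

/-- Two related elements over the same singleton of `V` have the same parity. -/
theorem sub_mem_C2 (hz : s.Inv {((2, 0) : ZMod 4 × V)}) {x y : ZMod 4 × V} (hxy : s.r x y)
    (h2 : y.2 = x.2) (hx : x.2 ∈ s.singles) : y - x ∈ Z2.prod (⊥ : AddSubgroup V) := by
  have h1 := single_add (neg_mem hx : s.Inv {((0, -x.2) : ZMod 4 × V)}) hxy
  have e1 : ((0, -x.2) : ZMod 4 × V) + x = (x.1, 0) := Prod.ext (by simp) (by simp)
  have e2 : ((0, -x.2) : ZMod 4 × V) + y = (y.1, 0) := Prod.ext (by simp) (by simp [h2])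
  rw [e1, e2] at h1
  refine ⟨?_, sub_eq_zero.2 h2⟩
  change y.1 - x.1 ∈ Z2
  have hC := Inv.mem_iff (C2_sub hz) h1
  have hC' : x.1 ∈ Z2 ↔ y.1 ∈ Z2 :=
    ⟨fun h => (hC.1 ⟨h, rfl⟩).1, fun h => (hC.2 ⟨h, rfl⟩).1⟩
  rw [mem_Z2, mem_Z2] at hC'
  rw [mem_Z2]
  revert hC'
  generalize y.1 = a
  generalize x.1 = b
  revert a b
  decide

include hP in
/-- Schemes whose quotient by the closed first factor is trivial. -/
theorem case_a_triv (hHs : s.Isub ((⊤ : AddSubgroup (ZMod 4)).prod (⊥ : AddSubgroup V)))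
    (hi : ∀ x y, s.r x y → y.2 = x.2) : Concl p s := by
  by_cases hP' : s.singles = ⊤
  · have hs : ∀ v : V, s.Inv {((0, v) : ZMod 4 × V)} := fun v => by
      rw [← mem_singles, hP']; trivial
    refine Or.inr (Or.inl ⟨(⊥ : AddSubgroup (ZMod 4)).prod ⊤, (⊤ : AddSubgroup (ZMod 4)).prod ⊥,
      V_ne_bot (exists_ne_zero p), HQ_ne_bot, ?_, hHs, ?_, ?_, ?_⟩)
    · rintro ⟨a, v⟩ y hxy ⟨ha, -⟩
      have ha' : a = 0 := ha
      subst ha'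
      have : y = (0, v) := hs v _ _ hxy rfl
      rw [this]
      exact ⟨rfl, trivial⟩
    · rw [eq_bot_iff]
      rintro ⟨a, v⟩ ⟨⟨ha, -⟩, ⟨-, hv⟩⟩
      exact Prod.ext ha hv
    · rw [eq_top_iff]
      rintro ⟨a, v⟩ -
      have : ((a, v) : ZMod 4 × V) = (0, v) + (a, 0) := by simp
      rw [this]
      exact add_mem (AddSubgroup.mem_sup_left ⟨rfl, trivial⟩)
        (AddSubgroup.mem_sup_right ⟨trivial, rfl⟩)
    · rintro ⟨a, v⟩ ⟨ha, -⟩ a' - b - b' - haa hbb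
      have ha' : a = 0 := ha
      subst ha'
      have : a' = (0, v) := hs v _ _ haa rfl
      rw [this]
      exact single_add (hs v) hbb
  · have hU : s.Isub ((⊤ : AddSubgroup (ZMod 4)).prod s.singles) := by
      intro x y hxy hx
      refine ⟨trivial, ?_⟩
      have : y.2 = x.2 := hi x y hxy
      rw [this]
      exact hx.2
    by_cases hz : s.Inv {((2, 0) : ZMod 4 × V)}
    · refine Concl.of_triv ⟨_, Z2.prod ⊥, ?_, hU, C2_sub hz, C2_ne_bot, HQ_ne_top hP', ?_, ?_⟩
      · rintro ⟨a, v⟩ ⟨-, hv⟩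
        have hv' : v = 0 := hv
        subst hv'
        exact ⟨trivial, zero_mem _⟩
      · intro x hx l hl
        rcases C2_mem.1 hl with rfl | rfl
        · rw [add_zero]; exact rfl' x
        · exact z_inv_of_not_single p hz (hi x) fun h => hx (top_prod_mem.2 h)
      · intro x hx y hxy
        exact sub_mem_C2 hz hxy (hi x y hxy) hx.2
    · refine Concl.of_triv ⟨_, _, ?_, hU, hHs, HQ_ne_bot, HQ_ne_top hP', ?_, ?_⟩
      · rintro ⟨a, v⟩ ⟨-, hv⟩
        have hv' : v = 0 := hv
        subst hv'
        exact ⟨trivial, zero_mem _⟩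
      · intro x hx
        refine (H_inv_or p hHs hz x).resolve_right ?_
        rintro ⟨D, hD, ⟨g, hg⟩, hDg⟩
        apply hx
        refine top_prod_mem.2 ((double_mem p).1 (mem_singles.2 ?_))
        convert hD using 1
        ext g'
        have key : ∀ g ∈ D, g = (0, x.2 + x.2) := by
          intro g hg
          obtain ⟨h1, y, hy, h2⟩ := hDg g hg
          rw [hi x y hy] at h2
          exact Prod.ext h1 h2.symm
        constructor
        · rintro rfl
          rw [← key g hg]
          exact hg
        · exact key g'
      · intro x _ y hxy
        exact ⟨trivial, sub_eq_zero.2 (hi x y hxy)⟩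

theorem case_a_not_z (hQ : Nat.card Q = p)
    (hU : s.Isub ((⊤ : AddSubgroup (ZMod 4)).prod Q))
    (hHs : s.Isub ((⊤ : AddSubgroup (ZMod 4)).prod (⊥ : AddSubgroup V)))
    (hUx : ∀ x y, s.r x y → y.2 - x.2 ∈ Q)
    (h1 : ∀ x y, x.2 ∈ Q → s.r x y → y.2 = x.2)
    (h2 : ∀ x : ZMod 4 × V, x.2 ∉ Q → ∀ q ∈ Q, ∃ h, s.r x (h, x.2 + q))
    (hm : s.Isub ((⊥ : AddSubgroup (ZMod 4)).prod (⊤ : AddSubgroup V)) → s.Isub (Z2.prod ⊤))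
    (hz : ¬ s.Inv {((2, 0) : ZMod 4 × V)}) : Concl p s := by
  refine Concl.of_triv ⟨_, _, ?_, hU, hHs, HQ_ne_bot, HQ_ne_top (line_ne_top hQ), ?_, ?_⟩
  · rintro ⟨a, v⟩ ⟨-, hv⟩
    have hv' : v = 0 := hv
    subst hv'
    exact ⟨trivial, zero_mem _⟩
  · intro x hx
    have hxQ : x.2 ∉ Q := fun h => hx (top_prod_mem.2 h)
    refine (H_inv_or p hHs hz x).resolve_right ?_
    rintro ⟨D, hD, ⟨g, hg⟩, hDg⟩
    have hDQ : ∀ g ∈ D, g.2 - (x.2 + x.2) ∈ Q := by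
      intro g hg
      obtain ⟨-, y, hy, h3⟩ := hDg g hg
      rw [← h3]
      have h7 := hUx x y hy
      have : y.2 + y.2 - (x.2 + x.2) = (y.2 - x.2) + (y.2 - x.2) := by abel
      rw [this]
      exact add_mem h7 h7
    have hw : x.2 + x.2 ∉ Q := fun h => hxQ ((double_mem p).1 h)
    have hgQ : g.2 ∉ Q := by
      intro h
      have := sub_mem h (hDQ g hg)
      rw [sub_sub_cancel] at this
      exact hw this
    have hV := V_sub_of_coset (s := s) hQ hw (by
      convert hD using 1
      ext ⟨a, v⟩
      constructor
      · rintro ⟨ha, hv⟩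
        have ha' : a = 0 := ha
        have hv' : v - (x.2 + x.2) ∈ Q := hv
        subst ha'
        obtain ⟨h, hh⟩ := h2 g hgQ (v - g.2) (by
          have := sub_mem hv' (hDQ g hg)
          rwa [sub_sub_sub_cancel_right] at this)
        rw [add_sub_cancel] at hh
        have h3 := hD _ _ hh hg
        have h4 : h = 0 := (hDg _ h3).1
        rwa [h4] at h3
      · intro h
        exact ⟨(hDg _ h).1, hDQ _ h⟩)
    refine hz (z_of_C2 ?_)
    have := inv_inf (hm hV) hHs
    have e : Z2.prod (⊤ : AddSubgroup V) ⊓ (⊤ : AddSubgroup (ZMod 4)).prod ⊥ = Z2.prod ⊥ := by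
      ext x
      exact ⟨fun h => ⟨h.1.1, h.2.2⟩, fun h => ⟨⟨h.1, trivial⟩, ⟨trivial, h.2⟩⟩⟩
    rwa [e] at this
  · intro x hx y hxy
    exact ⟨trivial, sub_eq_zero.2 (h1 x y hx.2 hxy)⟩

theorem case_a_z_inv (hQ : Nat.card Q = p)
    (hU : s.Isub ((⊤ : AddSubgroup (ZMod 4)).prod Q))
    (hHs : s.Isub ((⊤ : AddSubgroup (ZMod 4)).prod (⊥ : AddSubgroup V)))
    (h1 : ∀ x y, x.2 ∈ Q → s.r x y → y.2 = x.2)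
    (hz : s.Inv {((2, 0) : ZMod 4 × V)})
    (hall : ∀ x : ZMod 4 × V, x.2 ∉ Q → s.r x (x + (2, 0))) : Concl p s := by
  by_cases hQs : Q ≤ s.singles
  · refine Concl.of_triv ⟨_, Z2.prod ⊥, ?_, hU, C2_sub hz, C2_ne_bot,
      HQ_ne_top (line_ne_top hQ), ?_, ?_⟩
    · rintro ⟨a, v⟩ ⟨-, hv⟩
      have hv' : v = 0 := hv
      subst hv'
      exact ⟨trivial, zero_mem _⟩
    · intro x hx l hl
      rcases C2_mem.1 hl with rfl | rfl
      · rw [add_zero]; exact rfl' x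
      · exact hall x fun h => hx (top_prod_mem.2 h)
    · intro x hx y hxy
      exact sub_mem_C2 hz hxy (h1 x y hx.2 hxy) (hQs hx.2)
  · have hns : ∀ q ∈ Q, q ≠ 0 → q ∉ s.singles := by
      intro q hq h0 hqs
      apply hQs
      rw [← zmultiples_eq_line hQ hq h0, AddSubgroup.zmultiples_le]
      exact hqs
    refine Concl.of_triv ⟨_, Z2.prod ⊥, ?_, hHs, C2_sub hz, C2_ne_bot, HQ_ne_top ?_, ?_, ?_⟩
    · exact fun x hx => ⟨trivial, hx.2⟩
    · obtain ⟨v, hv⟩ := exists_ne_zero p (V := V)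
      intro h
      have : v ∈ (⊥ : AddSubgroup V) := h ▸ trivial
      exact hv this
    · intro x hx l hl
      rcases C2_mem.1 hl with rfl | rfl
      · rw [add_zero]; exact rfl' x
      · by_cases hxQ : x.2 ∈ Q
        · exact z_inv_of_not_single p hz (h1 x · hxQ)
            (hns _ hxQ fun h => hx ⟨trivial, h⟩)
        · exact hall x hxQ
    · intro x hx y hxy
      have h0 : x.2 = 0 := hx.2
      refine sub_mem_C2 hz hxy (h1 x y (h0 ▸ zero_mem _) hxy) (h0 ▸ zero_mem _)

theorem case_a_z (hQ : Nat.card Q = p)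
    (hHs : s.Isub ((⊤ : AddSubgroup (ZMod 4)).prod (⊥ : AddSubgroup V)))
    (hUx : ∀ x y, s.r x y → y.2 - x.2 ∈ Q)
    (h1 : ∀ x y, x.2 ∈ Q → s.r x y → y.2 = x.2)
    (h2 : ∀ x : ZMod 4 × V, x.2 ∉ Q → ∀ q ∈ Q, ∃ h, s.r x (h, x.2 + q))
    (hz : s.Inv {((2, 0) : ZMod 4 × V)}) {x : ZMod 4 × V} (hxQ : x.2 ∉ Q)
    (hx : ¬ s.r x (x + (2, 0))) : Concl p s := by
  obtain ⟨q0, hq0, hq0n⟩ := line_exists hQ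
  have hN : s.Isub (Z2.prod (⊤ : AddSubgroup V)) := by
    have hW := inv_sup (Inv.dbl p hz hx).closure (C2_sub hz)
    set W := AddSubgroup.closure {g | ∃ y, s.r x y ∧ y + y = g} ⊔
      Z2.prod (⊥ : AddSubgroup V) with hWd
    have hWe : W ≤ Z2.prod (⊤ : AddSubgroup V) := by
      refine sup_le (closure_le' ?_) fun y hy => ⟨hy.1, trivial⟩
      rintro _ ⟨y, -, rfl⟩
      exact ⟨Z2_double _, trivial⟩
    have hvW : ∀ y, s.r x y → y.2 ∈ vp W := fun y hy => by
      rw [← double_mem p]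
      exact sub_snd p (h := y.1 + y.1) (AddSubgroup.mem_sup_left
          (AddSubgroup.subset_closure (dbl_mem hy)))
    have hxW := hvW x (rfl' x)
    have hQW : Q ≤ vp W := by
      intro q hq
      obtain ⟨h, hh⟩ := h2 x hxQ q hq
      have := sub_mem (hvW _ hh) hxW
      rwa [add_sub_cancel_left] at this
    have htop : vp W = ⊤ := by
      by_contra hc
      have := line_le hQ hc hQW
      rw [← this] at hxW
      exact hxQ hxW
    have : W = Z2.prod ⊤ := by
      refine le_antisymm hWe ?_
      rintro ⟨a, v⟩ ⟨ha, -⟩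
      refine (mem_sub p).2 ⟨AddSubgroup.mem_sup_right ⟨ha, rfl⟩, ?_⟩
      rw [htop]
      trivial
    rwa [this] at hW
  have hV : s.Isub ((⊥ : AddSubgroup (ZMod 4)).prod (⊤ : AddSubgroup V)) := by
    refine V_sub_of_coset hQ (w := x.2 + x.2) (fun h => hxQ ((double_mem p).1 h)) ?_
    convert dbl_even p hz hN hx using 1
    ext ⟨a, v⟩
    refine and_congr_right fun ha => ?_
    change v - (x.2 + x.2) ∈ Q ↔ ∃ y, s.r x y ∧ y.2 + y.2 = v
    constructor
    · intro hv
      obtain ⟨k, -, hk⟩ := exists_smul_inv p (V := V) (not_dvd_two p V)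
      set q := k • (v - (x.2 + x.2)) with hq
      have hqq : q + q = v - (x.2 + x.2) := by
        rw [← two_nsmul]
        exact (hk _).2
      obtain ⟨h, hh⟩ := h2 x hxQ q (nsmul_mem hv k)
      refine ⟨_, hh, ?_⟩
      change x.2 + q + (x.2 + q) = v
      rw [add_add_add_comm, hqq, add_sub_cancel]
    · rintro ⟨y, hy, rfl⟩
      have h7 := hUx x y hy
      have : y.2 + y.2 - (x.2 + x.2) = (y.2 - x.2) + (y.2 - x.2) := by abel
      rw [this]
      exact add_mem h7 h7
  have hQs : ∀ q ∈ Q, s.Inv {((0, q) : ZMod 4 × V)} := by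
    rintro q hq a y hay ha
    have ha' : a = (0, q) := ha
    subst ha'
    exact Prod.ext (hV _ _ hay ⟨rfl, trivial⟩).1 (h1 _ y hq hay)
  have hQi : ∀ x : ZMod 4 × V, x.2 ∉ Q → ∀ q ∈ Q, s.r x (x + (0, q)) := by
    intro x hx
    have key : ∀ q ∈ Q, q ≠ 0 → ∀ t, s.r x t → s.r x (t + (0, q)) → ∀ q ∈ Q, s.r x (x + (0, q)) := by
      intro q hq hqn t ht htq q' hq'
      have e1 : s.r x (x + (0, q)) := by
        refine trans' htq ?_
        rw [add_comm, add_comm x]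
        exact single_add (hQs q hq) (symm' ht)
      have e2 : ∀ k : ℕ, s.r x (x + (0, k • q)) := by
        intro k
        induction k with
        | zero => rw [zero_smul]; convert rfl' x using 1; simp
        | succ k ih =>
          have e3 := single_add (hQs q hq) ih
          rw [add_comm] at e3
          have e4 := trans' e1 e3
          convert e4 using 1
          refine Prod.ext (by simp) ?_
          simp only [Prod.snd_add, succ_nsmul]
          abel
      rw [← zmultiples_eq_line hQ hq hqn] at hq'
      obtain ⟨k, -, rfl⟩ := (mem_zmultiples_iff p).1 hq'
      exact e2 k
    have hpar : ∀ h v, s.r x (h, v) → h = x.1 ∨ h = x.1 + 2 := by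
      intro h v hh
      have h3 := N_coset hN hh
      change x.1 ∈ Z2 ↔ h ∈ Z2 at h3
      rw [mem_Z2, mem_Z2] at h3
      revert h3
      generalize x.1 = b
      clear hh
      revert h b
      decide
    obtain ⟨a, ha⟩ := h2 x hx q0 hq0
    obtain ⟨b, hb⟩ := h2 x hx (q0 + q0) (add_mem hq0 hq0)
    rcases hpar _ _ ha with rfl | rfl
    · refine key q0 hq0 hq0n x (rfl' x) ?_
      convert ha using 1
      exact Prod.ext (by simp) (by simp)
    · rcases hpar _ _ hb with rfl | rfl
      · refine key (q0 + q0) (add_mem hq0 hq0) (fun h => hq0n ((two_smul_eq_zero p).1 h))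
          x (rfl' x) ?_
        convert hb using 1
        exact Prod.ext (by simp) (by simp)
      · refine key q0 hq0 hq0n _ ha ?_
        convert hb using 1
        exact Prod.ext (by simp) (by simp [add_assoc])
  have hVc : ∀ v ∉ Q, ∀ y, s.r (0, v) y ↔ y.1 = 0 ∧ y.2 - v ∈ Q := by
    intro v hv y
    constructor
    · intro hy
      exact ⟨(hV _ _ hy ⟨rfl, trivial⟩).1, hUx _ _ hy⟩
    · rintro ⟨h3, h4⟩
      have := hQi (0, v) hv _ h4
      convert this using 1
      exact Prod.ext (by simp [h3]) (by simp)
  have hzr : ∀ h v, v ∉ Q → s.r (h, 0) (h + 2, 0) → s.r (h, v) (h + 2, v) := by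
    intro h v hv hh
    by_contra hc
    have hcl : ∀ y, s.r (h, v) y ↔ y.1 = h ∧ y.2 - v ∈ Q := by
      intro y
      constructor
      · intro hy
        have h4 := hUx _ _ hy
        refine ⟨?_, h4⟩
        by_contra hn
        have h3 := N_coset hN hy
        change h ∈ Z2 ↔ y.1 ∈ Z2 at h3
        have h5 : y.1 = h + 2 := by
          rw [mem_Z2, mem_Z2] at h3
          revert h3 hn
          generalize y.1 = b
          clear hy hc hh h4
          revert h b
          decide
        have hyQ : y.2 ∉ Q := fun h6 => hv (by
          have := sub_mem h6 h4
          rwa [sub_sub_cancel] at this)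
        have h6 := hQi y hyQ _ (neg_mem h4)
        apply hc
        have h7 := trans' hy h6
        convert h7 using 1
        exact Prod.ext (by simp [h5]) (by simp)
      · rintro ⟨h3, h4⟩
        have := hQi (h, v) hv _ h4
        convert this using 1
        exact Prod.ext (by simp [h3]) (by simp)
    have hI : s.Inv {((h, 0) : ZMod 4 × V)} := by
      convert ((cl_inv (s := s) (h, v)).sub (cl_inv (s := s) (0, v))).inter hHs using 1
      ext ⟨a, u⟩
      constructor
      · rintro ⟨⟩
        exact ⟨⟨(h, v), rfl' _, (0, v), rfl' _, by simp⟩, trivial, rfl⟩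
      · rintro ⟨⟨y, hy, y', hy', h3⟩, -, h4⟩
        have h4' : u = 0 := h4
        subst h4'
        have h3' : y - y' = (a, 0) := h3
        have h5 : y.1 - y'.1 = a := congrArg Prod.fst h3'
        rw [((hcl y).1 hy).1, ((hVc v hv y').1 hy').1, sub_zero] at h5
        rw [h5]
        rfl
    have h3 : ((h + 2, 0) : ZMod 4 × V) = (h, 0) := hI _ _ hh rfl
    exact add_z_ne (h, (0 : V)) (by rw [Prod.mk_add_mk, add_zero]; exact h3)
  refine Or.inr (Or.inl ⟨(⊥ : AddSubgroup (ZMod 4)).prod ⊤, (⊤ : AddSubgroup (ZMod 4)).prod ⊥,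
    V_ne_bot (exists_ne_zero p), HQ_ne_bot, hV, hHs, ?_, ?_, ?_⟩)
  · rw [eq_bot_iff]
    rintro ⟨a, v⟩ ⟨⟨ha, -⟩, ⟨-, hv⟩⟩
    exact Prod.ext ha hv
  · rw [eq_top_iff]
    rintro ⟨a, v⟩ -
    have : ((a, v) : ZMod 4 × V) = (0, v) + (a, 0) := by simp
    rw [this]
    exact add_mem (AddSubgroup.mem_sup_left ⟨rfl, trivial⟩)
      (AddSubgroup.mem_sup_right ⟨trivial, rfl⟩)
  · rintro ⟨a, v⟩ ⟨ha, -⟩ ⟨a', v'⟩ ⟨ha', -⟩ ⟨h, u⟩ ⟨-, hu⟩ ⟨h', u'⟩ ⟨-, hu'⟩ hv hh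
    have e1 : a = 0 := ha
    have e2 : a' = 0 := ha'
    have e3 : u = 0 := hu
    have e4 : u' = 0 := hu'
    subst e1 e2 e3 e4
    by_cases hvQ : v ∈ Q
    · have e5 : ((0, v') : ZMod 4 × V) = (0, v) := hQs v hvQ _ _ hv rfl
      rw [e5]
      exact single_add (hQs v hvQ) hh
    · have e5 := hQi (h, v) hvQ _ (hUx _ _ hv)
      have e6 : ((h, v) : ZMod 4 × V) + (0, (0, v').2 - (0, v).2) = (h, v') :=
        Prod.ext (by simp) (by simp)
      have e7 : v' ∉ Q := fun h6 => hvQ (by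
        have := sub_mem h6 (hUx _ _ hv)
        rwa [sub_sub_cancel] at this)
      rw [e6] at e5
      have e8 : s.r (h, v') (h', v') := by
        have e9 := sub_mem_C2 hz hh rfl (zero_mem _)
        rcases e9.1 with e10 | e10
        · have e11 : h' - h = 0 := e10
          rw [sub_eq_zero.1 e11]
          exact rfl' _
        · have e11 : h' - h = 2 := e10
          have e12 : h' = h + 2 := by rw [← e11]; ring
          subst e12
          exact hzr h v' e7 hh
      have := trans' e5 e8
      convert this using 1 <;> simp

end Sch

namespace Sch
open Plane

/-- Images of classes modulo closed subgroups of prime power index have the size of a power of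
that prime. -/
def MinP {Γ : Type*} [AddCommGroup Γ] [Fintype Γ] (s : Sch Γ) : Prop :=
  ∀ U : AddSubgroup Γ, s.Isub U → ∀ q k : ℕ, q.Prime → U.index = q ^ k → ∀ x, ∃ j,
    (QuotientAddGroup.mk '' s.cl x : Set (Γ ⧸ U)).ncard = q ^ j

theorem MinP.map {Γ Γ' : Type*} [AddCommGroup Γ] [Fintype Γ] [AddCommGroup Γ'] {s : Sch Γ}
    (hs : s.MinP) (f : Γ →+ Γ') (hf : Function.Surjective f) (hU : s.Isub f.ker) {q k : ℕ}
    (hq : q.Prime) (hc : Nat.card Γ' = q ^ k) (x : Γ) : ∃ j, (f '' s.cl x).ncard = q ^ j := by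
  have hi : f.ker.index = q ^ k := by
    rw [AddSubgroup.index_ker, AddMonoidHom.range_eq_top.2 hf, AddSubgroup.card_top, hc]
  obtain ⟨j, hj⟩ := hs f.ker hU q k hq hi x
  refine ⟨j, ?_⟩
  rw [← hj, ← Set.ncard_image_of_injective _ (QuotientAddGroup.kerLift_injective f),
    Set.image_image]
  rfl

variable {p : ℕ} {V : Type*} [AddCommGroup V] [Fintype V] [hP : Plane p V]
variable {s : Sch (ZMod 4 × V)} {Q : AddSubgroup V}

theorem MinP.N_of_V (hs : s.MinP)
    (hV : s.Isub ((⊥ : AddSubgroup (ZMod 4)).prod (⊤ : AddSubgroup V))) :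
    s.Isub (Z2.prod (⊤ : AddSubgroup V)) := by
  have hker : (AddMonoidHom.fst (ZMod 4) V).ker = (⊥ : AddSubgroup (ZMod 4)).prod ⊤ := by
    ext x
    exact ⟨fun h => ⟨h, trivial⟩, fun h => h.1⟩
  obtain ⟨j, hj⟩ := hs.map (AddMonoidHom.fst (ZMod 4) V) Prod.fst_surjective (hker ▸ hV)
    Nat.prime_two (k := 2) (by simp) (2, 0)
  set I := AddMonoidHom.fst (ZMod 4) V '' s.cl (2, 0) with hI
  have h2 : (2 : ZMod 4) ∈ I := ⟨_, rfl' _, rfl⟩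
  have h0 : (0 : ZMod 4) ∉ I := by
    rintro ⟨y, hy, h⟩
    have h3 : ((2, 0) : ZMod 4 × V).1 = 0 := (hV _ _ (symm' hy) ⟨h, trivial⟩).1
    have h4 : (2 : ZMod 4) ≠ 0 := by decide
    exact h4 h3
  have hneg : ∀ a ∈ I, -a ∈ I := by
    rintro _ ⟨y, hy, rfl⟩
    refine ⟨-y, ?_, rfl⟩
    have := s.neg _ _ hy
    rwa [neg_z] at this
  have h1 : (1 : ZMod 4) ∉ I := by
    intro h
    have h3 : (3 : ZMod 4) ∈ I := hneg 1 h
    have : I = ({1, 2, 3} : Finset (ZMod 4)) := by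
      ext a
      rcases zmod4_cases a with rfl | rfl | rfl | rfl
      · exact ⟨fun h => absurd h h0, fun h => absurd h (by decide)⟩
      · exact ⟨fun _ => by decide, fun _ => h2⟩
      · exact ⟨fun _ => by decide, fun _ => h⟩
      · exact ⟨fun _ => by decide, fun _ => h3⟩
    rw [this, Set.ncard_coe_finset] at hj
    have h4 : 3 = 2 ^ j := hj
    rcases j with _ | _ | j
    · omega
    · omega
    · rw [pow_add] at h4; omega
  have h3 : (3 : ZMod 4) ∉ I := fun h => h1 (hneg 3 h)
  have hz2 : ∀ y, s.r (2, 0) y → y.1 = 2 := by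
    intro y hy
    have : y.1 ∈ I := ⟨y, hy, rfl⟩
    rcases zmod4_cases y.1 with h | h | h | h
    · exact absurd (h ▸ this) h0
    · exact h
    · exact absurd (h ▸ this) h1
    · exact absurd (h ▸ this) h3
  have := hV.union (hV.add (cl_inv (s := s) (2, 0)))
  unfold Isub
  convert this using 1
  ext ⟨a, v⟩
  constructor
  · rintro ⟨h | h, -⟩
    · have h' : a = 0 := h
      exact Or.inl ⟨h', trivial⟩
    · have h' : a = 2 := h
      subst h'
      exact Or.inr ⟨(0, v), ⟨rfl, trivial⟩, (2, 0), rfl' _, by simp⟩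
  · rintro (h | ⟨⟨b, u⟩, ⟨hb, -⟩, y, hy, h⟩)
    · exact ⟨Or.inl h.1, trivial⟩
    · have hb' : b = 0 := hb
      have h' : (b, u) + y = (a, v) := h
      have h4 : b + y.1 = a := congrArg Prod.fst h'
      rw [hb', zero_add, hz2 y hy] at h4
      exact ⟨Or.inr h4.symm, trivial⟩

theorem MinP.line_coset (hs : s.MinP) (hQ : Nat.card Q = p)
    (hU : s.Isub ((⊤ : AddSubgroup (ZMod 4)).prod Q)) :
    ∀ x y, s.r x y → y.2 - x.2 ∈ Q := by
  intro x y hxy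
  by_cases hx : x.2 ∈ Q
  · exact sub_mem (hU _ _ hxy ⟨trivial, hx⟩).2 hx
  set f : ZMod 4 × V →+ V ⧸ Q := (QuotientAddGroup.mk' Q).comp (AddMonoidHom.snd _ _) with hf
  have hfm : ∀ y, f y = 0 ↔ y.2 ∈ Q := fun y => QuotientAddGroup.eq_zero_iff y.2
  have hker : f.ker = (⊤ : AddSubgroup (ZMod 4)).prod Q := by
    ext y
    rw [AddMonoidHom.mem_ker, hfm, top_prod_mem]
  have hcard : Nat.card (V ⧸ Q) = p ^ 1 := by
    have h1 := AddSubgroup.card_eq_card_quotient_mul_card_addSubgroup Q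
    rw [hQ, card_eq p, sq] at h1
    rw [pow_one]
    exact (Nat.eq_of_mul_eq_mul_right hP.prime.pos h1).symm
  obtain ⟨j, hj⟩ := hs.map f
    ((QuotientAddGroup.mk'_surjective Q).comp Prod.snd_surjective) (hker ▸ hU)
    hP.prime hcard x
  have h0 : (0 : V ⧸ Q) ∉ f '' s.cl x := by
    rintro ⟨y, hy, h⟩
    rw [hfm] at h
    exact hx (hU _ _ (symm' hy) ⟨trivial, h⟩).2
  have : Finite (V ⧸ Q) := Nat.finite_of_card_ne_zero (by rw [hcard]; simp [hP.prime.ne_zero])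
  have hlt : (f '' s.cl x).ncard < p ^ 1 := by
    rw [← hcard, ← Set.ncard_univ]
    refine Set.ncard_lt_ncard ⟨Set.subset_univ _, fun h => h0 (h trivial)⟩ (Set.toFinite _)
  rw [hj] at hlt
  have hj0 : j = 0 := by
    have := (Nat.pow_lt_pow_iff_right hP.prime.one_lt).1 hlt
    omega
  rw [hj0, pow_zero, Set.ncard_eq_one] at hj
  obtain ⟨a, ha⟩ := hj
  have h1 : f x = a := by
    have : f x ∈ f '' s.cl x := ⟨x, rfl' x, rfl⟩
    rwa [ha] at this
  have h2 : f y = a := by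
    have : f y ∈ f '' s.cl x := ⟨y, hxy, rfl⟩
    rwa [ha] at this
  have h3 : f (y - x) = 0 := by rw [map_sub, h1, h2, sub_self]
  exact (hfm _).1 h3

/-- The elements of `V` whose fibre is a union of classes form a subgroup. -/
theorem exists_fibres (hHs : s.Isub ((⊤ : AddSubgroup (ZMod 4)).prod (⊥ : AddSubgroup V))) :
    ∃ T : AddSubgroup V, ∀ v, v ∈ T ↔ ∀ x y, s.r x y → x.2 = v → y.2 = v :=
  ⟨{carrier := {v | s.Inv {g | g.2 = v}}
    zero_mem' := fun x y hxy hx => (hHs _ _ hxy ⟨trivial, hx⟩).2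
    add_mem' := by
      intro a b ha hb
      have := Inv.add ha hb
      change s.Inv {g : ZMod 4 × V | g.2 = a + b}
      convert this using 1
      ext g
      constructor
      · intro h
        have h' : g.2 = a + b := h
        exact ⟨(g.1, a), rfl, (0, b), rfl, Prod.ext (add_zero _) h'.symm⟩
      · rintro ⟨x, hx, y, hy, rfl⟩
        have hx' : x.2 = a := hx
        have hy' : y.2 = b := hy
        exact congrArg₂ (· + ·) hx' hy'
    neg_mem' := by
      intro a ha
      have := Inv.neg ha
      change s.Inv {g : ZMod 4 × V | g.2 = -a}
      convert this using 1
      ext g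
      exact neg_eq_iff_eq_neg.symm }, fun _ => Iff.rfl⟩

theorem MinP.concl_H (hs : s.MinP)
    (hHs : s.Isub ((⊤ : AddSubgroup (ZMod 4)).prod (⊥ : AddSubgroup V))) : Concl p s := by
  obtain ⟨T, hT⟩ := exists_fibres hHs
  have hU : s.Isub ((⊤ : AddSubgroup (ZMod 4)).prod T) := by
    intro x y hxy hx
    refine ⟨trivial, ?_⟩
    have hxT : x.2 ∈ T := hx.2
    have h := (hT x.2).1 hxT x y hxy rfl
    change y.2 ∈ T
    rwa [h]
  have hker : (AddMonoidHom.snd (ZMod 4) V).ker = (⊤ : AddSubgroup (ZMod 4)).prod ⊥ := by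
    ext x
    exact ⟨fun h => ⟨trivial, h⟩, fun h => h.2⟩
  set E : ZMod 4 × V → Set V := fun x => AddMonoidHom.snd (ZMod 4) V '' s.cl x with hE
  have hpow : ∀ x, ∃ j, (E x).ncard = p ^ j := fun x =>
    hs.map (AddMonoidHom.snd (ZMod 4) V) Prod.snd_surjective (hker ▸ hHs) hP.prime (card_eq p) x
  have hEE : ∀ x y, s.r x y → ∀ z, z.2 = y.2 → E z = E x := by
    have key : ∀ x z : ZMod 4 × V, z.2 ∈ E x → E z ⊆ E x := by
      rintro x z ⟨y, hy, hyz⟩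
      have h1 : s.Inv (s.cl x + ((⊤ : AddSubgroup (ZMod 4)).prod (⊥ : AddSubgroup V) :
        AddSubgroup (ZMod 4 × V))) := (cl_inv (s := s) x).add hHs
      rintro _ ⟨u, hu, rfl⟩
      obtain ⟨t, ht, l, hl, h⟩ := h1 z u hu ⟨y, hy, z - y, ⟨trivial, sub_eq_zero.2 hyz.symm⟩, by simp⟩
      refine ⟨t, ht, ?_⟩
      have hl0 : l.2 = 0 := hl.2
      have h' : t + l = u := h
      change t.2 = u.2
      rw [← h', Prod.snd_add, hl0, add_zero]
    intro x y hxy z hz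
    refine (key x z ⟨y, hxy, hz.symm⟩).antisymm (key z x ?_)
    have h1 : s.Inv (s.cl z + ((⊤ : AddSubgroup (ZMod 4)).prod (⊥ : AddSubgroup V) :
        AddSubgroup (ZMod 4 × V))) := (cl_inv (s := s) z).add hHs
    obtain ⟨t, ht, l, hl, h⟩ := h1 y x (symm' hxy)
      ⟨z, rfl' z, y - z, ⟨trivial, sub_eq_zero.2 hz.symm⟩, by simp⟩
    refine ⟨t, ht, ?_⟩
    have hl0 : l.2 = 0 := hl.2
    have h' : t + l = x := h
    change t.2 = x.2
    rw [← h', Prod.snd_add, hl0, add_zero]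
  have hEs : ∀ x : ZMod 4 × V, x.2 ∈ E x := fun x => ⟨x, rfl' x, rfl⟩
  have hE1 : ∀ x : ZMod 4 × V, (E x).ncard = 1 → x.2 ∈ T := by
    intro x hx
    obtain ⟨a, ha⟩ := Set.ncard_eq_one.1 hx
    rw [hT]
    intro y z hyz hy
    have h1 : z.2 ∈ E y := ⟨z, hyz, rfl⟩
    rw [hEE x x (rfl' x) y hy] at h1
    have h2 := hEs x
    rw [ha] at h1 h2
    exact (Set.mem_singleton_iff.1 h1).trans (Set.mem_singleton_iff.1 h2).symm
  have hE0 : ∀ x : ZMod 4 × V, x.2 ≠ 0 → (0 : V) ∉ E x := by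
    rintro x hx ⟨y, hy, h⟩
    exact hx (hHs _ _ (symm' hy) ⟨trivial, h⟩).2
  have hEp : ∀ x : ZMod 4 × V, x.2 ∉ T → (E x).ncard = p := by
    intro x hx
    obtain ⟨j, hj⟩ := hpow x
    have hlt : (E x).ncard < p ^ 2 := by
      rw [← card_eq p (V := V), ← Set.ncard_univ]
      refine Set.ncard_lt_ncard ⟨Set.subset_univ _, fun h => hE0 x ?_ (h trivial)⟩ (Set.toFinite _)
      exact fun h0 => hx (h0 ▸ zero_mem _)
    have hj1 : j ≠ 0 := by
      rintro rfl
      exact hx (hE1 x (by simpa using hj))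
    rw [hj] at hlt
    have := (Nat.pow_lt_pow_iff_right hP.prime.one_lt).1 hlt
    have hj' : j = 1 := by omega
    rw [hj, hj', pow_one]
  rcases cases_subgroup p T with hT0 | hTQ | hT1
  · exfalso
    classical
    have hfib : ∀ v : V, v ≠ 0 →
        (Finset.univ.filter fun u : V => u ≠ 0 ∧ E (0, u) = E (0, v)).card = p := by
      intro v hv
      rw [← hEp (0, v) (by rw [hT0]; exact hv), ← Set.ncard_coe_finset]
      congr 1
      ext u
      rw [Finset.coe_filter]
      constructor
      · rintro ⟨-, -, h⟩
        rw [← h]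
        exact hEs (0, u)
      · intro hu
        refine ⟨Finset.mem_univ _, fun h => hE0 (0, v) hv (h ▸ hu), ?_⟩
        obtain ⟨y, hy, h⟩ := hu
        exact hEE _ y hy _ h.symm
    have h1 := Finset.card_eq_sum_card_image (fun u : V => E (0, u)) (Finset.univ.erase 0)
    have h2 : p ∣ ∑ b ∈ (Finset.univ.erase (0 : V)).image (fun u : V => E (0, u)),
        ((Finset.univ.erase (0 : V)).filter fun u => E (0, u) = b).card := by
      refine Finset.dvd_sum fun b hb => ?_
      obtain ⟨v, hv, rfl⟩ := Finset.mem_image.1 hb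
      have h3 := hfib v (Finset.ne_of_mem_erase hv)
      have h4 : ((Finset.univ.erase (0 : V)).filter fun u => E (0, u) = E (0, v)) =
          Finset.univ.filter fun u : V => u ≠ 0 ∧ E (0, u) = E (0, v) := by
        ext u
        simp
      rw [h4, h3]
    rw [← h1, Finset.card_erase_of_mem (Finset.mem_univ _), Finset.card_univ, hP.card] at h2
    have h5 : p ∣ p ^ 2 := dvd_pow_self p two_ne_zero
    have h6 := Nat.dvd_sub h5 h2
    have h7 : p ^ 2 - (p ^ 2 - 1) = 1 := by
      have : 0 < p ^ 2 := pow_pos hP.prime.pos 2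
      omega
    rw [h7] at h6
    exact hP.prime.one_lt.ne' (Nat.dvd_one.1 h6)
  · have hUx := hs.line_coset hTQ hU
    have h1 : ∀ x y : ZMod 4 × V, x.2 ∈ T → s.r x y → y.2 = x.2 :=
      fun x y hx hxy => (hT x.2).1 hx x y hxy rfl
    have h2 : ∀ x : ZMod 4 × V, x.2 ∉ T → ∀ q ∈ T, ∃ h, s.r x (h, x.2 + q) := by
      intro x hx q hq
      have h3 : E x = {v | v - x.2 ∈ T} := by
        refine Set.eq_of_subset_of_ncard_le ?_ ?_ (Set.toFinite _)
        · rintro _ ⟨y, hy, rfl⟩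
          exact hUx x y hy
        · rw [hEp x hx, card_coset hTQ]
      have h4 : x.2 + q ∈ E x := by
        rw [h3, Set.mem_ofPred_eq, add_sub_cancel_left]
        exact hq
      obtain ⟨y, hy, h⟩ := h4
      refine ⟨y.1, ?_⟩
      have h' : y.2 = x.2 + q := h
      rw [← h']
      exact hy
    by_cases hz : s.Inv {((2, 0) : ZMod 4 × V)}
    · by_cases hall : ∀ x : ZMod 4 × V, x.2 ∉ T → s.r x (x + (2, 0))
      · exact case_a_z_inv hTQ hU hHs h1 hz hall
      · push Not at hall
        obtain ⟨x, hx, hxn⟩ := hall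
        exact case_a_z hTQ hHs hUx h1 h2 hz hx hxn
    · exact case_a_not_z hTQ hU hHs hUx h1 h2 hs.N_of_V hz
  · exact case_a_triv hHs fun x y hxy => (hT x.2).1 (hT1 ▸ trivial) x y hxy rfl

theorem MinP.concl (hs : s.MinP) : Concl p s := by
  by_cases hH : ∀ W, s.Isub W → ((1, 0) : ZMod 4 × V) ∈ W → W = ⊤
  · by_cases hV : ∀ W, s.Isub W → (∀ v : V, (0, v) ∈ W) → W = ⊤
    · exact primitive hH hV
    · push Not at hV
      obtain ⟨W, hW, hv, hWt⟩ := hV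
      have hev : ∀ x ∈ W, x.1 ∈ Z2 := by
        intro x hx
        by_contra hc
        exact hWt (eq_top_of (odd_mem (p := p) (v := x.2) hx (not_Z2 hc)) hv)
      refine index_two ?_ hH
      by_cases hz : ((2, 0) : ZMod 4 × V) ∈ W
      · have : W = Z2.prod ⊤ := by
          ext ⟨a, v⟩
          refine ⟨fun h => ⟨hev _ h, trivial⟩, fun h => (mem_sub p).2 ⟨?_, hv v⟩⟩
          rcases h.1 with h | h
          · have h' : a = 0 := h
            subst h'
            exact zero_mem _
          · have h' : a = 2 := h
            subst h'
            exact hz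
        rwa [← this]
      · refine hs.N_of_V ?_
        have : W = (⊥ : AddSubgroup (ZMod 4)).prod ⊤ := by
          ext ⟨a, v⟩
          refine ⟨fun h => ⟨fst_zero_of_z p hz _ h, trivial⟩, fun h => ?_⟩
          have h' : a = 0 := h.1
          subst h'
          exact hv v
        rwa [← this]
  · push Not at hH
    obtain ⟨W, hW, h1, hWt⟩ := hH
    by_cases hHs : s.Isub ((⊤ : AddSubgroup (ZMod 4)).prod (⊥ : AddSubgroup V))
    · exact hs.concl_H hHs
    · have hWeq : W = (⊤ : AddSubgroup (ZMod 4)).prod (vp W) := by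
        ext ⟨a, v⟩
        rw [mem_sub p]
        exact ⟨fun h => ⟨trivial, h.2⟩, fun h => ⟨H_mem h1 a, h.2⟩⟩
      rw [hWeq] at hW
      have hQ : Nat.card (vp W) = p := by
        rcases cases_subgroup p (vp W) with h | h | h
        · rw [h] at hW
          exact absurd hW hHs
        · exact h
        · exact absurd (eq_top_of h1 fun v => by rw [← mem_vp, h]; trivial) hWt
      have hUx := hs.line_coset hQ hW
      by_cases hz : s.Inv {((2, 0) : ZMod 4 × V)}
      · exact case_b hQ hW hUx hz hHs
      · refine case_c hQ hW hUx fun W' hW' h2 => ?_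
        by_contra hne
        obtain ⟨x, hx, hx0⟩ : ∃ x ∈ W', x ≠ 0 := by
          by_contra! h
          exact hne ((AddSubgroup.eq_bot_iff_forall _).2 h)
        by_cases h1' : ((1, 0) : ZMod 4 × V) ∈ W'
        · exact hHs (H_sub_of p hW' h2 (Or.inl rfl) h1')
        · exact hz (z_of_sub p hW' h2 h1' hx hx0)

end Sch

section Perm

open MulAction

/-- The 2-closure of a permutation group. -/
def closure2 {Ω : Type*} (K : Subgroup (Equiv.Perm Ω)) : Subgroup (Equiv.Perm Ω) where
  carrier := {f | ∀ a b, ∃ k ∈ K, k a = f a ∧ k b = f b}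
  one_mem' := fun _ _ => ⟨1, K.one_mem, rfl, rfl⟩
  mul_mem' := by
    intro f g hf hg a b
    obtain ⟨k, hk, h1, h2⟩ := hg a b
    obtain ⟨l, hl, h3, h4⟩ := hf (g a) (g b)
    exact ⟨l * k, K.mul_mem hl hk, by simp [h1, h3], by simp [h2, h4]⟩
  inv_mem' := by
    intro f hf a b
    obtain ⟨k, hk, h1, h2⟩ := hf (f⁻¹ a) (f⁻¹ b)
    refine ⟨k⁻¹, K.inv_mem hk, ?_, ?_⟩
    · rw [Equiv.Perm.inv_eq_iff_eq, h1]; simp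
    · rw [Equiv.Perm.inv_eq_iff_eq, h2]; simp

theorem le_closure2 {Ω : Type*} (K : Subgroup (Equiv.Perm Ω)) : K ≤ closure2 K :=
  fun f hf _ _ => ⟨f, hf, rfl, rfl⟩

theorem closure2_mono {Ω : Type*} {K L : Subgroup (Equiv.Perm Ω)} (h : K ≤ L) :
    closure2 K ≤ closure2 L := by
  intro f hf a b
  obtain ⟨k, hk, hh⟩ := hf a b
  exact ⟨k, h hk, hh⟩

theorem closure2_closure2 {Ω : Type*} (K : Subgroup (Equiv.Perm Ω)) :
    closure2 (closure2 K) = closure2 K := by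
  refine le_antisymm (fun f hf a b => ?_) (le_closure2 _)
  obtain ⟨k, hk, h1, h2⟩ := hf a b
  obtain ⟨l, hl, h3, h4⟩ := hk a b
  exact ⟨l, hl, h3.trans h1, h4.trans h2⟩

variable {G : Type*} [CommGroup G]

theorem mulRight_mem {K : Subgroup (Equiv.Perm G)} (hK : InSup K) (g : G) :
    Equiv.mulRight g ∈ K := hK ⟨g, rfl⟩

theorem mem_VBasic_class {K : Subgroup (Equiv.Perm G)} {x y : G} :
    (∃ X ∈ VBasic K, x ∈ X ∧ y ∈ X) ↔ ∃ k ∈ K, k 1 = 1 ∧ k x = y := by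
  constructor
  · rintro ⟨_, ⟨g, rfl⟩, hx, hy⟩
    have h : y ∈ orbit (stabilizer K (1 : G)) x := by
      rw [orbit_eq_iff.2 hx]
      exact hy
    obtain ⟨⟨⟨k, hk⟩, hk1⟩, rfl⟩ := h
    exact ⟨k, hk, hk1, rfl⟩
  · rintro ⟨k, hk, h1, rfl⟩
    exact ⟨_, ⟨x, rfl⟩, mem_orbit_self _, ⟨⟨⟨k, hk⟩, h1⟩, rfl⟩⟩

theorem rel_iff_orbital {K : Subgroup (Equiv.Perm G)} (hK : InSup K) {a b c d : G} :
    (∃ X ∈ VBasic K, (a, b) ∈ Rel X ∧ (c, d) ∈ Rel X) ↔ ∃ k ∈ K, k a = c ∧ k b = d := by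
  change (∃ X ∈ VBasic K, b * a⁻¹ ∈ X ∧ d * c⁻¹ ∈ X) ↔ _
  rw [mem_VBasic_class]
  constructor
  · rintro ⟨k, hk, h1, h2⟩
    refine ⟨Equiv.mulRight c * k * Equiv.mulRight a⁻¹,
      K.mul_mem (K.mul_mem (mulRight_mem hK _) hk) (mulRight_mem hK _), ?_, ?_⟩
    · simp [h1]
    · simp [h2]
  · rintro ⟨k, hk, h1, h2⟩
    refine ⟨Equiv.mulRight c⁻¹ * k * Equiv.mulRight a,
      K.mul_mem (K.mul_mem (mulRight_mem hK _) hk) (mulRight_mem hK _), ?_, ?_⟩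
    · simp [h1]
    · simp [h2]

theorem exists_rel (K : Subgroup (Equiv.Perm G)) (a b : G) : ∃ X ∈ VBasic K, (a, b) ∈ Rel X :=
  ⟨_, ⟨b * a⁻¹, rfl⟩, mem_orbit_self _⟩

theorem eq_of_mem_VBasic {K : Subgroup (Equiv.Perm G)} {X Y : Set G} (hX : X ∈ VBasic K)
    (hY : Y ∈ VBasic K) {x : G} (h1 : x ∈ X) (h2 : x ∈ Y) : X = Y := by
  obtain ⟨g, rfl⟩ := hX
  obtain ⟨h, rfl⟩ := hY
  dsimp only at h1 h2 ⊢
  rw [← orbit_eq_iff.2 h1, ← orbit_eq_iff.2 h2]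

theorem preserves_iff {K : Subgroup (Equiv.Perm G)} (hK : InSup K) (f : Equiv.Perm G) :
    (∀ X ∈ VBasic K, Prod.map (⇑f) (⇑f) '' Rel X = Rel X) ↔ f ∈ closure2 K := by
  constructor
  · intro h a b
    obtain ⟨X, hX, hab⟩ := exists_rel K a b
    refine (rel_iff_orbital hK).1 ⟨X, hX, hab, ?_⟩
    rw [← h X hX]
    exact ⟨_, hab, rfl⟩
  · intro h X hX
    have key : ∀ a b, (a, b) ∈ Rel X ↔ (f a, f b) ∈ Rel X := by
      intro a b
      obtain ⟨Y, hY, h1, h2⟩ := (rel_iff_orbital hK).2 (h a b)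
      constructor
      · intro h3
        rwa [eq_of_mem_VBasic hX hY h3 h1]
      · intro h3
        rwa [eq_of_mem_VBasic hX hY h3 h2]
    ext ⟨c, d⟩
    constructor
    · rintro ⟨⟨a, b⟩, hab, hh⟩
      rw [← hh]
      exact (key a b).1 hab
    · intro hcd
      refine ⟨(f.symm c, f.symm d), (key _ _).2 (by simpa using hcd), by simp⟩

variable [Finite G]

theorem inSup2_iff {K : Subgroup (Equiv.Perm G)} :
    InSup2 K ↔ InSup K ∧ closure2 K = K := by
  refine and_congr_right fun hK => ?_
  have : {f : Equiv.Perm G | ∀ X ∈ VBasic K, Prod.map (⇑f) (⇑f) '' Rel X = Rel X} =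
      (closure2 K : Set (Equiv.Perm G)) := Set.ext (preserves_iff hK)
  rw [this, eq_comm, SetLike.coe_set_eq]

theorem InSup2Min.exists_agree {K : Subgroup (Equiv.Perm G)} (hK : InSup2Min K)
    {K' : Subgroup (Equiv.Perm G)} (h1 : InSup K') (h2 : GComplete K' K)
    {k : Equiv.Perm G} (hk : k ∈ K) (a b : G) : ∃ k' ∈ K', k' a = k a ∧ k' b = k b := by
  have hKc := (inSup2_iff.1 hK.1).2
  have := hK.2 (closure2 K') (inSup2_iff.2 ⟨h1.trans (le_closure2 _), closure2_closure2 _⟩)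
    ⟨(closure2_mono h2.1).trans_eq hKc, fun R hR hreg hiso => by
      obtain ⟨c, hc, h⟩ := h2.2 R hR hreg hiso
      exact ⟨c, hc, fun r hr => le_closure2 _ (h r hr)⟩⟩
  rw [← this] at hk
  exact hk a b

/-- The action of a permutation group on an invariant system of cosets. -/
def cosetHom (K : Subgroup (Equiv.Perm G)) (U : Subgroup G)
    (h : ∀ k ∈ K, ∀ a b : G, a⁻¹ * b ∈ U → (k a)⁻¹ * k b ∈ U) : K →* Equiv.Perm (G ⧸ U) :=
  MonoidHom.toHomPerm
    { toFun := fun k => Quotient.map' k.1 fun a b hab => by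
        rw [QuotientGroup.leftRel_apply] at *
        exact h k.1 k.2 a b hab
      map_one' := by
        funext x
        induction x using QuotientGroup.induction_on
        rfl
      map_mul' := by
        intro k l
        funext x
        induction x using QuotientGroup.induction_on
        rfl }

theorem card_eq_of_regular {Ω : Type*} {P : Subgroup (Equiv.Perm Ω)} (ω : Ω)
    (hc : ∀ a ∈ P, ∀ b ∈ P, a * b = b * a) (ht : ∀ x, ∃ g ∈ P, g ω = x) :
    Nat.card P = Nat.card Ω := by
  refine Nat.card_congr (Equiv.ofBijective (fun g : P => g.1 ω) ⟨?_, ?_⟩)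
  · rintro ⟨g, hg⟩ ⟨h, hh⟩ hgh
    have hgh' : g ω = h ω := hgh
    ext x
    obtain ⟨c, hcP, rfl⟩ := ht x
    have h1 := congrArg (fun f : Equiv.Perm Ω => f ω) (hc g hg c hcP)
    have h2 := congrArg (fun f : Equiv.Perm Ω => f ω) (hc h hh c hcP)
    simp only [Equiv.Perm.mul_apply] at h1 h2
    change g (c ω) = h (c ω)
    rw [h1, h2, hgh']
  · intro x
    obtain ⟨g, hg, h⟩ := ht x
    exact ⟨⟨g, hg⟩, h⟩

/-- Images of regular abelian subgroups on a system of `q ^ n` cosets are `q`-groups. -/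
theorem isPGroup_image {K : Subgroup (Equiv.Perm G)} {U : Subgroup G}
    (h : ∀ k ∈ K, ∀ a b : G, a⁻¹ * b ∈ U → (k a)⁻¹ * k b ∈ U) {q n : ℕ}
    (hU : U.index = q ^ n) {R : Subgroup (Equiv.Perm G)} (hR : R ≤ K)
    (ht : ∀ g : G, ∃ r ∈ R, r 1 = g) (hc : ∀ a ∈ R, ∀ b ∈ R, a * b = b * a) :
    IsPGroup q ((R.subgroupOf K).map (cosetHom K U h).rangeRestrict) := by
  have h1 : Nat.card ((R.subgroupOf K).map (cosetHom K U h)) = Nat.card (G ⧸ U) := by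
    refine card_eq_of_regular (QuotientGroup.mk 1) ?_ ?_
    · rintro _ ⟨a, ha, rfl⟩ _ ⟨b, hb, rfl⟩
      rw [← map_mul, ← map_mul]
      congr 1
      exact Subtype.ext (hc _ ha _ hb)
    · intro x
      induction x using QuotientGroup.induction_on with
      | H g =>
        obtain ⟨r, hr, rfl⟩ := ht g
        exact ⟨_, ⟨⟨r, hR hr⟩, hr, rfl⟩, rfl⟩
  have h2 : IsPGroup q ((R.subgroupOf K).map (cosetHom K U h)) :=
    IsPGroup.of_card (h1.trans hU)
  rintro ⟨x, k, hk, rfl⟩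
  obtain ⟨m, hm⟩ := h2 ⟨cosetHom K U h k, k, hk, rfl⟩
  have hm' : cosetHom K U h k ^ q ^ m = 1 := congrArg Subtype.val hm
  exact ⟨m, Subtype.ext (Subtype.ext hm')⟩

theorem InSup2Min.ncard_image {K : Subgroup (Equiv.Perm G)} (hK : InSup2Min K) {U : Subgroup G}
    (hU : ∀ k ∈ K, k 1 = 1 → ∀ u ∈ U, k u ∈ U) {q n : ℕ} (hq : q.Prime)
    (hn : U.index = q ^ n) (x : G) :
    ∃ j, (QuotientGroup.mk '' {y | ∃ k ∈ K, k 1 = 1 ∧ k x = y} : Set (G ⧸ U)).ncard = q ^ j := by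
  have hKs : InSup K := hK.1.1
  have h : ∀ k ∈ K, ∀ a b : G, a⁻¹ * b ∈ U → (k a)⁻¹ * k b ∈ U := by
    intro k hk a b hab
    have := hU (Equiv.mulRight (k a)⁻¹ * k * Equiv.mulRight a)
      (K.mul_mem (K.mul_mem (mulRight_mem hKs _) hk) (mulRight_mem hKs _)) (by simp) _ hab
    simpa [mul_comm] using this
  set ρ := (cosetHom K U h).rangeRestrict with hρ
  have : Fact q.Prime := ⟨hq⟩
  obtain ⟨T, hT⟩ := (isPGroup_image h hn hKs
    (fun g => ⟨Equiv.mulRight g, ⟨g, rfl⟩, by simp⟩) (by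
      rintro _ ⟨a, rfl⟩ _ ⟨b, rfl⟩
      ext x
      simp [mul_assoc, mul_comm a b])).exists_le_sylow
  set K' : Subgroup (Equiv.Perm G) := ((T : Subgroup _).comap ρ).map K.subtype with hK'
  have hsup : InSup K' := by
    intro f hf
    exact ⟨⟨f, hKs hf⟩, hT ⟨⟨f, hKs hf⟩, hf, rfl⟩, rfl⟩
  have hcomp : GComplete K' K := by
    refine ⟨?_, ?_⟩
    · rintro _ ⟨k, -, rfl⟩
      exact k.2
    · rintro R hR hreg ⟨e⟩
      obtain ⟨S, hS⟩ := (isPGroup_image h hn hR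
        (fun g => by
          obtain ⟨r, hr, -⟩ := hreg 1 g
          exact ⟨r.1, r.2, hr⟩) (by
          intro a ha b hb
          have : (⟨a, ha⟩ * ⟨b, hb⟩ : R) = ⟨b, hb⟩ * ⟨a, ha⟩ :=
            e.injective (by rw [map_mul, map_mul, mul_comm])
          exact congrArg Subtype.val this)).exists_le_sylow
      obtain ⟨m, hm⟩ := MulAction.exists_smul_eq (cosetHom K U h).range S T
      obtain ⟨k, rfl⟩ := (cosetHom K U h).rangeRestrict_surjective m
      refine ⟨k.1, k.2, fun r hr => ?_⟩
      refine ⟨k * ⟨r, hR hr⟩ * k⁻¹, ?_, rfl⟩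
      change ρ (k * ⟨r, hR hr⟩ * k⁻¹) ∈ T
      rw [← hm, map_mul, map_mul, map_inv]
      have : ρ ⟨r, hR hr⟩ ∈ S := hS ⟨⟨r, hR hr⟩, hr, rfl⟩
      exact Subgroup.smul_mem_pointwise_smul _ (MulAut.conj (ρ k)) _ this
  set St : Subgroup K := (T : Subgroup _).comap ρ ⊓ (stabilizer (Equiv.Perm G) (1 : G)).comap
    K.subtype with hSt
  have hP : IsPGroup q (St.map ρ) := T.2.to_le (by
    rintro _ ⟨k, hk, rfl⟩
    exact hk.1)
  obtain ⟨j, hj⟩ := hP.card_orbit (QuotientGroup.mk x : G ⧸ U)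
  refine ⟨j, ?_⟩
  rw [← hj, Nat.card_coe_set_eq]
  congr 2
  ext z
  constructor
  · rintro ⟨_, ⟨k, hk, h1, rfl⟩, rfl⟩
    obtain ⟨_, ⟨k', hk', rfl⟩, h2, h3⟩ := hK.exists_agree hsup hcomp hk 1 x
    refine ⟨⟨ρ k', k', ⟨hk', h2.trans h1⟩, rfl⟩, ?_⟩
    change (QuotientGroup.mk (k'.1 x) : G ⧸ U) = _
    exact congrArg _ h3
  · rintro ⟨⟨_, k, hk, rfl⟩, rfl⟩
    exact ⟨k.1 x, ⟨k.1, k.2, hk.2, rfl⟩, rfl⟩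

end Perm

section

theorem coeff_sumElems {G : Type*} [Group G] [Finite G] (X : Set G) [DecidablePred (· ∈ X)]
    (g : G) : (sumElems X).coeff g = if g ∈ X then 1 else 0 := by
  classical
  rw [sumElems, MonoidAlgebra.coeff_sum, Finsupp.finsetSum_apply]
  simp only [MonoidAlgebra.coeff_single, Finsupp.single_apply]
  rw [Finset.sum_ite_eq']
  simp

namespace SRing

variable {G : Type*} [Group G] [Finite G] (A : SRing G)

/-- Two elements are related if they lie in the same basic set. -/
def rel (x y : G) : Prop := ∃ X ∈ A.basic, x ∈ X ∧ y ∈ X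

variable {A}

theorem eq_of_mem {X Y : Set G} (hX : X ∈ A.basic) (hY : Y ∈ A.basic) {g : G} (h1 : g ∈ X)
    (h2 : g ∈ Y) : X = Y :=
  (A.cover g).unique ⟨hX, h1⟩ ⟨hY, h2⟩

theorem rel_equiv : Equivalence A.rel where
  refl x := by
    obtain ⟨X, ⟨hX, hx⟩, -⟩ := A.cover x
    exact ⟨X, hX, hx, hx⟩
  symm := by
    rintro x y ⟨X, hX, hx, hy⟩
    exact ⟨X, hX, hy, hx⟩
  trans := by
    rintro x y z ⟨X, hX, hx, hy⟩ ⟨Y, hY, hy', hz⟩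
    obtain rfl := eq_of_mem hX hY hy hy'
    exact ⟨X, hX, hx, hz⟩

theorem rel_iff_mem {X : Set G} (hX : X ∈ A.basic) {x y : G} (hx : x ∈ X) :
    A.rel x y ↔ y ∈ X := by
  constructor
  · rintro ⟨Y, hY, hx', hy⟩
    rwa [eq_of_mem hX hY hx hx']
  · exact fun hy => ⟨X, hX, hx, hy⟩

theorem mem_basic_iff {X : Set G} : X ∈ A.basic ↔ ∃ x, X = {y | A.rel x y} := by
  constructor
  · intro hX
    obtain ⟨x, hx⟩ := A.nonempty X hX
    exact ⟨x, Set.ext fun y => (rel_iff_mem hX hx).symm⟩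
  · rintro ⟨x, rfl⟩
    obtain ⟨X, ⟨hX, hx⟩, -⟩ := A.cover x
    convert hX using 1
    exact Set.ext fun y => rel_iff_mem hX hx

theorem rel_one {x : G} (h : A.rel 1 x) : x = 1 :=
  (rel_iff_mem A.one_mem (Set.mem_singleton _)).1 h

theorem rel_inv {x y : G} (h : A.rel x y) : A.rel x⁻¹ y⁻¹ := by
  obtain ⟨X, hX, hx, hy⟩ := h
  exact ⟨X⁻¹, A.inv_mem X hX, by simpa using hx, by simpa using hy⟩

theorem mem_span_iff {a : MonoidAlgebra ℤ G} :
    a ∈ A.span ↔ ∀ x y, A.rel x y → a.coeff x = a.coeff y := by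
  classical
  constructor
  · intro ha x y hxy
    refine Submodule.span_induction (p := fun a _ => a.coeff x = a.coeff y) ?_ rfl ?_ ?_ ha
    · rintro _ ⟨X, hX, rfl⟩
      rw [coeff_sumElems, coeff_sumElems]
      have : x ∈ X ↔ y ∈ X := by
        constructor
        · exact fun h => (rel_iff_mem hX h).1 hxy
        · exact fun h => (rel_iff_mem hX h).1 (rel_equiv.symm hxy)
      simp [this]
    · intro a b _ _ h1 h2
      simp [h1, h2]
    · intro n a _ h
      rw [MonoidAlgebra.coeff_smul_apply, MonoidAlgebra.coeff_smul_apply, h]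
  · intro h
    have hfin : A.basic.Finite := Set.toFinite _
    have key : a = ∑ X ∈ hfin.toFinset.attach,
        a.coeff (A.nonempty X.1 (hfin.mem_toFinset.1 X.2)).some • sumElems X.1 := by
      ext g
      obtain ⟨X, ⟨hX, hg⟩, -⟩ := A.cover g
      rw [MonoidAlgebra.coeff_sum, Finsupp.finsetSum_apply]
      rw [Finset.sum_eq_single (⟨X, hfin.mem_toFinset.2 hX⟩ : {x // x ∈ hfin.toFinset})]
      · rw [MonoidAlgebra.coeff_smul_apply, coeff_sumElems, if_pos hg, smul_eq_mul, mul_one]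
        exact h _ _ ⟨X, hX, hg, (A.nonempty X hX).some_mem⟩
      · rintro ⟨Y, hY⟩ - hne
        rw [MonoidAlgebra.coeff_smul_apply, coeff_sumElems, if_neg, smul_zero]
        intro hgY
        exact hne (Subtype.ext (eq_of_mem (hfin.mem_toFinset.1 hY) hX hgY hg))
      · intro h
        exact absurd (Finset.mem_attach _ _) h
    rw [key]
    refine Submodule.sum_mem _ fun X _ => Submodule.smul_mem _ _ ?_
    exact Submodule.subset_span ⟨X.1, hfin.mem_toFinset.1 X.2, rfl⟩

theorem isASet_iff {X : Set G} : A.IsASet X ↔ ∀ x y, A.rel x y → x ∈ X → y ∈ X := by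
  classical
  rw [IsASet, mem_span_iff]
  simp only [coeff_sumElems]
  constructor
  · intro h x y hxy hx
    have := h x y hxy
    rw [if_pos hx] at this
    by_contra hy
    rw [if_neg hy] at this
    exact one_ne_zero this
  · intro h x y hxy
    have : x ∈ X ↔ y ∈ X := ⟨h x y hxy, h y x (rel_equiv.symm hxy)⟩
    simp [this]

theorem conv_rel [Fintype G] {f g : G → ℤ} (hf : ∀ x y, A.rel x y → f x = f y)
    (hg : ∀ x y, A.rel x y → g x = g y) {x y : G} (h : A.rel x y) :
    ∑ t, f t * g (t⁻¹ * x) = ∑ t, f t * g (t⁻¹ * y) := by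
  classical
  set el : (G → ℤ) → MonoidAlgebra ℤ G := fun f => ∑ t, MonoidAlgebra.single t (f t) with hel
  have hc : ∀ (f : G → ℤ) (x : G), (el f).coeff x = f x := by
    intro f x
    rw [hel]
    dsimp only
    rw [MonoidAlgebra.coeff_sum, Finsupp.finsetSum_apply]
    simp only [MonoidAlgebra.coeff_single, Finsupp.single_apply]
    simp
  have hm : ∀ f : G → ℤ, (∀ x y, A.rel x y → f x = f y) → el f ∈ A.span := by
    intro f hf
    rw [mem_span_iff]
    intro x y hxy
    rw [hc, hc, hf x y hxy]
  have h1 := mem_span_iff.1 (A.mul_mem _ _ (hm f hf) (hm g hg)) x y h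
  have h2 : ∀ x, (el f * el g).coeff x = ∑ t, f t * g (t⁻¹ * x) := by
    intro x
    conv_lhs => rw [hel]
    dsimp only
    rw [Finset.sum_mul, MonoidAlgebra.coeff_sum, Finsupp.finsetSum_apply]
    refine Finset.sum_congr rfl fun t _ => ?_
    rw [MonoidAlgebra.coeff_single_mul_apply]
    congr 1
    exact hc g _
  rwa [h2, h2] at h1

end SRing

variable {G : Type*} [CommGroup G] [Finite G] {Γ : Type*} [AddCommGroup Γ] [Fintype Γ]

/-- The underlying bijection of an isomorphism from an additive to a multiplicative group. -/
def tr (φ : Multiplicative Γ ≃* G) : Γ ≃ G := Multiplicative.ofAdd.trans φ.toEquiv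

section tr

variable (φ : Multiplicative Γ ≃* G)

theorem tr_add (x y : Γ) : tr φ (x + y) = tr φ x * tr φ y := φ.map_mul _ _

theorem tr_zero : tr φ 0 = 1 := φ.map_one

theorem tr_neg (x : Γ) : tr φ (-x) = (tr φ x)⁻¹ := φ.map_inv _

theorem tr_sub (x y : Γ) : tr φ (x - y) = tr φ x * (tr φ y)⁻¹ := by
  rw [sub_eq_add_neg, tr_add, tr_neg]

theorem tr_nsmul (n : ℕ) (x : Γ) : tr φ (n • x) = tr φ x ^ n := map_pow φ _ _

/-- The image of an additive subgroup. -/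
def img (W : AddSubgroup Γ) : Subgroup G where
  carrier := tr φ '' W
  one_mem' := ⟨0, W.zero_mem, tr_zero φ⟩
  mul_mem' := by
    rintro _ _ ⟨a, ha, rfl⟩ ⟨b, hb, rfl⟩
    exact ⟨a + b, W.add_mem ha hb, tr_add φ a b⟩
  inv_mem' := by
    rintro _ ⟨a, ha, rfl⟩
    exact ⟨-a, W.neg_mem ha, tr_neg φ a⟩

variable {φ}

@[simp] theorem tr_mem_img {W : AddSubgroup Γ} {x : Γ} : tr φ x ∈ img φ W ↔ x ∈ W := by
  constructor
  · rintro ⟨y, hy, h⟩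
    rwa [← (tr φ).injective h]
  · exact fun h => ⟨x, h, rfl⟩

theorem img_mono {W W' : AddSubgroup Γ} (h : W ≤ W') : img φ W ≤ img φ W' := by
  rintro _ ⟨x, hx, rfl⟩
  exact ⟨x, h hx, rfl⟩

theorem img_ne_bot {W : AddSubgroup Γ} (h : W ≠ ⊥) : img φ W ≠ ⊥ := by
  intro h'
  refine h ((AddSubgroup.eq_bot_iff_forall _).2 fun x hx => ?_)
  have : tr φ x ∈ img φ W := tr_mem_img.2 hx
  rw [h', Subgroup.mem_bot, ← tr_zero φ] at this
  exact (tr φ).injective this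

theorem img_ne_top {W : AddSubgroup Γ} (h : W ≠ ⊤) : img φ W ≠ ⊤ := by
  intro h'
  refine h ((AddSubgroup.eq_top_iff' _).2 fun x => ?_)
  have : tr φ x ∈ img φ W := h' ▸ Subgroup.mem_top _
  exact tr_mem_img.1 this

theorem card_img (W : AddSubgroup Γ) : Nat.card (img φ W) = Nat.card W :=
  (Nat.card_congr ((tr φ).image (W : Set Γ))).symm

/-- Cosets of a subgroup and of its image. -/
def quotTr (φ : Multiplicative Γ ≃* G) (W : AddSubgroup Γ) : Γ ⧸ W ≃ G ⧸ img φ W :=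
  Quotient.congr (tr φ) (by
    intro a b
    rw [QuotientAddGroup.leftRel_apply, QuotientGroup.leftRel_apply, ← tr_neg, ← tr_add,
      tr_mem_img])

end tr

/-- The Schur partition on `Γ` corresponding to an S-ring over an isomorphic group. -/
def SRing.toSch (A : SRing G) (φ : Multiplicative Γ ≃* G) : Sch Γ where
  r x y := A.rel (tr φ x) (tr φ y)
  eqv := ⟨fun _ => rel_equiv.refl _, rel_equiv.symm, rel_equiv.trans⟩
  zero := by
    intro x h
    rw [tr_zero] at h
    rw [← (tr φ).injective.eq_iff, tr_zero, rel_one h]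
  neg := by
    intro x y h
    rw [tr_neg, tr_neg]
    exact rel_inv h
  conv := by
    intro f g hf hg x y h
    have := Fintype.ofFinite G
    have h1 := conv_rel (A := A) (f := f ∘ (tr φ).symm) (g := g ∘ (tr φ).symm)
      (fun a b hab => hf _ _ (by simpa using hab)) (fun a b hab => hg _ _ (by simpa using hab)) h
    have key : ∀ x, ∑ t, (f ∘ (tr φ).symm) t * (g ∘ (tr φ).symm) (t⁻¹ * tr φ x) =
        ∑ t, f t * g (x - t) := by
      intro x
      rw [← (tr φ).sum_comp]
      refine Finset.sum_congr rfl fun t _ => ?_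
      simp only [Function.comp_apply, Equiv.symm_apply_apply]
      rw [mul_comm (tr φ t)⁻¹, ← tr_sub, Equiv.symm_apply_apply]
    rwa [key, key] at h1

variable {A : SRing G} {φ : Multiplicative Γ ≃* G}

theorem isASubgroup_img {W : AddSubgroup Γ} (h : (A.toSch φ).Isub W) :
    A.IsASubgroup (img φ W) := by
  refine SRing.isASet_iff.2 ?_
  rintro _ y hxy ⟨x, hx, rfl⟩
  obtain ⟨y, rfl⟩ := (tr φ).surjective y
  exact ⟨y, h x y hxy hx, rfl⟩

theorem minP_of_inSup2Min {K : Subgroup (Equiv.Perm G)} (hK : InSup2Min K)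
    (hA : A.basic = VBasic K) : (A.toSch φ).MinP := by
  have hrel : ∀ x y, A.rel x y ↔ ∃ k ∈ K, k 1 = 1 ∧ k x = y := by
    intro x y
    rw [SRing.rel, hA]
    exact mem_VBasic_class
  intro U hU q k hq hk x
  have hidx : (img φ U).index = q ^ k := by
    rw [← hk]
    exact (Nat.card_congr (quotTr φ U)).symm
  obtain ⟨j, hj⟩ := hK.ncard_image (U := img φ U) (by
    rintro k hk h1 _ ⟨u, hu, rfl⟩
    obtain ⟨v, hv⟩ := (tr φ).surjective (k (tr φ u))
    refine ⟨v, hU u v ?_ hu, hv⟩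
    exact (hrel _ _).2 ⟨k, hk, h1, hv.symm⟩) hq hidx (tr φ x)
  refine ⟨j, ?_⟩
  rw [← hj, ← Set.ncard_image_of_injective _ (quotTr φ U).injective]
  congr 1
  ext z
  constructor
  · rintro ⟨_, ⟨y, hy, rfl⟩, rfl⟩
    exact ⟨tr φ y, (hrel _ _).1 hy, rfl⟩
  · rintro ⟨y, hy, rfl⟩
    obtain ⟨y, rfl⟩ := (tr φ).surjective y
    exact ⟨_, ⟨y, (hrel _ _).2 hy, rfl⟩, rfl⟩

end

section

variable {G : Type*} [CommGroup G] [Finite G]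

section Cyclic

variable {A : SRing G}

theorem SRing.autGSet_mul_inv {σ τ : MulAut G} (hσ : σ ∈ A.autGSet) (hτ : τ ∈ A.autGSet) :
    σ * τ⁻¹ ∈ A.autGSet := by
  intro X hX
  have h1 : Prod.map σ σ '' Rel X = Rel X := hσ X hX
  have h2 : Prod.map τ τ '' Rel X = Rel X := hτ X hX
  change (fun z : G × G => (σ (τ⁻¹ z.1), σ (τ⁻¹ z.2))) '' Rel X = Rel X
  conv_lhs => rw [← h2]
  rw [Set.image_image]
  refine Eq.trans (Set.image_congr fun z _ => ?_) h1
  exact Prod.ext (congrArg σ (MulAut.inv_apply_self ..)) (congrArg σ (MulAut.inv_apply_self ..))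

theorem SRing.one_mem_autGSet : (1 : MulAut G) ∈ A.autGSet := by
  intro X hX
  exact Set.image_id _

/-- S-rings over cyclic groups are Cayley minimal. -/
theorem isCayleyMinimal_of_isCyclic [IsCyclic G] (A : SRing G) : A.IsCayleyMinimal := by
  intro K hK
  obtain ⟨g, hg⟩ := IsCyclic.exists_generator (α := G)
  have hext : ∀ σ τ : MulAut G, σ g = τ g → σ = τ := by
    intro σ τ h
    ext x
    obtain ⟨n, rfl⟩ := Subgroup.mem_zpowers_iff.1 (hg x)
    rw [map_zpow, map_zpow, h]
  ext σ
  constructor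
  · intro hσ
    have hmem : (fun φ : MulAut G => φ g) '' (K : Set (MulAut G)) ∈ setOrbits A.autGSet :=
      hK ▸ ⟨g, rfl⟩
    obtain ⟨h, hh⟩ : ∃ h, (fun φ : MulAut G => φ h) '' A.autGSet =
      (fun φ : MulAut G => φ g) '' (K : Set (MulAut G)) := hmem
    obtain ⟨δ, hδ, h1⟩ : g ∈ (fun φ : MulAut G => φ h) '' A.autGSet :=
      by rw [hh]; exact ⟨1, K.one_mem, rfl⟩
    obtain ⟨δ', hδ', h2⟩ : σ g ∈ (fun φ : MulAut G => φ h) '' A.autGSet :=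
      by rw [hh]; exact ⟨σ, hσ, rfl⟩
    have : σ = δ' * δ⁻¹ := by
      refine hext _ _ ?_
      rw [← h2, ← h1]
      simp
    rw [this]
    exact SRing.autGSet_mul_inv hδ' hδ
  · intro hσ
    have hmem : (fun φ : MulAut G => φ g) '' A.autGSet ∈ setOrbits (K : Set (MulAut G)) :=
      hK ▸ ⟨g, rfl⟩
    obtain ⟨h, hh⟩ : ∃ h, (fun φ : MulAut G => φ h) '' (K : Set (MulAut G)) =
      (fun φ : MulAut G => φ g) '' A.autGSet := hmem
    obtain ⟨δ, hδ, h1⟩ : g ∈ (fun φ : MulAut G => φ h) '' (K : Set (MulAut G)) :=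
      by rw [hh]; exact ⟨1, SRing.one_mem_autGSet, rfl⟩
    obtain ⟨δ', hδ', h2⟩ : σ g ∈ (fun φ : MulAut G => φ h) '' (K : Set (MulAut G)) :=
      by rw [hh]; exact ⟨σ, hσ, rfl⟩
    have : σ = δ' * δ⁻¹ := by
      refine hext _ _ ?_
      rw [← h2, ← h1]
      simp
    rw [this]
    exact K.mul_mem hδ' (K.inv_mem hδ)

end Cyclic

variable {Γ : Type*} [AddCommGroup Γ] [Fintype Γ] {A : SRing G} {φ : Multiplicative Γ ≃* G}

theorem mem_basic_iff_cl {X : Set G} : X ∈ A.basic ↔ ∃ x, X = tr φ '' (A.toSch φ).cl x := by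
  rw [SRing.mem_basic_iff]
  constructor
  · rintro ⟨g, rfl⟩
    obtain ⟨x, rfl⟩ := (tr φ).surjective g
    refine ⟨x, ?_⟩
    ext g
    constructor
    · intro hg
      obtain ⟨y, rfl⟩ := (tr φ).surjective g
      exact ⟨y, hg, rfl⟩
    · rintro ⟨y, hy, rfl⟩
      exact hy
  · rintro ⟨x, rfl⟩
    refine ⟨tr φ x, ?_⟩
    ext g
    constructor
    · rintro ⟨y, hy, rfl⟩
      exact hy
    · intro hg
      obtain ⟨y, rfl⟩ := (tr φ).surjective g
      exact ⟨y, hg, rfl⟩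

theorem ncard_basic_eq_two (h : ∀ x y : Γ, x ≠ 0 → y ≠ 0 → (A.toSch φ).r x y) {z : Γ}
    (hz : z ≠ 0) : A.basic.ncard = 2 := by
  have h1 : A.basic = {{1}, {1}ᶜ} := by
    have hcl : ∀ x : Γ, x ≠ 0 → tr φ '' (A.toSch φ).cl x = {1}ᶜ := by
      intro x hx
      ext g
      obtain ⟨y, rfl⟩ := (tr φ).surjective g
      rw [(tr φ).injective.mem_set_image, Set.mem_compl_iff, Set.mem_singleton_iff, ← tr_zero φ,
        (tr φ).injective.eq_iff]
      constructor
      · intro hy h0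
        subst h0
        exact hx (Sch.zero' (s := A.toSch φ) hy)
      · exact fun hy => h x y hx hy
    have hcl0 : tr φ '' (A.toSch φ).cl 0 = {1} := by
      ext g
      obtain ⟨y, rfl⟩ := (tr φ).surjective g
      rw [(tr φ).injective.mem_set_image, Set.mem_singleton_iff, ← tr_zero φ,
        (tr φ).injective.eq_iff]
      constructor
      · exact fun hy => (A.toSch φ).zero y hy
      · rintro rfl
        exact Sch.self_mem_cl _
    ext X
    rw [mem_basic_iff_cl (φ := φ)]
    constructor
    · rintro ⟨x, rfl⟩
      by_cases hx : x = 0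
      · subst hx
        exact Or.inl hcl0
      · exact Or.inr (hcl x hx)
    · rintro (rfl | rfl)
      · exact ⟨0, hcl0.symm⟩
      · exact ⟨z, (hcl z hz).symm⟩
  rw [h1]
  refine Set.ncard_pair fun h => ?_
  have : (1 : G) ∈ ({1}ᶜ : Set G) := h ▸ Set.mem_singleton _
  exact this rfl

theorem tensorConclusion_of {U W : AddSubgroup Γ} (hU : U ≠ ⊥) (hW : W ≠ ⊥)
    (hUs : (A.toSch φ).Isub U) (hWs : (A.toSch φ).Isub W) (hinf : U ⊓ W = ⊥) (hsup : U ⊔ W = ⊤)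
    (h : ∀ a ∈ U, ∀ a' ∈ U, ∀ b ∈ W, ∀ b' ∈ W, (A.toSch φ).r a a' → (A.toSch φ).r b b' →
      (A.toSch φ).r (a + b) (a' + b')) : TensorConclusion A := by
  have hU' : U ≠ ⊤ := by
    rintro rfl
    exact hW (by simpa using hinf)
  have hW' : W ≠ ⊤ := by
    rintro rfl
    exact hU (by simpa using hinf)
  have hdec : ∀ x : Γ, ∃ a ∈ U, ∃ b ∈ W, a + b = x := fun x =>
    AddSubgroup.mem_sup.1 (hsup ▸ AddSubgroup.mem_top x)
  have huniq : ∀ a ∈ U, ∀ a' ∈ U, ∀ b ∈ W, ∀ b' ∈ W, a + b = a' + b' → a = a' ∧ b = b' := by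
    intro a ha a' ha' b hb b' hb' he
    have h1 : a - a' = b' - b := by
      rw [sub_eq_sub_iff_add_eq_add, he, add_comm]
    have h2 : a - a' ∈ U ⊓ W := ⟨U.sub_mem ha ha', h1 ▸ W.sub_mem hb' hb⟩
    rw [hinf, AddSubgroup.mem_bot, sub_eq_zero] at h2
    subst h2
    exact ⟨rfl, add_left_cancel he⟩
  have hcl : ∀ a ∈ U, ∀ b ∈ W, (A.toSch φ).cl (a + b) = (A.toSch φ).cl a + (A.toSch φ).cl b := by
    intro a ha b hb
    ext x
    constructor
    · intro hx
      have h1 : (A.toSch φ).Inv ((A.toSch φ).cl a + (W : Set Γ)) := (Sch.cl_inv a).add hWs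
      have h2 : (A.toSch φ).Inv ((U : Set Γ) + (A.toSch φ).cl b) :=
        Sch.Inv.add hUs (Sch.cl_inv b)
      obtain ⟨a', ha', b', hb', rfl⟩ := h1 _ _ hx ⟨a, Sch.self_mem_cl a, b, hb, rfl⟩
      obtain ⟨a'', ha'', b'', hb'', he⟩ := h2 _ _ hx ⟨a, ha, b, Sch.self_mem_cl b, rfl⟩
      have := huniq a'' ha'' a' (hUs _ _ ha' ha) b'' (hWs _ _ hb'' hb) b' hb' he
      rw [this.2] at hb''
      exact ⟨a', ha', b', hb'', rfl⟩
    · rintro ⟨a', ha', b', hb', rfl⟩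
      exact h a ha a' (hUs _ _ ha' ha) b hb b' (hWs _ _ hb' hb) ha' hb'
  have himg : ∀ S T : Set Γ, tr φ '' (S + T) = tr φ '' S * tr φ '' T := by
    intro S T
    exact Set.image_image2_distrib (tr_add φ)
  refine ⟨img φ U, img φ W, img_ne_bot hU, img_ne_top hU', img_ne_bot hW, img_ne_top hW',
    isASubgroup_img hUs, isASubgroup_img hWs, ?_, ?_, ?_⟩
  · refine (Subgroup.eq_bot_iff_forall _).2 fun g hg => ?_
    obtain ⟨x, rfl⟩ := (tr φ).surjective g
    have : x ∈ U ⊓ W := ⟨tr_mem_img.1 hg.1, tr_mem_img.1 hg.2⟩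
    rw [hinf, AddSubgroup.mem_bot] at this
    rw [this, tr_zero]
  · refine (Subgroup.eq_top_iff' _).2 fun g => ?_
    obtain ⟨x, rfl⟩ := (tr φ).surjective g
    obtain ⟨a, ha, b, hb, rfl⟩ := hdec x
    rw [tr_add]
    exact Subgroup.mul_mem_sup (tr_mem_img.2 ha) (tr_mem_img.2 hb)
  · ext Z
    constructor
    · intro hZ
      obtain ⟨x, rfl⟩ := (mem_basic_iff_cl (φ := φ)).1 hZ
      obtain ⟨a, ha, b, hb, rfl⟩ := hdec x
      refine ⟨_, mem_basic_iff_cl.2 ⟨a, rfl⟩, _, mem_basic_iff_cl.2 ⟨b, rfl⟩,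
        Set.image_mono fun y hy => hUs _ _ hy ha, Set.image_mono fun y hy => hWs _ _ hy hb, ?_⟩
      rw [hcl a ha b hb, himg]
    · rintro ⟨X, hX, Y, hY, hXU, hYW, rfl⟩
      obtain ⟨a, rfl⟩ := (mem_basic_iff_cl (φ := φ)).1 hX
      obtain ⟨b, rfl⟩ := (mem_basic_iff_cl (φ := φ)).1 hY
      have ha : a ∈ U := tr_mem_img.1 (hXU ⟨a, Sch.self_mem_cl a, rfl⟩)
      have hb : b ∈ W := tr_mem_img.1 (hYW ⟨b, Sch.self_mem_cl b, rfl⟩)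
      rw [← himg, ← hcl a ha b hb]
      exact mem_basic_iff_cl.2 ⟨_, rfl⟩

theorem wreathConclusion_of {p : ℕ} {U L : AddSubgroup Γ} (hle : L ≤ U)
    (hUs : (A.toSch φ).Isub U) (hLs : (A.toSch φ).Isub L) (hL : L ≠ ⊥) (hU : U ≠ ⊤)
    (hrad : ∀ x ∉ U, ∀ l ∈ L, (A.toSch φ).r x (x + l))
    (hc : CondCA A (img φ U) (img φ L) ∨ CondCA' A (img φ U) (img φ L) ∨
      CondCA'' p A (img φ U) (img φ L)) : WreathConclusion p A := by
  refine ⟨img φ U, img φ L, img_mono hle, isASubgroup_img hUs, isASubgroup_img hLs,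
    img_ne_bot hL, img_ne_top hU, ?_, hc⟩
  intro X hX hXU
  obtain ⟨x, rfl⟩ := (mem_basic_iff_cl (φ := φ)).1 hX
  have hx : x ∉ U := by
    intro hx
    exact hXU (Set.image_mono fun y hy => hUs _ _ hy hx)
  have hadd : ∀ l ∈ L, {tr φ l} * tr φ '' (A.toSch φ).cl x ⊆ tr φ '' (A.toSch φ).cl x := by
    rintro l hl _ ⟨_, rfl, _, ⟨y, hy, rfl⟩, rfl⟩
    refine ⟨y + l, Sch.trans' hy (hrad y (fun hyU => hx (hUs _ _ (Sch.symm' hy) hyU)) l hl), ?_⟩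
    rw [tr_add, mul_comm]
  rintro _ ⟨l, hl, rfl⟩
  have : {tr φ l} * tr φ '' (A.toSch φ).cl x = tr φ '' (A.toSch φ).cl x := by
    refine (hadd l hl).antisymm ?_
    have := Set.mul_subset_mul_left (s := {tr φ l}) (hadd (-l) (L.neg_mem hl))
    rwa [← mul_assoc, Set.singleton_mul_singleton, tr_neg, mul_inv_cancel,
      Set.singleton_one, one_mul] at this
  exact ⟨this, by rw [mul_comm]; exact this⟩

theorem condCA_of {U L : AddSubgroup Γ} (hUs : (A.toSch φ).Isub U)
    (h : ∀ x ∈ U, ∀ y, (A.toSch φ).r x y → y - x ∈ L) : CondCA A (img φ U) (img φ L) := by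
  have hsec : ∀ x : Γ, (hx : x ∈ U) → (QuotientGroup.mk '' (Subtype.val ⁻¹'
      (tr φ '' (A.toSch φ).cl x) : Set (img φ U)) :
        Set (img φ U ⧸ (img φ L).subgroupOf (img φ U))) =
      {QuotientGroup.mk ⟨tr φ x, tr_mem_img.2 hx⟩} := by
    intro x hx
    ext z
    constructor
    · rintro ⟨⟨_, _⟩, ⟨y, hy, rfl⟩, rfl⟩
      refine (QuotientGroup.eq.2 ?_).symm
      change (tr φ x)⁻¹ * tr φ y ∈ img φ L
      rw [mul_comm, ← tr_sub]
      exact tr_mem_img.2 (h x hx y hy)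
    · rintro rfl
      exact ⟨_, ⟨x, Sch.self_mem_cl x, rfl⟩, rfl⟩
  intro AS hAS
  rw [hAS]
  ext Z
  constructor
  · rintro ⟨X, hX, hXU, rfl⟩
    obtain ⟨x, rfl⟩ := (mem_basic_iff_cl (φ := φ)).1 hX
    exact ⟨_, (hsec x (tr_mem_img.1 (hXU ⟨x, Sch.self_mem_cl x, rfl⟩))).symm⟩
  · rintro ⟨s, rfl⟩
    induction s using QuotientGroup.induction_on with
    | H g =>
      obtain ⟨_, x, hx, rfl⟩ := g
      refine ⟨_, mem_basic_iff_cl.2 ⟨x, rfl⟩, ?_, (hsec x hx).symm⟩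
      exact Set.image_mono fun y hy => hUs _ _ hy hx

end

section

section Restrict

variable {G : Type*} [CommGroup G] [Finite G]
variable {Γ : Type*} [AddCommGroup Γ] [Fintype Γ] {A : SRing G} {φ : Multiplicative Γ ≃* G}

theorem mem_restrictBasic {U : AddSubgroup Γ} (hUs : (A.toSch φ).Isub U) {Y : Set (img φ U)} :
    Y ∈ restrictBasic A (img φ U) ↔
      ∃ x ∈ U, Y = Subtype.val ⁻¹' (tr φ '' (A.toSch φ).cl x) := by
  constructor
  · intro hY
    obtain ⟨x, hx⟩ := (mem_basic_iff_cl (φ := φ)).1 hY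
    have h1 : tr φ x ∈ Subtype.val '' Y := by
      rw [hx]
      exact ⟨x, Sch.self_mem_cl x, rfl⟩
    obtain ⟨u, -, hu⟩ := h1
    refine ⟨x, tr_mem_img.1 (hu ▸ u.2), ?_⟩
    rw [← hx, Set.preimage_image_eq _ Subtype.val_injective]
  · rintro ⟨x, hx, rfl⟩
    refine (mem_basic_iff_cl (φ := φ)).2 ⟨x, ?_⟩
    refine (Subtype.image_preimage_coe (img φ U : Set G) _).trans ?_
    rw [Set.inter_eq_right]
    exact Set.image_mono fun y hy => hUs _ _ hy hx

theorem isCyclotomic_of_multipliers {U : AddSubgroup Γ} (hUs : (A.toSch φ).Isub U)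
    (h : ∀ x ∈ U, ∀ y, (A.toSch φ).r x y → ∃ n : ℕ, n.Coprime (Fintype.card Γ) ∧ n • x = y ∧
      ∀ u ∈ U, (A.toSch φ).r u (n • u)) {AU : SRing (img φ U)}
    (hAU : AU.basic = restrictBasic A (img φ U)) : AU.IsCyclotomic := by
  set K : Subgroup (MulAut (img φ U)) :=
    { carrier := {σ | ∀ u, A.rel u.1 (σ u).1}
      one_mem' := fun u => SRing.rel_equiv.refl _
      mul_mem' := fun {σ τ} hσ hτ u => by
        have h1 : A.rel u.1 (τ u).1 := hτ u
        have h2 : A.rel (τ u).1 ((σ * τ) u).1 := hσ (τ u)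
        exact SRing.rel_equiv.trans h1 h2
      inv_mem' := fun {σ} hσ u => by
        have := hσ (σ⁻¹ u)
        rw [MulAut.apply_inv_self] at this
        exact SRing.rel_equiv.symm this } with hK
  have key : ∀ x : Γ, ∀ hx : x ∈ U, (Subtype.val ⁻¹' (tr φ '' (A.toSch φ).cl x) : Set (img φ U)) =
      (fun σ : MulAut (img φ U) => σ ⟨tr φ x, tr_mem_img.2 hx⟩) '' (K : Set (MulAut (img φ U))) := by
    intro x hx
    ext w
    constructor
    · rintro ⟨y, hy, hw⟩
      obtain ⟨n, hn, hxy, hall⟩ := h x hx y hy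
      have hc : (Nat.card (img φ U)).Coprime n := by
        rw [card_img]
        refine Nat.Coprime.coprime_dvd_left ?_ hn.symm
        rw [← Nat.card_eq_fintype_card]
        exact AddSubgroup.card_addSubgroup_dvd_card U
      refine ⟨MulEquiv.ofBijective (powMonoidHom n) (powCoprime hc).bijective, ?_, ?_⟩
      · rintro ⟨_, u, hu, rfl⟩
        have := hall u hu
        change A.rel (tr φ u) (tr φ u ^ n)
        rw [← tr_nsmul]
        exact this
      · refine Subtype.ext ?_
        change tr φ x ^ n = w.1
        rw [← hw, ← tr_nsmul, hxy]
    · rintro ⟨σ, hσ, rfl⟩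
      have h1 := hσ ⟨tr φ x, tr_mem_img.2 hx⟩
      obtain ⟨y, hy⟩ := (tr φ).surjective (σ ⟨tr φ x, tr_mem_img.2 hx⟩).1
      refine ⟨y, ?_, hy⟩
      change A.rel (tr φ x) (tr φ y)
      rw [hy]
      exact h1
  refine ⟨K, ?_⟩
  rw [hAU]
  ext Y
  rw [mem_restrictBasic hUs]
  constructor
  · rintro ⟨x, hx, rfl⟩
    exact ⟨_, (key x hx).symm⟩
  · rintro ⟨⟨_, x, hx, rfl⟩, rfl⟩
    exact ⟨x, hx, (key x hx).symm⟩

theorem smul_restrict {U : AddSubgroup Γ} {z : Γ} (hz : z ∈ U) {S : Set Γ} :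
    (⟨tr φ z, tr_mem_img.2 hz⟩ : img φ U) • (Subtype.val ⁻¹' (tr φ '' S) : Set (img φ U)) =
      Subtype.val ⁻¹' (tr φ '' {y | y - z ∈ S}) := by
  ext ⟨_, y, hy, rfl⟩
  rw [Set.mem_smul_set_iff_inv_smul_mem]
  change (tr φ z)⁻¹ * tr φ y ∈ tr φ '' S ↔ tr φ y ∈ tr φ '' _
  rw [mul_comm, ← tr_sub, (tr φ).injective.mem_set_image, (tr φ).injective.mem_set_image]
  rfl

theorem isCyclic_section {U L : Subgroup G} (hle : L ≤ U) {p : ℕ} (hp : p.Prime)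
    (hU : Nat.card U = 2 * p) (hL : Nat.card L = 2) : IsCyclic (U ⧸ L.subgroupOf U) := by
  have := Fact.mk hp
  refine isCyclic_of_prime_card (p := p) ?_
  have h1 := Subgroup.card_eq_card_quotient_mul_card_subgroup (L.subgroupOf U)
  rw [Nat.card_congr (Subgroup.subgroupOfEquivOfLe hle).toEquiv, hU, hL] at h1
  omega

end Restrict

open Sch Plane

variable {p : ℕ} {V : Type*} [AddCommGroup V] [Fintype V] [hP : Plane p V]
variable {G : Type*} [CommGroup G] [Finite G] {A : SRing G}
  {φ : Multiplicative (ZMod 4 × V) ≃* G}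

theorem card_prod' {Q : AddSubgroup V} (W : AddSubgroup (ZMod 4)) :
    Nat.card (W.prod Q) = Nat.card W * Nat.card Q := by
  rw [Nat.card_congr (W.prodEquiv Q).toEquiv, Nat.card_prod]

theorem card_Z2 : Nat.card Z2 = 2 := by
  have h : (Z2 : Set (ZMod 4)) = {0, 2} := rfl
  rw [← SetLike.coe_sort_coe, Nat.card_coe_set_eq, h]
  exact Set.ncard_pair (by decide)

theorem card_C2 : Nat.card (Z2.prod (⊥ : AddSubgroup V)) = 2 := by
  rw [card_prod', card_Z2]
  simp

variable (p) in
include hP in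
theorem exists_crt (a : ℕ) {k : ℕ} : ∃ n : ℕ, n ≡ a [MOD 4] ∧ n ≡ k [MOD p] := by
  have hc : Nat.Coprime 4 p := by
    have : Nat.Coprime 2 p := (Nat.coprime_two_left).2 hP.odd
    exact Nat.Coprime.pow_left 2 this
  obtain ⟨n, hn1, hn2⟩ := Nat.chineseRemainder hc a k
  exact ⟨n, hn1, hn2⟩

theorem smul_fst_congr {n a : ℕ} (h : n ≡ a [MOD 4]) (x : ZMod 4) : n • x = a • x := by
  rw [nsmul_eq_mul, nsmul_eq_mul, (ZMod.natCast_eq_natCast_iff n a 4).2 h]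

theorem exists_multiplier {s : Sch (ZMod 4 × V)} {Q : AddSubgroup V} (hQ : Nat.card Q = p)
    (hz : s.Inv {(2, 0)}) (hQs : s.Isub ((⊥ : AddSubgroup (ZMod 4)).prod Q)) :
    ∀ x ∈ Z2.prod Q, ∀ y, s.r x y → ∃ n : ℕ, n.Coprime (Fintype.card (ZMod 4 × V)) ∧ n • x = y ∧
      ∀ u ∈ Z2.prod Q, s.r u (n • u) := by
  have hshift : ∀ h ∈ Z2, ∀ x y, s.r x y → s.r ((h, 0) + x) ((h, 0) + y) := by
    rintro h (h0 | h2) x y hxy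
    · have h0' : h = 0 := h0
      subst h0'
      rwa [← Prod.zero_eq_mk, zero_add, zero_add]
    · have h2' : h = 2 := h2
      subst h2'
      exact single_add hz hxy
  rintro ⟨h, v⟩ ⟨hh, hv⟩ ⟨h', v'⟩ hxy
  have hh' : h ∈ Z2 := hh
  have hv' : v ∈ Q := hv
  have h1 := hshift (-h) (Z2.neg_mem hh') _ _ hxy
  rw [Prod.mk_add_mk, Prod.mk_add_mk, neg_add_cancel, zero_add, zero_add] at h1
  obtain ⟨h2, h3⟩ := hQs _ _ h1 ⟨rfl, hv'⟩
  have h2' : -h + h' = 0 := h2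
  have h3' : v' ∈ Q := h3
  have h4 : h' = h := (neg_add_eq_zero.1 h2').symm
  subst h4
  rw [h2'] at h1
  by_cases hv0 : v = 0
  · subst hv0
    have : v' = 0 := congrArg Prod.snd (s.zero _ h1)
    subst this
    exact ⟨1, Nat.coprime_one_left _, one_smul _ _, fun u _ => by rw [one_smul]; exact rfl' _⟩
  have hv'0 : v' ≠ 0 := by
    rintro rfl
    exact hv0 (congrArg Prod.snd (zero' h1))
  have hQv := zmultiples_eq_line hQ hv' hv0
  obtain ⟨k, -, rfl⟩ := (mem_zmultiples_iff (p := p)).1 (hQv.symm ▸ h3')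
  have hk : ¬ p ∣ k := by
    rintro ⟨c, rfl⟩
    exact hv'0 (by rw [mul_comm, mul_smul, hP.psmul, smul_zero])
  obtain ⟨n, hn1, hn2⟩ := exists_crt p (V := V) 1 (k := k)
  refine ⟨n, ?_, ?_, ?_⟩
  · rw [Fintype.card_prod, ZMod.card, hP.card]
    refine Nat.Coprime.mul_right ?_ (Nat.Coprime.pow_right 2 ?_)
    · exact (Nat.ModEq.gcd_eq hn1).trans (by norm_num)
    · have : n.gcd p = k.gcd p := Nat.ModEq.gcd_eq hn2
      rw [Nat.Coprime, this]
      exact ((Nat.Prime.coprime_iff_not_dvd hP.prime).2 hk).symm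
  · rw [Prod.smul_mk, smul_fst_congr hn1, one_smul, smul_congr hn2]
  · rintro ⟨a, w⟩ ⟨ha, hw⟩
    have ha' : a ∈ Z2 := ha
    have hw' : w ∈ Q := hw
    obtain ⟨m, -, rfl⟩ := (mem_zmultiples_iff (p := p)).1 (hQv.symm ▸ hw')
    rw [Prod.smul_mk, smul_fst_congr hn1, one_smul, smul_congr hn2, smul_comm]
    have h5 : s.r (0, m • v) (0, m • k • v) := by
      by_cases hm : p ∣ m
      · obtain ⟨c, rfl⟩ := hm
        rw [mul_comm, mul_smul, mul_smul, hP.psmul, hP.psmul]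
        exact rfl' _
      · exact scal_r p hm h1
    have h6 := hshift a ha' _ _ h5
    simpa using h6

theorem wreath_of_cyc (h : WrCyc p (A.toSch φ)) : WreathConclusion p A := by
  obtain ⟨hz, Q, hQ, hQs, hrad⟩ := h
  have hUs : (A.toSch φ).Isub (Z2.prod Q) := by
    have h1 := Inv.add (C2_sub hz) hQs
    unfold Isub
    convert h1 using 1
    ext ⟨h, v⟩
    constructor
    · rintro ⟨hh, hv⟩
      exact ⟨(h, 0), ⟨hh, rfl⟩, (0, v), ⟨rfl, hv⟩, by simp⟩
    · rintro ⟨⟨a, b⟩, ⟨ha, hb⟩, ⟨c, d⟩, ⟨hc, hd⟩, he⟩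
      have hb' : b = 0 := hb
      have hc' : c = 0 := hc
      subst hb' hc'
      have he1 : a + 0 = h := congrArg Prod.fst he
      have he2 : 0 + d = v := congrArg Prod.snd he
      rw [add_zero] at he1
      rw [zero_add] at he2
      subst he1 he2
      exact ⟨ha, hd⟩
  have hle : Z2.prod (⊥ : AddSubgroup V) ≤ Z2.prod Q := AddSubgroup.prod_mono le_rfl bot_le
  refine wreathConclusion_of hle hUs (C2_sub hz) C2_ne_bot ?_ ?_ (Or.inr (Or.inl ⟨Or.inl ?_, ?_⟩))
  · exact ne_top_of_notMem (x := (1, 0)) fun h => one_notMem_Z2 h.1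
  · intro x hx l hl
    rcases C2_mem.1 hl with rfl | rfl
    · rw [add_zero]
      exact rfl' _
    · exact hrad x hx
  · intro AU hAU
    exact isCyclotomic_of_multipliers hUs (exists_multiplier hQ hz hQs) hAU
  · intro AS _
    have := isCyclic_section (img_mono (φ := φ) hle) hP.prime
      (by rw [card_img, card_prod', card_Z2, hQ]) (by rw [card_img, card_C2])
    exact isCayleyMinimal_of_isCyclic AS

theorem isCyclic_img {Q : AddSubgroup V} (hQ : Nat.card Q = p) :
    IsCyclic (img φ ((⊤ : AddSubgroup (ZMod 4)).prod Q)) := by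
  obtain ⟨w, hw, hw0⟩ := (AddSubgroup.ne_bot_iff_exists_ne_zero.1 (line_ne_bot hQ) |> fun ⟨a, h⟩ =>
    (⟨a.1, a.2, fun h' => h (Subtype.ext h')⟩ : ∃ w, w ∈ Q ∧ w ≠ 0))
  have hQw := zmultiples_eq_line hQ hw hw0
  refine ⟨⟨tr φ (1, w), tr_mem_img.2 ⟨trivial, hw⟩⟩, ?_⟩
  rintro ⟨_, ⟨h, v⟩, ⟨-, hv⟩, rfl⟩
  have hv' : v ∈ Q := hv
  obtain ⟨m, -, rfl⟩ := (mem_zmultiples_iff (p := p)).1 (hQw.symm ▸ hv')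
  obtain ⟨n, hn1, hn2⟩ := exists_crt p (V := V) h.val (k := m)
  refine Subgroup.mem_zpowers_iff.2 ⟨n, Subtype.ext ?_⟩
  rw [zpow_natCast]
  change tr φ (1, w) ^ n = tr φ (h, m • w)
  rw [← tr_nsmul, Prod.smul_mk, smul_fst_congr hn1, smul_congr hn2, nsmul_eq_mul, mul_one,
    ZMod.natCast_zmod_val]

theorem wreath_of_exc (h : WrExc p (A.toSch φ)) : WreathConclusion p A := by
  obtain ⟨hz, Q, hQ, hUs, hQs, hrad, hone⟩ := h
  set U := (⊤ : AddSubgroup (ZMod 4)).prod Q with hU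
  set W := (⊥ : AddSubgroup (ZMod 4)).prod Q with hW
  have hle : Z2.prod (⊥ : AddSubgroup V) ≤ U := AddSubgroup.prod_mono le_top bot_le
  have hWU : W ≤ U := AddSubgroup.prod_mono le_top le_rfl
  have hodd : ∀ x ∈ U, x.1 ∉ Z2 → ∀ y, (A.toSch φ).r x y ↔ y - x ∈ W := by
    have h1 : ∀ x ∈ U, x.1 = 1 → ∀ y, (A.toSch φ).r x y ↔ y - x ∈ W := by
      intro x hx hx1 y
      have hx2 : x.2 ∈ Q := hx.2
      have h2 : (A.toSch φ).r (1, 0) x := (hone x).2 ⟨hx1, hx2⟩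
      have h3 : (A.toSch φ).r x y ↔ (A.toSch φ).r (1, 0) y :=
        ⟨fun h => trans' h2 h, fun h => trans' (symm' h2) h⟩
      have h4 : y - x ∈ W ↔ y.1 - x.1 = 0 ∧ y.2 - x.2 ∈ Q := Iff.rfl
      rw [h3, hone, h4, hx1, sub_eq_zero]
      exact and_congr_right fun _ => ⟨fun h => Q.sub_mem h hx2, fun h => by
        simpa using Q.add_mem h hx2⟩
    intro x hx hx1 y
    rcases not_Z2 hx1 with h | h
    · exact h1 x hx h y
    · rw [← neg_iff, h1 (-x) (U.neg_mem hx) (by rw [Prod.fst_neg, h]; decide),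
        ← neg_mem_iff]
      have : -(-y - -x) = y - x := by abel
      rw [this]
  have hcl : ∀ z : ZMod 4 × V, z.1 ∈ Z2 → z.2 = 0 → ∀ x : ZMod 4 × V,
      {y | y - z ∈ (A.toSch φ).cl x} = (A.toSch φ).cl (z + x) := by
    rintro ⟨h, v⟩ hh hv x
    have hv' : v = 0 := hv
    subst hv'
    ext y
    change (A.toSch φ).r x (y - (h, 0)) ↔ (A.toSch φ).r ((h, 0) + x) y
    rcases hh with h0 | h2
    · have h0' : h = 0 := h0
      subst h0'
      rw [← Prod.zero_eq_mk, zero_add, sub_zero]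
    · have h2' : h = 2 := h2
      subst h2'
      constructor
      · intro h
        have := single_add hz h
        rwa [add_sub_cancel] at this
      · intro h
        have := single_add hz h
        rwa [← add_assoc, zz, zero_add, add_comm, ← neg_z, ← sub_eq_add_neg] at this
  refine wreathConclusion_of hle hUs (C2_sub hz) C2_ne_bot ?_ ?_
    (Or.inr (Or.inr ⟨?_, isCyclic_img hQ, ?_, ?_⟩))
  · obtain ⟨w, hw⟩ := exists_notMem hQ
    exact ne_top_of_notMem (x := (0, w)) fun h => hw h.2
  · intro x hx l hl
    rcases C2_mem.1 hl with rfl | rfl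
    · rw [add_zero]
      exact rfl' _
    · exact hrad x hx
  · rw [card_img, hU, card_prod', hQ]
    simp
  · rw [card_img, card_C2]
  · intro AU hAU
    have hWset : ((img φ W).subgroupOf (img φ U) : Set (img φ U)) =
        Subtype.val ⁻¹' (tr φ '' (W : Set (ZMod 4 × V))) := rfl
    refine ⟨(img φ W).subgroupOf (img φ U), ?_, ?_, ?_⟩
    · refine SRing.isASet_iff.2 ?_
      rintro u w ⟨Y, hY, hu, hw⟩ huW
      rw [hAU] at hY
      exact SRing.isASet_iff.1 (isASubgroup_img hQs) u.1 w.1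
        ⟨_, hY, ⟨u, hu, rfl⟩, ⟨w, hw, rfl⟩⟩ huW
    · rw [Nat.card_congr (Subgroup.subgroupOfEquivOfLe (img_mono hWU)).toEquiv, card_img, hW,
        card_prod', hQ]
      simp
    · ext Z
      constructor
      · intro hZ
        rw [hAU, mem_restrictBasic hUs] at hZ
        obtain ⟨⟨h, v⟩, ⟨-, hv⟩, rfl⟩ := hZ
        have hv' : v ∈ Q := hv
        by_cases hh : h ∈ Z2
        · have hhU : ((h, 0) : ZMod 4 × V) ∈ U := ⟨trivial, Q.zero_mem⟩
          refine Or.inl ⟨⟨tr φ (h, 0), tr_mem_img.2 hhU⟩, ⟨(h, 0), ⟨hh, rfl⟩, rfl⟩,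
            Subtype.val ⁻¹' (tr φ '' (A.toSch φ).cl (0, v)), ?_, ?_, ?_⟩
          · rw [hAU, mem_restrictBasic hUs]
            exact ⟨(0, v), ⟨trivial, hv'⟩, rfl⟩
          · rw [hWset]
            exact Set.preimage_mono (Set.image_mono fun y hy => hQs _ _ hy ⟨rfl, hv'⟩)
          · refine Eq.trans ?_ (smul_restrict (S := (A.toSch φ).cl (0, v)) hhU).symm
            rw [hcl (h, 0) hh rfl]
            simp
        · have hhU : ((h, v) : ZMod 4 × V) ∈ U := ⟨trivial, hv'⟩
          refine Or.inr ⟨⟨tr φ (h, v), tr_mem_img.2 hhU⟩, ?_, ?_⟩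
          · intro hmem
            obtain ⟨a, ha, b, hb, hab⟩ := Subgroup.mem_sup.1 hmem
            obtain ⟨a', ha', haa⟩ := ha
            obtain ⟨b', hb', hbb⟩ := hb
            have h1 : a.1 * b.1 = tr φ (h, v) := congrArg Subtype.val hab
            have h2 : tr φ (a' + b') = tr φ (h, v) := by
              rw [tr_add, haa, hbb]
              exact h1
            have h3 := congrArg Prod.fst ((tr φ).injective h2)
            have h4 : b'.1 = 0 := hb'.1
            have h5 : a'.1 ∈ Z2 := ha'.1
            rw [Prod.fst_add, h4, add_zero] at h3
            have h3' : a'.1 = h := h3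
            exact hh (by rw [← h3']; exact h5)
          · rw [hWset]
            refine Eq.trans ?_ (smul_restrict (S := (W : Set (ZMod 4 × V))) hhU).symm
            congr 2
            ext y
            exact hodd _ hhU hh y
      · rintro (⟨l, hl, X, hX, hXW, rfl⟩ | ⟨u, hu, rfl⟩)
        · rw [hAU, mem_restrictBasic hUs] at hX
          obtain ⟨x, hx, rfl⟩ := hX
          obtain ⟨_, z, hzU, rfl⟩ := l
          have hzC : z ∈ Z2.prod (⊥ : AddSubgroup V) := tr_mem_img.1 hl
          rw [hAU, mem_restrictBasic hUs]
          refine ⟨z + x, U.add_mem hzU hx, ?_⟩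
          rw [← hcl z hzC.1 hzC.2]
          exact smul_restrict hzU
        · obtain ⟨_, x, hxU, rfl⟩ := u
          have hx : x.1 ∉ Z2 := by
            intro hx
            refine hu ?_
            have h1 : ((x.1, 0) : ZMod 4 × V) ∈ U := ⟨trivial, Q.zero_mem⟩
            have h2 : ((0, x.2) : ZMod 4 × V) ∈ U := ⟨trivial, hxU.2⟩
            refine Subgroup.mem_sup.2 ⟨⟨tr φ (x.1, 0), tr_mem_img.2 h1⟩, ⟨(x.1, 0), ⟨hx, rfl⟩, rfl⟩,
              ⟨tr φ (0, x.2), tr_mem_img.2 h2⟩, ⟨(0, x.2), ⟨rfl, hxU.2⟩, rfl⟩, Subtype.ext ?_⟩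
            change tr φ _ * tr φ _ = tr φ x
            rw [← tr_add]
            simp
          rw [hAU, mem_restrictBasic hUs]
          refine ⟨x, hxU, ?_⟩
          rw [hWset]
          refine (smul_restrict hxU).trans ?_
          congr 2
          ext y
          exact (hodd x hxU hx y).symm

theorem conclusion_of_concl (h : Concl p (A.toSch φ)) :
    A.basic.ncard = 2 ∨ TensorConclusion A ∨ WreathConclusion p A := by
  rcases h with h | ⟨U, W, hU, hW, hUs, hWs, hinf, hsup, h⟩ |
    ⟨U, L, hle, hUs, hLs, hL, hU, hrad, h⟩ | h | h
  · exact Or.inl (ncard_basic_eq_two h z_ne_zero)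
  · exact Or.inr (Or.inl (tensorConclusion_of hU hW hUs hWs hinf hsup h))
  · exact Or.inr (Or.inr (wreathConclusion_of hle hUs hLs hL hU hrad (Or.inl (condCA_of hUs h))))
  · exact Or.inr (Or.inr (wreath_of_cyc h))
  · exact Or.inr (Or.inr (wreath_of_exc h))

theorem plane_zmod (hp : p.Prime) (hodd : Odd p) [NeZero p] : Plane p (ZMod p × ZMod p) where
  prime := hp
  odd := hodd
  psmul v := by ext <;> simp
  card := by rw [Fintype.card_prod, ZMod.card, sq]

end

/-- Let `p` be an odd prime, `G = C₄ × C_p × C_p`,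
`K ∈ Sup₂^min(G_r)` and `𝒜 = V(K,G)`. Then `rk(𝒜) = 2`, or `𝒜` is a tensor
product of two S-rings over proper nontrivial subgroups, or `𝒜` is a nontrivial
`S = U/L`-wreath product satisfying one of (CA), (CA'), (CA''). -/
theorem stmt12 (p : ℕ) (hp : p.Prime) (hodd : Odd p)
    (G : Type*) [CommGroup G] [Finite G]
    (hG : Nonempty (G ≃* Multiplicative (ZMod 4) × Multiplicative (ZMod p) × Multiplicative (ZMod p)))
    (K : Subgroup (Equiv.Perm G)) (hK : InSup2Min K)
    (A : SRing G) (hA : A.basic = VBasic K) :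
    A.basic.ncard = 2 ∨ TensorConclusion A ∨ WreathConclusion p A := by
  obtain ⟨e⟩ := hG
  have : NeZero p := ⟨hp.ne_zero⟩
  have := plane_zmod hp hodd
  let φ : Multiplicative (ZMod 4 × ZMod p × ZMod p) ≃* G :=
    ((MulEquiv.prodMultiplicative _ _).trans
      ((MulEquiv.refl _).prodCongr (MulEquiv.prodMultiplicative _ _))).trans e.symm
  exact conclusion_of_concl (φ := φ) (Sch.MinP.concl (minP_of_inSup2Min hK hA))

end Paper
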